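/- arXiv:2411.16069 — 4 statements merged into one kernel-verified Lean document; each statement's English description precedes it below -/
import Mathlib

section
/- For any constant c > 0 and any 0 < δ < 1/14, there exist a constant C > 0 and N₀ such that for all N ≥ N₀ and all 𝔄, 𝔅 ⊆ {N+1, …, 2N} with |𝔄| ≥ cN and |𝔅| ≥ cN, there exist a ∈ 𝔄, b ∈ 𝔅 and a positive integer P with Ω(P) ≤ 6 such that |ab − P²| ≤ C · P^{1−δ}. -/
theorem norm_integral_exp_mul_I_le {ω : ℝ} (hω : ω ≠ 0) (s t : ℝ) :
    ‖∫ x in s..t, Complex.exp ((ω * x : ℝ) * Complex.I)‖ ≤ 2 / |ω| := by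
  have h0 : (ω : ℂ) * Complex.I ≠ 0 := by simp [hω]
  have h1 : ∀ x : ℝ, Complex.exp ((ω * x : ℝ) * Complex.I)
      = Complex.exp ((ω : ℂ) * Complex.I * x) := fun x => by
    congr 1; push_cast; ring
  simp_rw [h1]
  rw [integral_exp_mul_complex h0, norm_div]
  have h2 : ‖(ω : ℂ) * Complex.I‖ = |ω| := by simp
  rw [h2]
  gcongr
  refine (norm_sub_le _ _).trans ?_
  rw [← h1, ← h1, Complex.norm_exp_ofReal_mul_I, Complex.norm_exp_ofReal_mul_I]
  norm_num

theorem integral_norm_sq_exp_sum_le {ι : Type*} (B : Finset ι) (c : ι → ℂ) (ω : ι → ℝ)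
    (s t : ℝ) :
    ∫ x in s..t, ‖∑ b ∈ B, c b * Complex.exp ((ω b * x : ℝ) * Complex.I)‖ ^ 2
      ≤ ∑ b ∈ B, ∑ b' ∈ B, ‖c b‖ * ‖c b'‖ *
          ‖∫ x in s..t, Complex.exp (((ω b - ω b') * x : ℝ) * Complex.I)‖ := by
  have h1 : ∀ x : ℝ, ((‖∑ b ∈ B, c b * Complex.exp ((ω b * x : ℝ) * Complex.I)‖ ^ 2 : ℝ) : ℂ)
      = ∑ b ∈ B, ∑ b' ∈ B, (c b * (starRingEnd ℂ) (c b')) *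
          Complex.exp (((ω b - ω b') * x : ℝ) * Complex.I) := fun x => by
    push_cast
    rw [← Complex.mul_conj', map_sum, Finset.sum_mul_sum]
    refine Finset.sum_congr rfl fun b _ => Finset.sum_congr rfl fun b' _ => ?_
    rw [map_mul, ← Complex.exp_conj, map_mul, map_mul, Complex.conj_I, Complex.conj_ofReal,
      Complex.conj_ofReal]
    have : Complex.exp (((ω b : ℂ) - ω b') * x * Complex.I) =
      Complex.exp ((ω b * x : ℝ) * Complex.I) * Complex.exp ((ω b' * x : ℝ) * -Complex.I) := by
      rw [← Complex.exp_add]; congr 1; push_cast; ring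
    rw [this]; push_cast; ring
  have h2 : ((∫ x in s..t, ‖∑ b ∈ B, c b * Complex.exp ((ω b * x : ℝ) * Complex.I)‖ ^ 2 : ℝ) : ℂ)
      = ∑ b ∈ B, ∑ b' ∈ B, (c b * (starRingEnd ℂ) (c b')) *
          ∫ x in s..t, Complex.exp (((ω b - ω b') * x : ℝ) * Complex.I) := by
    rw [← intervalIntegral.integral_ofReal]
    simp_rw [h1]
    have hc : ∀ b b' : ι, Continuous fun x : ℝ => (c b * (starRingEnd ℂ) (c b')) *
          Complex.exp (((ω b - ω b') * x : ℝ) * Complex.I) := fun b b' => by fun_prop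
    rw [intervalIntegral.integral_finsetSum fun b _ =>
      (continuous_finsetSum _ fun b' _ => hc b b').intervalIntegrable _ _]
    refine Finset.sum_congr rfl fun b _ => ?_
    rw [intervalIntegral.integral_finsetSum fun b' _ => (hc b b').intervalIntegrable _ _]
    refine Finset.sum_congr rfl fun b' _ => ?_
    rw [intervalIntegral.integral_const_mul]
  refine (le_abs_self _).trans ?_
  rw [← Real.norm_eq_abs, ← Complex.norm_real, h2]
  refine (norm_sum_le _ _).trans (Finset.sum_le_sum fun b _ =>
    (norm_sum_le _ _).trans (Finset.sum_le_sum fun b' _ => ?_))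
  rw [norm_mul, norm_mul, RCLike.norm_conj]

theorem sum_inv_abs_sub_le {N : ℕ} {B : Finset ℕ} (hB : B ⊆ Finset.Icc (N + 1) (2 * N)) {b : ℕ}
    (hb : b ∈ Finset.Icc (N + 1) (2 * N)) :
    ∑ b' ∈ B.erase b, 1 / |(b : ℝ) - b'| ≤ 2 * (1 + Real.log N) := by
  have hH : ∑ k ∈ Finset.range N, 1 / ((k : ℝ) + 1) ≤ 1 + Real.log N := by
    have := harmonic_le_one_add_log N
    simpa [harmonic] using this
  have key : ∀ D : Finset ℕ, ∀ f : ℕ → ℕ, Set.InjOn f D → (∀ x ∈ D, f x < N) →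
      (∀ x ∈ D, |(b : ℝ) - x| = f x + 1) →
      ∑ b' ∈ D, 1 / |(b : ℝ) - b'| ≤ 1 + Real.log N := by
    intro D f hf hN hx
    refine le_trans ?_ hH
    rw [Finset.sum_congr rfl fun x hx' => by rw [hx x hx'],
      ← Finset.sum_image (f := fun k : ℕ => 1 / ((k : ℝ) + 1)) hf]
    refine Finset.sum_le_sum_of_subset_of_nonneg ?_ fun _ _ _ => by positivity
    intro k hk
    obtain ⟨x, hx', rfl⟩ := Finset.mem_image.1 hk
    exact Finset.mem_range.2 (hN x hx')
  rw [← Finset.sum_filter_add_sum_filter_not _ (fun x => x < b), two_mul]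
  simp only [Finset.mem_Icc] at hb
  refine add_le_add (key _ (fun x => b - x - 1) ?_ ?_ ?_) (key _ (fun x => x - b - 1) ?_ ?_ ?_)
  · intro x hx y hy h
    simp only [Finset.coe_filter, Finset.mem_erase, Set.mem_ofPred_eq] at hx hy h
    omega
  · intro x hx
    simp only [Finset.mem_filter, Finset.mem_erase] at hx
    have := Finset.mem_Icc.1 (hB hx.1.2)
    omega
  · intro x hx
    simp only [Finset.mem_filter, Finset.mem_erase] at hx
    have h1 : b = (b - x - 1) + 1 + x := by omega
    have h2 : (b : ℝ) = ((b - x - 1 : ℕ) : ℝ) + 1 + x := by exact_mod_cast h1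
    rw [abs_of_nonneg] <;> linarith [Nat.cast_nonneg (α := ℝ) (b - x - 1)]
  · intro x hx y hy h
    simp only [Finset.coe_filter, Finset.mem_erase, Set.mem_ofPred_eq] at hx hy h
    omega
  · intro x hx
    simp only [Finset.mem_filter, Finset.mem_erase] at hx
    have := Finset.mem_Icc.1 (hB hx.1.2)
    omega
  · intro x hx
    simp only [Finset.mem_filter, Finset.mem_erase] at hx
    have h1 : x = (x - b - 1) + 1 + b := by omega
    have h2 : (x : ℝ) = ((x - b - 1 : ℕ) : ℝ) + 1 + b := by exact_mod_cast h1
    rw [abs_of_nonpos] <;> linarith [Nat.cast_nonneg (α := ℝ) (x - b - 1)]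

theorem abs_sqrt_sub_sqrt_ge {N b b' : ℕ} (hN : 0 < N) (hb : b ≤ 2 * N) (hb' : b' ≤ 2 * N) :
    |(b : ℝ) - b'| / (3 * √N) ≤ |√(b : ℝ) - √(b' : ℝ)| := by
  have hN' : (0 : ℝ) < N := by exact_mod_cast hN
  have h0 : 0 < √(N : ℝ) := Real.sqrt_pos.2 hN'
  have hs : ∀ m : ℕ, m ≤ 2 * N → √(m : ℝ) ≤ 3 / 2 * √N := fun m hm => by
    have hm' : (m : ℝ) ≤ 2 * N := by exact_mod_cast hm
    rw [Real.sqrt_le_left (by positivity), mul_pow, Real.sq_sqrt hN'.le]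
    nlinarith
  have h1 : (b : ℝ) - b' = (√(b : ℝ) - √(b' : ℝ)) * (√(b : ℝ) + √(b' : ℝ)) := by
    have := Real.mul_self_sqrt (Nat.cast_nonneg (α := ℝ) b)
    have := Real.mul_self_sqrt (Nat.cast_nonneg (α := ℝ) b')
    linarith
  rw [h1, abs_mul, div_le_iff₀ (by positivity), abs_of_nonneg (a := √(b : ℝ) + √(b' : ℝ))
    (by positivity)]
  gcongr
  linarith [hs b hb, hs b' hb']

theorem integral_norm_sq_sqrt_sum_le {N : ℕ} (hN : 0 < N) {B : Finset ℕ}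
    (hB : B ⊆ Finset.Icc (N + 1) (2 * N)) {c : ℕ → ℂ} (hc : ∀ b ∈ B, ‖c b‖ ≤ 2) {θ : ℝ}
    (hθ : 0 < θ) {s t : ℝ} (hst : s ≤ t) :
    ∫ x in s..t, ‖∑ b ∈ B, c b * Complex.exp ((θ * √b * x : ℝ) * Complex.I)‖ ^ 2
      ≤ 4 * N * ((t - s) + 12 * √N * (1 + Real.log N) / θ) := by
  have hN' : (0 : ℝ) < N := by exact_mod_cast hN
  have h0 : 0 < √(N : ℝ) := Real.sqrt_pos.2 hN'
  have hL : 0 ≤ Real.log N := Real.log_natCast_nonneg N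
  refine (integral_norm_sq_exp_sum_le B c (fun b => θ * √b) s t).trans ?_
  have hrow : ∀ b ∈ B, ∑ b' ∈ B, ‖c b‖ * ‖c b'‖ *
      ‖∫ x in s..t, Complex.exp (((θ * √b - θ * √b') * x : ℝ) * Complex.I)‖
      ≤ 4 * ((t - s) + 12 * √N * (1 + Real.log N) / θ) := by
    intro b hb
    have hbI := Finset.mem_Icc.1 (hB hb)
    have hcc : ∀ b' ∈ B, ‖c b‖ * ‖c b'‖ ≤ 4 := fun b' hb' => by
      nlinarith [hc b hb, hc b' hb', norm_nonneg (c b), norm_nonneg (c b')]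
    rw [← Finset.add_sum_erase _ _ hb, mul_add]
    refine add_le_add ?_ ?_
    · refine mul_le_mul (hcc b hb) ?_ (norm_nonneg _) (by norm_num)
      simp only [sub_self, zero_mul, Complex.ofReal_zero, Complex.exp_zero]
      rw [intervalIntegral.integral_const, norm_smul, norm_one, mul_one,
        Real.norm_of_nonneg (sub_nonneg.2 hst)]
    · have h1 : ∀ b' ∈ B.erase b, ‖c b‖ * ‖c b'‖ *
          ‖∫ x in s..t, Complex.exp (((θ * √b - θ * √b') * x : ℝ) * Complex.I)‖
          ≤ 4 * (6 * √N / θ) * (1 / |(b : ℝ) - b'|) := by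
        intro b' hb'
        have hb'B := (Finset.mem_erase.1 hb').2
        have hb'I := Finset.mem_Icc.1 (hB hb'B)
        have hne : (b : ℝ) - b' ≠ 0 := by
          rw [sub_ne_zero]; exact_mod_cast (Finset.mem_erase.1 hb').1.symm
        have hpos : 0 < |(b : ℝ) - b'| := abs_pos.2 hne
        have hge := abs_sqrt_sub_sqrt_ge hN hbI.2 hb'I.2
        have hge' : 0 < |(b : ℝ) - b'| / (3 * √N) := by positivity
        have hω : θ * √b - θ * √b' ≠ 0 := by
          rw [← mul_sub]
          exact mul_ne_zero hθ.ne' (abs_pos.1 (hge'.trans_le hge))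
        rw [mul_assoc 4]
        refine mul_le_mul (hcc b' hb'B) ?_ (norm_nonneg _) (by norm_num)
        refine (norm_integral_exp_mul_I_le hω s t).trans ?_
        rw [← mul_sub, abs_mul, abs_of_pos hθ]
        calc 2 / (θ * |√(b : ℝ) - √(b' : ℝ)|)
            ≤ 2 / (θ * (|(b : ℝ) - b'| / (3 * √N))) := by gcongr
          _ = 6 * √N / θ * (1 / |(b : ℝ) - b'|) := by field_simp; norm_num
      refine (Finset.sum_le_sum h1).trans ?_
      rw [← Finset.mul_sum]
      calc 4 * (6 * √N / θ) * ∑ b' ∈ B.erase b, 1 / |(b : ℝ) - b'|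
          ≤ 4 * (6 * √N / θ) * (2 * (1 + Real.log N)) := by
            gcongr
            exact sum_inv_abs_sub_le hB (hB hb)
        _ = 4 * (12 * √N * (1 + Real.log N) / θ) := by ring
  refine (Finset.sum_le_sum hrow).trans ?_
  rw [Finset.sum_const, nsmul_eq_mul]
  have hcard : (B.card : ℝ) ≤ N := by
    have := Finset.card_le_card hB
    rw [Nat.card_Icc] at this
    exact_mod_cast (by omega : B.card ≤ N)
  have : 0 ≤ (t - s) + 12 * √N * (1 + Real.log N) / θ := by
    have := sub_nonneg.2 hst
    positivity
  calc (B.card : ℝ) * (4 * ((t - s) + 12 * √N * (1 + Real.log N) / θ))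
      ≤ N * (4 * ((t - s) + 12 * √N * (1 + Real.log N) / θ)) := by gcongr
    _ = _ := by ring
theorem two_mul_norm_integral_le {G : ℝ → ℂ} (hG : Continuous G) {a b c τ : ℝ} (hab : a ≤ b)
    (hbc : b ≤ c) (hτ : 0 < τ) :
    2 * ‖∫ x in a..b, G x‖ ≤ τ * (b - a) + (∫ x in a..c, ‖G x‖ ^ 2) / τ := by
  have h1 : ‖∫ x in a..b, G x‖ ≤ ∫ x in a..b, ‖G x‖ :=
    intervalIntegral.norm_integral_le_integral_norm hab
  have h2 : ∫ x in a..b, 2 * ‖G x‖ ≤ ∫ x in a..b, (τ + ‖G x‖ ^ 2 / τ) := by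
    refine intervalIntegral.integral_mono_on hab (by apply Continuous.intervalIntegrable; fun_prop)
      (by apply Continuous.intervalIntegrable; fun_prop) fun x _ => ?_
    have : τ + ‖G x‖ ^ 2 / τ - 2 * ‖G x‖ = (τ - ‖G x‖) ^ 2 / τ := by field_simp; ring
    have h : 0 ≤ (τ - ‖G x‖) ^ 2 / τ := by positivity
    linarith
  have h3 : ∫ x in a..b, (τ + ‖G x‖ ^ 2 / τ) = τ * (b - a) + (∫ x in a..b, ‖G x‖ ^ 2) / τ := by
    rw [intervalIntegral.integral_add (by simp)
      (by apply Continuous.intervalIntegrable; fun_prop), intervalIntegral.integral_div,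
      intervalIntegral.integral_const, smul_eq_mul, mul_comm]
  have h4 : ∫ x in a..b, ‖G x‖ ^ 2 ≤ ∫ x in a..c, ‖G x‖ ^ 2 :=
    intervalIntegral.integral_mono_interval le_rfl hab hbc
      (Filter.Eventually.of_forall fun x => by positivity)
      (by apply Continuous.intervalIntegrable; fun_prop)
  rw [intervalIntegral.integral_const_mul] at h2
  have h5 : (∫ x in a..b, ‖G x‖ ^ 2) / τ ≤ (∫ x in a..c, ‖G x‖ ^ 2) / τ := by gcongr
  linarith

theorem half_le_norm_average_exp {ω l : ℝ} (hl : 0 < l) (hω : 0 ≤ ω) (h : ω * l ≤ 1) :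
    1 / 2 ≤ ‖(l : ℂ)⁻¹ * ∫ x in (0 : ℝ)..l, Complex.exp ((ω * x : ℝ) * Complex.I)‖ := by
  have hInt : IntervalIntegrable (fun x : ℝ => Complex.exp ((ω * x : ℝ) * Complex.I))
    MeasureTheory.volume 0 l := by apply Continuous.intervalIntegrable; fun_prop
  have hre : (∫ x in (0 : ℝ)..l, Complex.exp ((ω * x : ℝ) * Complex.I)).re
      = ∫ x in (0 : ℝ)..l, Real.cos (ω * x) := by
    have := Complex.reCLM.intervalIntegral_comp_comm hInt
    simp only [Complex.reCLM_apply] at this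
    rw [← this]
    simp_rw [Complex.exp_ofReal_mul_I_re]
  have h1 : ∫ x in (0 : ℝ)..l, (1 / 2 : ℝ) ≤ ∫ x in (0 : ℝ)..l, Real.cos (ω * x) := by
    refine intervalIntegral.integral_mono_on hl.le (by simp)
      (by apply Continuous.intervalIntegrable; fun_prop) fun x hx => ?_
    have h2 : ω * x ≤ 1 := (mul_le_mul_of_nonneg_left hx.2 hω).trans h
    have h3 : 0 ≤ ω * x := mul_nonneg hω hx.1
    nlinarith [Real.one_sub_sq_div_two_le_cos (x := ω * x)]
  rw [intervalIntegral.integral_const, smul_eq_mul, sub_zero, ← hre] at h1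
  rw [norm_mul, norm_inv, Complex.norm_real, Real.norm_of_nonneg hl.le, le_inv_mul_iff₀ hl]
  exact h1.trans ((le_abs_self _).trans (Complex.abs_re_le_norm _))

/-- Double large sieve for the points `√a`, `√b` with `N < a, b ≤ 2N`. -/
theorem norm_sum_exp_sqrt_le {N : ℕ} (hN : 0 < N) {A B : Finset ℕ}
    (hA : A ⊆ Finset.Icc (N + 1) (2 * N)) (hB : B ⊆ Finset.Icc (N + 1) (2 * N)) {θ : ℝ}
    (hθ : 0 < θ) :
    ‖∑ a ∈ A, ∑ b ∈ B, Complex.exp ((θ * √b * √a : ℝ) * Complex.I)‖ ≤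
      16 * (N * √N) * √((1 + θ) * (1 + (1 + Real.log N) / θ)) := by
  have hN' : (0 : ℝ) < N := by exact_mod_cast hN
  have hr : 0 < √(N : ℝ) := Real.sqrt_pos.2 hN'
  have hL : 0 ≤ Real.log N := Real.log_natCast_nonneg N
  set r : ℝ := √(N : ℝ) with hrdef
  have hrsq : r ^ 2 = N := Real.sq_sqrt hN'.le
  set l : ℝ := 1 / (4 * r * (1 + θ)) with hl
  have hlpos : 0 < l := by positivity
  have hup : ∀ m : ℕ, m ≤ 2 * N + 1 → √(m : ℝ) ≤ 2 * r := fun m hm => by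
    have hm' : (m : ℝ) ≤ 2 * N + 1 := by exact_mod_cast hm
    have hN1 : (1 : ℝ) ≤ N := by exact_mod_cast hN
    rw [Real.sqrt_le_left (by positivity), mul_pow, hrsq]
    linarith
  have hgap : ∀ a : ℕ, a ≤ 2 * N → √(a : ℝ) + l ≤ √((a + 1 : ℕ) : ℝ) := fun a ha => by
    have h1 := hup a (by omega)
    have h2 := hup (a + 1) (by omega)
    have h3 := Real.mul_self_sqrt (Nat.cast_nonneg (α := ℝ) a)
    have h4 := Real.mul_self_sqrt (Nat.cast_nonneg (α := ℝ) (a + 1))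
    have h5 : (√((a + 1 : ℕ) : ℝ) - √(a : ℝ)) * (√((a + 1 : ℕ) : ℝ) + √(a : ℝ)) = 1 := by
      push_cast at *
      linarith
    have h6 : 0 ≤ √((a + 1 : ℕ) : ℝ) - √(a : ℝ) := by
      rw [sub_nonneg]; exact Real.sqrt_le_sqrt (by push_cast; linarith)
    have h7 : l ≤ 1 / (4 * r) := by
      rw [hl]
      exact one_div_le_one_div_of_le (by positivity) (by nlinarith [mul_pos hr hθ])
    have h8 : 1 / (4 * r) ≤ √((a + 1 : ℕ) : ℝ) - √(a : ℝ) := by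
      rw [div_le_iff₀ (by positivity)]
      calc (1 : ℝ) = _ := h5.symm
        _ ≤ _ := by gcongr; linarith
    linarith
  set m : ℕ → ℂ := fun b =>
    (l : ℂ)⁻¹ * ∫ x in (0 : ℝ)..l, Complex.exp ((θ * √b * x : ℝ) * Complex.I) with hm
  have hmb : ∀ b ∈ B, 1 / 2 ≤ ‖m b‖ := fun b hb => by
    have hb' := hup b (by have := Finset.mem_Icc.1 (hB hb); omega)
    refine half_le_norm_average_exp hlpos (by positivity) ?_
    rw [hl, mul_one_div, div_le_one (by positivity)]
    nlinarith [mul_le_mul_of_nonneg_left hb' hθ.le, mul_pos hr hθ]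
  set G : ℝ → ℂ := fun x =>
    ∑ b ∈ B, (m b)⁻¹ * Complex.exp ((θ * √b * x : ℝ) * Complex.I) with hG
  have hGc : Continuous G := by rw [hG]; fun_prop
  have hinner : ∀ a : ℕ, ∑ b ∈ B, Complex.exp ((θ * √b * √a : ℝ) * Complex.I)
      = (l : ℂ)⁻¹ * ∫ x in √(a : ℝ)..(√(a : ℝ) + l), G x := fun a => by
    rw [hG, intervalIntegral.integral_finsetSum fun b _ => by
      apply Continuous.intervalIntegrable; fun_prop, Finset.mul_sum]
    refine Finset.sum_congr rfl fun b hb => ?_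
    have hne : m b ≠ 0 := by
      rw [← norm_pos_iff]; linarith [hmb b hb]
    have hshift := intervalIntegral.integral_comp_add_left (a := 0) (b := l)
      (fun x : ℝ => Complex.exp ((θ * √b * x : ℝ) * Complex.I)) √(a : ℝ)
    rw [add_zero] at hshift
    rw [intervalIntegral.integral_const_mul, ← hshift]
    have h1 : ∀ x : ℝ, Complex.exp ((θ * √b * (√a + x) : ℝ) * Complex.I) =
        Complex.exp ((θ * √b * √a : ℝ) * Complex.I) *
          Complex.exp ((θ * √b * x : ℝ) * Complex.I) := fun x => by
      rw [← Complex.exp_add]; congr 1; push_cast; ring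
    simp_rw [h1]
    rw [intervalIntegral.integral_const_mul]
    have h2 : (l : ℂ)⁻¹ * ((m b)⁻¹ * (Complex.exp ((θ * √b * √a : ℝ) * Complex.I) *
        ∫ x in (0 : ℝ)..l, Complex.exp ((θ * √b * x : ℝ) * Complex.I)))
        = (m b)⁻¹ * m b * Complex.exp ((θ * √b * √a : ℝ) * Complex.I) := by
      rw [hm]; ring
    rw [h2, inv_mul_cancel₀ hne, one_mul]
  set E : ℝ := (1 + θ) * (1 + (1 + Real.log N) / θ) with hE
  have hEpos : 0 < E := by positivity
  set J : ℝ := ∫ x in √((N + 1 : ℕ) : ℝ)..√((N + 1 + N : ℕ) : ℝ), ‖G x‖ ^ 2 with hJ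
  have hJ0 : J ≤ 48 * (N * r) * (1 + (1 + Real.log N) / θ) := by
    have hlen : √((N + 1 + N : ℕ) : ℝ) - √((N + 1 : ℕ) : ℝ) ≤ r := by
      rw [sub_le_iff_le_add, Real.sqrt_le_left (by positivity), add_sq, hrsq,
        Real.sq_sqrt (by positivity)]
      push_cast
      nlinarith [mul_nonneg hr.le (Real.sqrt_nonneg ((N : ℝ) + 1))]
    refine (integral_norm_sq_sqrt_sum_le hN hB (fun b hb => ?_) hθ
      (Real.sqrt_le_sqrt (by push_cast; linarith))).trans ?_
    · rw [norm_inv]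
      exact inv_le_of_inv_le₀ (by norm_num) (by linarith [hmb b hb])
    · have : 12 * √(N : ℝ) * (1 + Real.log N) / θ = 12 * r * ((1 + Real.log N) / θ) := by ring
      rw [this]
      have h9 : 0 ≤ (1 + Real.log N) / θ := by positivity
      calc 4 * N * ((√((N + 1 + N : ℕ) : ℝ) - √((N + 1 : ℕ) : ℝ))
              + 12 * r * ((1 + Real.log N) / θ))
          ≤ 4 * N * (12 * r + 12 * r * ((1 + Real.log N) / θ)) := by
            gcongr; linarith
        _ = _ := by ring
  have hmain : ∀ τ : ℝ, 0 < τ →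
      2 * ‖∑ a ∈ A, ∑ b ∈ B, Complex.exp ((θ * √b * √a : ℝ) * Complex.I)‖
        ≤ τ * N + J / τ / l := by
    intro τ hτ
    have h1 : ∀ a ∈ A, 2 * ‖∑ b ∈ B, Complex.exp ((θ * √b * √a : ℝ) * Complex.I)‖
        ≤ l⁻¹ * (τ * l + (∫ x in √(a : ℝ)..√((a + 1 : ℕ) : ℝ), ‖G x‖ ^ 2) / τ) := by
      intro a ha
      have haI := Finset.mem_Icc.1 (hA ha)
      rw [hinner a, norm_mul, norm_inv, Complex.norm_real, Real.norm_of_nonneg hlpos.le,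
        mul_left_comm]
      gcongr
      have := two_mul_norm_integral_le hGc (a := √(a : ℝ)) (b := √(a : ℝ) + l)
        (by linarith) (hgap a haI.2) hτ
      simpa using this
    have h2 : ∑ a ∈ Finset.Icc (N + 1) (2 * N), ∫ x in √(a : ℝ)..√((a + 1 : ℕ) : ℝ), ‖G x‖ ^ 2
        = J := by
      have := intervalIntegral.sum_integral_adjacent_intervals (μ := MeasureTheory.volume)
        (f := fun x => ‖G x‖ ^ 2) (a := fun k : ℕ => √((N + 1 + k : ℕ) : ℝ)) (n := N)
        (fun k _ => by apply Continuous.intervalIntegrable; fun_prop)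
      rw [hJ]
      have h3 : Finset.Icc (N + 1) (2 * N) = Finset.Ico (N + 1) (N + 1 + N) := by
        ext x; simp only [Finset.mem_Icc, Finset.mem_Ico]; omega
      rw [h3, Finset.sum_Ico_eq_sum_range, Nat.add_sub_cancel_left]
      simpa [add_assoc] using this
    have hcard : ((Finset.Icc (N + 1) (2 * N)).card : ℝ) = N := by
      rw [Nat.card_Icc]; exact_mod_cast (by omega : 2 * N + 1 - (N + 1) = N)
    calc 2 * ‖∑ a ∈ A, ∑ b ∈ B, Complex.exp ((θ * √b * √a : ℝ) * Complex.I)‖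
        ≤ 2 * ∑ a ∈ A, ‖∑ b ∈ B, Complex.exp ((θ * √b * √a : ℝ) * Complex.I)‖ := by
          gcongr; exact norm_sum_le _ _
      _ ≤ ∑ a ∈ A, l⁻¹ * (τ * l + (∫ x in √(a : ℝ)..√((a + 1 : ℕ) : ℝ), ‖G x‖ ^ 2) / τ) := by
          rw [Finset.mul_sum]; exact Finset.sum_le_sum h1
      _ ≤ ∑ a ∈ Finset.Icc (N + 1) (2 * N),
            l⁻¹ * (τ * l + (∫ x in √(a : ℝ)..√((a + 1 : ℕ) : ℝ), ‖G x‖ ^ 2) / τ) := by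
          refine Finset.sum_le_sum_of_subset_of_nonneg hA fun a _ _ => ?_
          have : 0 ≤ ∫ x in √(a : ℝ)..√((a + 1 : ℕ) : ℝ), ‖G x‖ ^ 2 :=
            intervalIntegral.integral_nonneg (Real.sqrt_le_sqrt (by push_cast; linarith))
              fun x _ => by positivity
          positivity
      _ = τ * N + J / τ / l := by
          rw [← Finset.mul_sum, Finset.sum_add_distrib, ← Finset.sum_div, h2, Finset.sum_const,
            nsmul_eq_mul, hcard]
          field_simp
  have h0 : 0 < √E := Real.sqrt_pos.2 hEpos
  have hfin := hmain (14 * (r * √E)) (by positivity)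
  have hJl : J / (14 * (r * √E)) / l ≤ 14 * (N * r) * √E := by
    rw [hl, div_div, div_le_iff₀ (by positivity)]
    have : 14 * (N * r) * √E * (14 * (r * √E) * (1 / (4 * r * (1 + θ))))
        = 49 * (N * r) * (√E * √E / (1 + θ)) := by field_simp; norm_num
    rw [this, Real.mul_self_sqrt hEpos.le, hE, mul_div_cancel_left₀ _ (by positivity)]
    refine hJ0.trans ?_
    gcongr
    norm_num
  nlinarith [mul_pos (mul_pos hN' hr) h0]
theorem sum_inv_sqrt_le (n : ℕ) : ∑ h ∈ Finset.range (n + 1), 1 / √(h : ℝ) ≤ 2 * √(n : ℝ) := by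
  induction n with
  | zero => simp
  | succ n ih =>
    rw [Finset.sum_range_succ]
    have h1 := Real.mul_self_sqrt (Nat.cast_nonneg (α := ℝ) n)
    have h2 := Real.mul_self_sqrt (Nat.cast_nonneg (α := ℝ) (n + 1))
    have h3 : 0 < √((n + 1 : ℕ) : ℝ) := Real.sqrt_pos.2 (by positivity)
    have h4 : √(n : ℝ) ≤ √((n + 1 : ℕ) : ℝ) := Real.sqrt_le_sqrt (by push_cast; linarith)
    have h5 : 1 / √((n + 1 : ℕ) : ℝ) ≤ 2 * (√((n + 1 : ℕ) : ℝ) - √(n : ℝ)) := by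
      rw [div_le_iff₀ h3]
      push_cast at *
      nlinarith [Real.sqrt_nonneg (n : ℝ)]
    linarith

theorem sum_Ioc_inv_mul_sqrt_le {H n : ℕ} (hH : 0 < H) (hn : H ≤ n) :
    ∑ h ∈ Finset.Ioc H n, 1 / ((h : ℝ) * √h) ≤ 2 / √(H : ℝ) - 2 / √(n : ℝ) := by
  induction n, hn using Nat.le_induction with
  | base => simp
  | succ n hn ih =>
    rw [Finset.sum_Ioc_succ_top (by omega)]
    have hn0 : (0 : ℝ) < n := by exact_mod_cast hH.trans_le hn
    have h1 := Real.mul_self_sqrt hn0.le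
    have h2 := Real.mul_self_sqrt (Nat.cast_nonneg (α := ℝ) (n + 1))
    have h3 : 0 < √((n + 1 : ℕ) : ℝ) := Real.sqrt_pos.2 (by positivity)
    have h3' : 0 < √(n : ℝ) := Real.sqrt_pos.2 hn0
    have h4 : √(n : ℝ) ≤ √((n + 1 : ℕ) : ℝ) := Real.sqrt_le_sqrt (by push_cast; linarith)
    have h5 : 1 / (((n + 1 : ℕ) : ℝ) * √((n + 1 : ℕ) : ℝ))
        ≤ 2 / √(n : ℝ) - 2 / √((n + 1 : ℕ) : ℝ) := by
      have hc : ((n + 1 : ℕ) : ℝ) = √((n + 1 : ℕ) : ℝ) * √((n + 1 : ℕ) : ℝ) := h2.symm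
      have hd : (√((n + 1 : ℕ) : ℝ) - √(n : ℝ)) * (√((n + 1 : ℕ) : ℝ) + √(n : ℝ)) = 1 := by
        push_cast at *; linarith
      rw [show ((n + 1 : ℕ) : ℝ) * √((n + 1 : ℕ) : ℝ) = √((n + 1 : ℕ) : ℝ) * √((n + 1 : ℕ) : ℝ)
        * √((n + 1 : ℕ) : ℝ) by rw [h2]]
      generalize √((n + 1 : ℕ) : ℝ) = s at *
      generalize √(n : ℝ) = t at *
      rw [div_sub_div _ _ h3'.ne' h3.ne', div_le_div_iff₀ (by positivity) (by positivity)]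
      have h6 : 0 ≤ s - t := by linarith
      have h7 : (2 * s - t * 2) * (s * s * s) ≥ (s - t) * (s + t) * (s * s) := by
        nlinarith [mul_nonneg (mul_nonneg h6 (mul_pos h3 h3).le) h6]
      rw [hd] at h7
      nlinarith
    linarith

theorem sum_min_mul_sqrt_le {d η : ℝ} (hd : 1 ≤ d) (hη : 0 < η) (hη1 : η ≤ 1) (n : ℕ) :
    ∑ h ∈ Finset.range n, d * min (2 * (η / d) ^ 2) (1 / (h : ℝ) ^ 2) *
      (√h / √d + √d / √h) ≤ 25 * √η := by
  have hd0 : 0 < d := by linarith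
  obtain ⟨H, hH1, hH2⟩ : ∃ H : ℕ, d / η ≤ H ∧ (H : ℝ) ≤ 2 * (d / η) := by
    refine ⟨⌈d / η⌉₊, Nat.le_ceil _, ?_⟩
    have h1 : 1 ≤ d / η := by rw [le_div_iff₀ hη]; linarith
    linarith [Nat.ceil_lt_add_one (a := d / η) (by positivity)]
  have hHpos : (0 : ℝ) < H := lt_of_lt_of_le (by positivity) hH1
  have hHd : d ≤ H := by
    refine le_trans ?_ hH1
    rw [le_div_iff₀ hη]; nlinarith
  obtain ⟨s, hs, hsd⟩ : ∃ s : ℝ, 0 < s ∧ s ^ 2 = d := ⟨√d, Real.sqrt_pos.2 hd0, Real.sq_sqrt hd0.le⟩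
  obtain ⟨e, he, hed⟩ : ∃ e : ℝ, 0 < e ∧ e ^ 2 = η := ⟨√η, Real.sqrt_pos.2 hη, Real.sq_sqrt hη.le⟩
  have hsqd : √d = s := by rw [← hsd, Real.sqrt_sq hs.le]
  have hsqe : √η = e := by rw [← hed, Real.sqrt_sq he.le]
  rw [hsqd, hsqe]
  have hHs : √(H : ℝ) ≤ 3 / 2 * (s / e) := by
    rw [Real.sqrt_le_left (by positivity), mul_pow, div_pow s e, hsd, hed]
    have : 0 ≤ d / η := by positivity
    linarith
  have hHs' : s / e ≤ √(H : ℝ) := by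
    apply Real.le_sqrt_of_sq_le
    rw [div_pow, hsd, hed]; exact hH1
  have hterm : ∀ h ∈ Finset.range (max n H + 1),
      d * min (2 * (η / d) ^ 2) (1 / (h : ℝ) ^ 2) * (√h / s + s / √h)
      ≤ if h ∈ Finset.Ioc H (max n H) then 2 * s * (1 / ((h : ℝ) * √h))
        else if h ∈ Finset.range (H + 1) then
          2 * η ^ 2 / d * (√H / s) + 2 * η ^ 2 / d * s * (1 / √h) else 0 := by
    intro h hh
    split_ifs with h1 h2
    · have h3 : (H : ℝ) < h := by exact_mod_cast (Finset.mem_Ioc.1 h1).1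
      have h4 : 0 < (h : ℝ) := hHpos.trans h3
      have h5 : 0 < √(h : ℝ) := Real.sqrt_pos.2 h4
      have h6 : s / √h ≤ √h / s := by
        rw [div_le_div_iff₀ h5 hs, Real.mul_self_sqrt h4.le, ← sq, hsd]; linarith
      calc d * min (2 * (η / d) ^ 2) (1 / (h : ℝ) ^ 2) * (√h / s + s / √h)
          ≤ d * (1 / (h : ℝ) ^ 2) * (√h / s + √h / s) := by
            gcongr
            exact min_le_right _ _
        _ = 2 * s * (√h / (h : ℝ) ^ 2) := by rw [← hsd]; field_simp; ring
        _ = _ := by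
          congr 1
          rw [div_eq_div_iff (by positivity) (by positivity)]
          have := Real.mul_self_sqrt h4.le
          linear_combination (h : ℝ) * this
    · have h3 : (h : ℝ) ≤ H := by
        exact_mod_cast Nat.lt_succ_iff.1 (Finset.mem_range.1 h2)
      calc d * min (2 * (η / d) ^ 2) (1 / (h : ℝ) ^ 2) * (√h / s + s / √h)
          ≤ d * (2 * (η / d) ^ 2) * (√H / s + s / √h) := by
            gcongr
            exact min_le_left _ _
        _ = _ := by field_simp
    · simp only [Finset.mem_Ioc, Finset.mem_range] at h1 h2 hh
      omega
  have hnn : ∀ h : ℕ, 0 ≤ d * min (2 * (η / d) ^ 2) (1 / (h : ℝ) ^ 2) * (√h / s + s / √h) :=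
    fun h => by positivity
  refine (Finset.sum_le_sum_of_subset_of_nonneg
    (Finset.range_mono (by omega : n ≤ max n H + 1)) fun h _ _ => hnn h).trans
    ((Finset.sum_le_sum hterm).trans ?_)
  have hsplit : ∀ h : ℕ, (if h ∈ Finset.Ioc H (max n H) then 2 * s * (1 / ((h : ℝ) * √h))
        else if h ∈ Finset.range (H + 1) then
          2 * η ^ 2 / d * (√H / s) + 2 * η ^ 2 / d * s * (1 / √h) else 0)
      ≤ (if h ∈ Finset.Ioc H (max n H) then 2 * s * (1 / ((h : ℝ) * √h)) else 0)
        + (if h ∈ Finset.range (H + 1) then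
          2 * η ^ 2 / d * (√H / s) + 2 * η ^ 2 / d * s * (1 / √h) else 0) := by
    intro h
    split_ifs <;> first | linarith | skip
    have : 0 ≤ 2 * η ^ 2 / d * (√H / s) + 2 * η ^ 2 / d * s * (1 / √h) := by positivity
    linarith
  refine (Finset.sum_le_sum fun h _ => hsplit h).trans ?_
  rw [Finset.sum_add_distrib, ← Finset.sum_filter, ← Finset.sum_filter]
  have e1 : (Finset.range (max n H + 1)).filter (· ∈ Finset.Ioc H (max n H))
      = Finset.Ioc H (max n H) := by
    ext h; simp only [Finset.mem_filter, Finset.mem_range, Finset.mem_Ioc]; omega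
  have e2 : (Finset.range (max n H + 1)).filter (· ∈ Finset.range (H + 1))
      = Finset.range (H + 1) := by
    ext h; simp only [Finset.mem_filter, Finset.mem_range]; omega
  rw [e1, e2, Finset.sum_add_distrib, Finset.sum_const, Finset.card_range, nsmul_eq_mul,
    ← Finset.mul_sum, ← Finset.mul_sum (Finset.range (H + 1)) _ (2 * η ^ 2 / d * s)]
  have hHn : 0 < H := by exact_mod_cast hHpos
  have b1 := sum_Ioc_inv_mul_sqrt_le hHn (le_max_right n H)
  have b2 := sum_inv_sqrt_le H
  have b3 : 0 ≤ 2 / √((max n H : ℕ) : ℝ) := by positivity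
  have b4 : 2 / √(H : ℝ) ≤ 2 * (e / s) := by
    rw [div_le_iff₀ (Real.sqrt_pos.2 hHpos)]
    calc (2 : ℝ) = 2 * (e / s) * (s / e) := by field_simp
      _ ≤ _ := by gcongr
  have b5 : ((H + 1 : ℕ) : ℝ) ≤ 3 * (d / η) := by
    push_cast
    have : 1 ≤ d / η := by rw [le_div_iff₀ hη]; linarith
    linarith
  calc 2 * s * ∑ h ∈ Finset.Ioc H (max n H), 1 / ((h : ℝ) * √h)
        + (((H + 1 : ℕ) : ℝ) * (2 * η ^ 2 / d * (√H / s))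
          + 2 * η ^ 2 / d * s * ∑ h ∈ Finset.range (H + 1), 1 / √(h : ℝ))
      ≤ 2 * s * (2 * (e / s)) + (3 * (d / η) * (2 * η ^ 2 / d * (3 / 2 * (s / e) / s))
          + 2 * η ^ 2 / d * s * (2 * (3 / 2 * (s / e)))) := by
        gcongr
        · linarith
        · linarith
    _ ≤ 25 * e := by
        rw [← hsd, ← hed]
        field_simp
        linarith
theorem hasSum_cos_div_sq {s : ℝ} (hs : |s| ≤ 1) :
    HasSum (fun n : ℕ => 1 / (n : ℝ) ^ 2 * Real.cos (2 * Real.pi * n * s))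
      (Real.pi ^ 2 * (s ^ 2 - |s| + 1 / 6)) := by
  have h := hasSum_one_div_nat_pow_mul_cos one_ne_zero (x := |s|) ⟨abs_nonneg s, hs⟩
  have e1 : ∀ n : ℕ, Real.cos (2 * Real.pi * n * |s|) = Real.cos (2 * Real.pi * n * s) := by
    intro n
    rcases abs_choice s with h | h <;> rw [h]
    rw [mul_neg, Real.cos_neg]
  simp only [e1, mul_one] at h
  convert h using 1
  have e2 : (Polynomial.bernoulli 2) = Polynomial.X ^ 2 - Polynomial.X + Polynomial.C (1 / 6) := by
    rw [Polynomial.bernoulli]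
    simp [Finset.sum_range_succ, bernoulli_two, ← Polynomial.C_mul_X_pow_eq_monomial]
    norm_num
    have h2 : Polynomial.C (1 / 2 : ℚ) * 2 = 1 := by
      rw [show (2 : Polynomial ℚ) = Polynomial.C 2 from rfl, ← Polynomial.C_mul]
      norm_num
    linear_combination (-Polynomial.X) * h2
  rw [e2]
  simp [Nat.factorial]
  left
  ring

theorem hasSum_triangle_aux {u x : ℝ} (hu : 0 ≤ u) (hu' : u ≤ 1 / 2) (hx : |x| ≤ 1 / 2) :
    HasSum (fun n : ℕ => (1 - Real.cos (2 * Real.pi * n * u)) / (Real.pi ^ 2 * (n : ℝ) ^ 2) *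
      Real.cos (2 * Real.pi * n * x)) (max 0 (u - |x|) - u ^ 2) := by
  have hx2 := abs_le.1 hx
  have h0 := hasSum_cos_div_sq (s := x) (by linarith)
  have h1 := hasSum_cos_div_sq (s := x + u) (abs_le.2 ⟨by linarith, by linarith⟩)
  have h2 := hasSum_cos_div_sq (s := x - u) (abs_le.2 ⟨by linarith, by linarith⟩)
  have h3 := ((h0.sub (h1.mul_left (1 / 2))).sub (h2.mul_left (1 / 2))).mul_left (1 / Real.pi ^ 2)
  have e1 : (fun n : ℕ => (1 - Real.cos (2 * Real.pi * n * u)) / (Real.pi ^ 2 * (n : ℝ) ^ 2) *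
      Real.cos (2 * Real.pi * n * x)) = fun n : ℕ => 1 / Real.pi ^ 2 *
        (1 / (n : ℝ) ^ 2 * Real.cos (2 * Real.pi * n * x)
          - 1 / 2 * (1 / (n : ℝ) ^ 2 * Real.cos (2 * Real.pi * n * (x + u))) -
          1 / 2 * (1 / (n : ℝ) ^ 2 * Real.cos (2 * Real.pi * n * (x - u)))) := by
    funext n
    rw [mul_add _ x u, mul_sub _ x u, Real.cos_add, Real.cos_sub]
    rcases Nat.eq_zero_or_pos n with h | h
    · simp [h]
    have : (0 : ℝ) < n := by exact_mod_cast h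
    have := Real.pi_pos
    field_simp
    ring
  have e2 : max 0 (u - |x|) - u ^ 2 = 1 / Real.pi ^ 2 * (Real.pi ^ 2 * (x ^ 2 - |x| + 1 / 6)
      - 1 / 2 * (Real.pi ^ 2 * ((x + u) ^ 2 - |x + u| + 1 / 6))
      - 1 / 2 * (Real.pi ^ 2 * ((x - u) ^ 2 - |x - u| + 1 / 6))) := by
    have := Real.pi_pos
    have h4 : |x + u| + |x - u| = 2 * max |x| u := by
      rcases le_total 0 x with h | h
      · rw [abs_of_nonneg (by linarith : 0 ≤ x + u), abs_of_nonneg h]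
        rcases le_total x u with h' | h'
        · rw [max_eq_right h', abs_of_nonpos (by linarith)]; ring
        · rw [max_eq_left h', abs_of_nonneg (by linarith)]; ring
      · rw [abs_of_nonpos (by linarith : x - u ≤ 0), abs_of_nonpos h]
        rcases le_total (-x) u with h' | h'
        · rw [max_eq_right h', abs_of_nonneg (by linarith)]; ring
        · rw [max_eq_left h', abs_of_nonpos (by linarith)]; ring
    have h5 : max 0 (u - |x|) = max |x| u - |x| := by
      rw [← max_sub_sub_right, sub_self]
    rw [h5]
    field_simp
    linarith
  rw [e1, e2]
  exact h3

theorem hasSum_triangle {u : ℝ} (hu : 0 ≤ u) (hu' : u ≤ 1 / 2) (x : ℝ) :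
    HasSum (fun n : ℕ => (1 - Real.cos (2 * Real.pi * n * u)) / (Real.pi ^ 2 * (n : ℝ) ^ 2) *
      Real.cos (2 * Real.pi * n * x)) (max 0 (u - |x - round x|) - u ^ 2) := by
  convert hasSum_triangle_aux hu hu' (abs_sub_round x) using 3 with n
  rw [← Real.cos_sub_int_mul_two_pi (2 * Real.pi * n * x) (n * round x)]
  congr 1
  push_cast
  ring

theorem triangle_coeff_nonneg (u : ℝ) (n : ℕ) :
    0 ≤ (1 - Real.cos (2 * Real.pi * n * u)) / (Real.pi ^ 2 * (n : ℝ) ^ 2) :=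
  div_nonneg (by linarith [Real.cos_le_one (2 * Real.pi * n * u)]) (by positivity)

theorem triangle_coeff_le (u : ℝ) (n : ℕ) :
    (1 - Real.cos (2 * Real.pi * n * u)) / (Real.pi ^ 2 * (n : ℝ) ^ 2)
      ≤ min (2 * u ^ 2) (1 / (n : ℝ) ^ 2) := by
  rcases Nat.eq_zero_or_pos n with h | h
  · simp [h]; positivity
  have hn : (0 : ℝ) < n := by exact_mod_cast h
  have hp := Real.pi_gt_three
  apply le_min
  · rw [div_le_iff₀ (by positivity)]
    have := Real.one_sub_sq_div_two_le_cos (x := 2 * Real.pi * n * u)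
    nlinarith
  · rw [div_le_div_iff₀ (by positivity) (by positivity)]
    have := Real.neg_one_le_cos (2 * Real.pi * n * u)
    have h9 : 2 ≤ Real.pi ^ 2 := by nlinarith
    have : 0 < (n : ℝ) ^ 2 := by positivity
    nlinarith

theorem sum_triangle_multiples {d M : ℕ} (hd : 0 < d) {η x : ℝ} (hη1 : η ≤ 1 / 2)
    (hx1 : 1 ≤ x) (hxM : x + 1 ≤ M) :
    ∑ n ∈ Finset.Icc 1 M with d ∣ n, max 0 (η - |x - n|)
      = d * max 0 (η / d - |x / d - round (x / d)|) := by
  have hd' : (0 : ℝ) < d := by exact_mod_cast hd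
  have hd1 : (1 : ℝ) ≤ d := by exact_mod_cast hd
  have key : ∀ k : ℤ, |x - d * k| < η → k = round (x / d) := by
    intro k hk
    have h1 := abs_sub_round (x / d)
    have h2 : |x / d - k| < 1 / 2 := by
      rw [show x / d - k = (x - d * k) / d by field_simp, abs_div, abs_of_pos hd',
        div_lt_iff₀ hd']
      nlinarith
    have h3 : |((k - round (x / d) : ℤ) : ℝ)| < 1 := by
      push_cast
      rw [abs_lt]
      rw [abs_le] at h1
      rw [abs_lt] at h2
      constructor <;> linarith [h1.1, h1.2, h2.1, h2.2]
    have h4 : |k - round (x / d)| < 1 := by exact_mod_cast h3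
    have := Int.abs_lt_one_iff.1 h4
    omega
  have hterm : (d : ℝ) * max 0 (η / d - |x / d - round (x / d)|)
      = max 0 (η - |x - d * round (x / d)|) := by
    rw [show x / d - round (x / d) = (x - d * round (x / d)) / d by field_simp, abs_div,
      abs_of_pos hd', ← sub_div, ← mul_max_of_nonneg _ _ hd'.le |>.symm, mul_zero,
      mul_div_cancel₀ _ hd'.ne']
  rw [hterm]
  by_cases h : |x - d * round (x / d)| < η
  · have hpos : (1 : ℝ) / 2 < ((d * round (x / d) : ℤ) : ℝ) := by
      push_cast; linarith [(abs_lt.1 h).2]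
    have hpos' : 0 < (d : ℤ) * round (x / d) := by
      have : (0 : ℝ) < ((d * round (x / d) : ℤ) : ℝ) := by linarith
      exact_mod_cast this
    obtain ⟨m, hm⟩ := Int.eq_ofNat_of_zero_le hpos'.le
    have hmR : (m : ℝ) = d * round (x / d) := by
      have := congrArg (Int.cast (R := ℝ)) hm
      push_cast at this
      exact this.symm
    have hmM : m ≤ M := by
      have : (m : ℝ) ≤ M := by rw [hmR]; linarith [(abs_lt.1 h).1]
      exact_mod_cast this
    rw [Finset.sum_eq_single_of_mem m]
    · rw [hmR]
    · rw [Finset.mem_filter, Finset.mem_Icc]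
      refine ⟨⟨by omega, hmM⟩, ?_⟩
      have : (d : ℤ) ∣ (m : ℤ) := ⟨_, hm.symm⟩
      exact_mod_cast this
    · intro n hn hne
      apply max_eq_left
      by_contra! hcon
      obtain ⟨k, rfl⟩ := (Finset.mem_filter.1 hn).2
      apply hne
      have := key k (by push_cast at hcon ⊢; linarith)
      rw [← this] at hm
      have h2 : ((d * k : ℕ) : ℤ) = m := by push_cast; exact hm
      exact_mod_cast h2
  · rw [max_eq_left (by linarith)]
    refine Finset.sum_eq_zero fun n hn => max_eq_left ?_
    by_contra! hcon
    obtain ⟨k, rfl⟩ := (Finset.mem_filter.1 hn).2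
    have h1 := key k (by push_cast at hcon ⊢; linarith)
    apply h
    rw [← h1]
    push_cast at hcon ⊢
    linarith
/-- The number of pairs `(a, b)` with `√(ab)` close to `n`, counted with a Fejér weight. -/
noncomputable def nearWeight (A B : Finset ℕ) (η : ℝ) (n : ℕ) : ℝ :=
  ∑ a ∈ A, ∑ b ∈ B, max 0 (η - |√(b : ℝ) * √(a : ℝ) - n|)

theorem nearWeight_nonneg (A B : Finset ℕ) (η : ℝ) (n : ℕ) : 0 ≤ nearWeight A B η n :=
  Finset.sum_nonneg fun _ _ => Finset.sum_nonneg fun _ _ => le_max_left _ _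

theorem sqrt_frequency_le {L h d : ℝ} (hL : 1 ≤ L) (hh : 0 < h) (hd : 0 < d) :
    √((1 + 2 * Real.pi * h / d) * (1 + L / (2 * Real.pi * h / d)))
      ≤ 3 * √L * (√h / √d + √d / √h) := by
  have hp := Real.pi_gt_three
  have hp' := Real.pi_lt_four
  have hs : 0 < √h := Real.sqrt_pos.2 hh
  have ht : 0 < √d := Real.sqrt_pos.2 hd
  rw [Real.sqrt_le_left (by positivity), mul_pow, mul_pow, Real.sq_sqrt (by linarith)]
  have e1 : (√h / √d + √d / √h) ^ 2 = h / d + 2 + d / h := by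
    calc (√h / √d + √d / √h) ^ 2 = √h ^ 2 / √d ^ 2 + 2 + √d ^ 2 / √h ^ 2 := by
          field_simp
          ring
      _ = _ := by rw [Real.sq_sqrt hh.le, Real.sq_sqrt hd.le]
  rw [e1]
  have hr : 0 < h / d := by positivity
  have e2 : d / h = 1 / (h / d) := by field_simp
  rw [e2, mul_div_assoc]
  generalize h / d = r at hr
  have e3 : (1 + 2 * Real.pi * r) * (1 + L / (2 * Real.pi * r))
      = 1 + 2 * Real.pi * r + L * (1 / (2 * Real.pi)) * (1 / r) + L := by
    field_simp
    ring
  rw [e3]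
  have h1 : 1 / (2 * Real.pi) ≤ 1 := by
    rw [div_le_one (by positivity)]; linarith
  have h2 : 0 < 1 / r := by positivity
  have h3 : L * (1 / (2 * Real.pi)) * (1 / r) ≤ L * 1 * (1 / r) := by gcongr
  have h4 : 2 * Real.pi * r ≤ 9 * L * r := by
    apply mul_le_mul_of_nonneg_right _ hr.le
    linarith
  have h5 : 0 ≤ L * (1 / r) := by positivity
  nlinarith

theorem abs_sum_nearWeight_sub_le {N : ℕ} (hN : 0 < N) {A B : Finset ℕ}
    (hA : A ⊆ Finset.Icc (N + 1) (2 * N)) (hB : B ⊆ Finset.Icc (N + 1) (2 * N)) {η : ℝ}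
    (hη : 0 < η) (hη1 : η ≤ 1 / 2) {d M : ℕ} (hd : 0 < d) (hM : 2 * N + 1 ≤ M) :
    |∑ n ∈ Finset.Icc 1 M with d ∣ n, nearWeight A B η n - η ^ 2 * A.card * B.card / d|
      ≤ 1200 * (N * √N) * √(1 + Real.log N) * √η := by
  have hd' : (0 : ℝ) < d := by exact_mod_cast hd
  have hd1 : (1 : ℝ) ≤ d := by exact_mod_cast hd
  set u : ℝ := η / d with hu
  have hu0 : 0 ≤ u := by positivity
  have hu1 : u ≤ 1 / 2 := by
    rw [hu, div_le_iff₀ hd']; linarith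
  set c : ℕ → ℝ := fun h =>
    (1 - Real.cos (2 * Real.pi * h * u)) / (Real.pi ^ 2 * (h : ℝ) ^ 2) with hc
  have hpair : ∀ a ∈ A, ∀ b ∈ B, HasSum
      (fun h : ℕ => d * c h * Real.cos ((2 * Real.pi * h / d) * √(b : ℝ) * √(a : ℝ)))
      (∑ n ∈ Finset.Icc 1 M with d ∣ n, max 0 (η - |√(b : ℝ) * √(a : ℝ) - n|) - η ^ 2 / d) := by
    intro a ha b hb
    have ha' := Finset.mem_Icc.1 (hA ha)
    have hb' := Finset.mem_Icc.1 (hB hb)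
    have ha1 : (1 : ℝ) ≤ a := by exact_mod_cast (by omega : 1 ≤ a)
    have hb1 : (1 : ℝ) ≤ b := by exact_mod_cast (by omega : 1 ≤ b)
    have ha2 : (a : ℝ) ≤ 2 * N := by exact_mod_cast ha'.2
    have hb2 : (b : ℝ) ≤ 2 * N := by exact_mod_cast hb'.2
    have hM' : (2 * N + 1 : ℝ) ≤ M := by exact_mod_cast hM
    rw [sum_triangle_multiples hd hη1]
    · have h := (hasSum_triangle hu0 hu1 (√(b : ℝ) * √(a : ℝ) / d)).mul_left (d : ℝ)
      have e1 : (fun h : ℕ => d * c h * Real.cos ((2 * Real.pi * h / d) * √(b : ℝ) * √(a : ℝ)))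
          = fun h : ℕ => d * (c h * Real.cos (2 * Real.pi * h * (√(b : ℝ) * √(a : ℝ) / d))) := by
        funext h
        rw [mul_assoc (d : ℝ)]
        congr 3
        ring
      have e2 : η ^ 2 / d = d * u ^ 2 := by rw [hu]; field_simp
      rw [e1, e2, ← mul_sub]
      exact h
    · rw [← Real.sqrt_mul (by linarith)]
      apply Real.le_sqrt_of_sq_le
      nlinarith
    · have : √(b : ℝ) * √(a : ℝ) ≤ 2 * N := by
        rw [← Real.sqrt_mul (by linarith), Real.sqrt_le_left (by positivity)]
        nlinarith
      linarith
  have hsum := hasSum_sum fun a ha => hasSum_sum fun b hb => hpair a ha b hb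
  have hval : ∑ a ∈ A, ∑ b ∈ B,
      (∑ n ∈ Finset.Icc 1 M with d ∣ n, max 0 (η - |√(b : ℝ) * √(a : ℝ) - n|) - η ^ 2 / d)
      = ∑ n ∈ Finset.Icc 1 M with d ∣ n, nearWeight A B η n - η ^ 2 * A.card * B.card / d := by
    simp only [Finset.sum_sub_distrib, Finset.sum_const, nsmul_eq_mul, nearWeight]
    congr 1
    · rw [Finset.sum_comm (s := (Finset.Icc 1 M).filter (d ∣ ·))]
      exact Finset.sum_congr rfl fun a _ => Finset.sum_comm
    · ring
  rw [hval] at hsum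
  refine le_of_tendsto hsum.tendsto_sum_nat.abs (Filter.Eventually.of_forall fun m => ?_)
  have hlog : 0 ≤ Real.log N := Real.log_natCast_nonneg N
  have hterm : ∀ h ∈ Finset.range m,
      |∑ a ∈ A, ∑ b ∈ B, d * c h * Real.cos ((2 * Real.pi * h / d) * √(b : ℝ) * √(a : ℝ))|
      ≤ 48 * (N * √N) * √(1 + Real.log N) *
        (d * min (2 * (η / d) ^ 2) (1 / (h : ℝ) ^ 2) * (√h / √(d : ℝ) + √(d : ℝ) / √h)) := by
    intro h _
    rcases Nat.eq_zero_or_pos h with h0 | h0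
    · have : c h = 0 := by simp [hc, h0]
      simp only [this, mul_zero, zero_mul, Finset.sum_const_zero, abs_zero]
      positivity
    have hh : (0 : ℝ) < h := by exact_mod_cast h0
    have hθ : 0 < 2 * Real.pi * h / d := by have := Real.pi_pos; positivity
    have hc0 : 0 ≤ c h := triangle_coeff_nonneg u h
    have e1 : ∑ a ∈ A, ∑ b ∈ B, d * c h *
        Real.cos ((2 * Real.pi * h / d) * √(b : ℝ) * √(a : ℝ)) = d * c h *
        (∑ a ∈ A, ∑ b ∈ B, Complex.exp (((2 * Real.pi * h / d) * √(b : ℝ) * √(a : ℝ) : ℝ)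
          * Complex.I)).re := by
      simp only [Complex.re_sum, Complex.exp_ofReal_mul_I_re, Finset.mul_sum]
    rw [e1, abs_mul, abs_of_nonneg (by positivity : 0 ≤ d * c h)]
    calc d * c h * |(∑ a ∈ A, ∑ b ∈ B, Complex.exp
            (((2 * Real.pi * h / d) * √(b : ℝ) * √(a : ℝ) : ℝ) * Complex.I)).re|
        ≤ d * min (2 * (η / d) ^ 2) (1 / (h : ℝ) ^ 2) * (16 * (N * √N) *
          (3 * √(1 + Real.log N) * (√h / √(d : ℝ) + √(d : ℝ) / √h))) := by
          gcongr
          · exact triangle_coeff_le u h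
          · refine (Complex.abs_re_le_norm _).trans
              ((norm_sum_exp_sqrt_le hN hA hB hθ).trans ?_)
            gcongr
            exact sqrt_frequency_le (by linarith) hh hd'
      _ = _ := by ring
  calc |∑ h ∈ Finset.range m, ∑ a ∈ A, ∑ b ∈ B,
        d * c h * Real.cos ((2 * Real.pi * h / d) * √(b : ℝ) * √(a : ℝ))|
      ≤ ∑ h ∈ Finset.range m, 48 * (N * √N) * √(1 + Real.log N) *
        (d * min (2 * (η / d) ^ 2) (1 / (h : ℝ) ^ 2) * (√h / √(d : ℝ) + √(d : ℝ) / √h)) :=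
        (Finset.abs_sum_le_sum_abs _ _).trans (Finset.sum_le_sum hterm)
    _ ≤ 48 * (N * √N) * √(1 + Real.log N) * (25 * √η) := by
        rw [← Finset.mul_sum]
        gcongr
        exact sum_min_mul_sqrt_le hd1 hη (by linarith) m
    _ = _ := by ring
/-- The function `μ²(m) / φ(m)`. -/
noncomputable def selbergG (m : ℕ) : ℝ := if Squarefree m then (Nat.totient m : ℝ)⁻¹ else 0

/-- The unnormalised Selberg weights whose diagonalised form is supported on `s`. -/
noncomputable def selbergWeight (s : Finset ℕ) (d : ℕ) : ℝ :=
  ArithmeticFunction.moebius d * d * ∑ m ∈ s with d ∣ m, selbergG m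

/-- The divisor sum whose square is the Selberg majorant. -/
noncomputable def selbergSum (s : Finset ℕ) (R n : ℕ) : ℝ :=
  ∑ d ∈ Finset.Icc 1 R with d ∣ n, selbergWeight s d

theorem selbergG_nonneg (m : ℕ) : 0 ≤ selbergG m := by
  unfold selbergG; split_ifs <;> positivity

theorem selbergG_of_not_squarefree {m : ℕ} (h : ¬Squarefree m) : selbergG m = 0 := if_neg h

theorem selbergG_of_squarefree {m : ℕ} (h : Squarefree m) :
    selbergG m = (Nat.totient m : ℝ)⁻¹ := if_pos h

theorem selbergG_mul {m n : ℕ} (h : Nat.Coprime m n) :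
    selbergG (m * n) = selbergG m * selbergG n := by
  unfold selbergG
  simp only [Nat.squarefree_mul h, Nat.totient_mul h]
  by_cases hm : Squarefree m <;> by_cases hn : Squarefree n <;> simp [hm, hn, mul_comm]

theorem sum_divisors_moebius_mul_self {k : ℕ} (hk : Squarefree k) :
    ∑ d ∈ k.divisors, (ArithmeticFunction.moebius d : ℝ) * d =
      ArithmeticFunction.moebius k * Nat.totient k := by
  have h1 : ∀ n : ℕ, 0 < n → ∑ x ∈ n.divisorsAntidiagonal,
      (ArithmeticFunction.moebius x.1 : ℤ) * ((x.2 : ℕ) : ℤ) = (Nat.totient n : ℤ) :=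
    (ArithmeticFunction.sum_eq_iff_sum_mul_moebius_eq (R := ℤ)
      (f := fun n => (Nat.totient n : ℤ)) (g := fun n => (n : ℤ))).1
      fun n _ => by exact_mod_cast Nat.sum_totient n
  have h2 := h1 k (Nat.pos_of_ne_zero hk.ne_zero)
  have h3 : ∑ d ∈ k.divisors, (ArithmeticFunction.moebius d : ℤ) * d =
      ArithmeticFunction.moebius k * Nat.totient k := by
    rw [← h2, Finset.mul_sum,
      Nat.sum_divisorsAntidiagonal' (f := fun a b =>
        (ArithmeticFunction.moebius k : ℤ) * (ArithmeticFunction.moebius a * (b : ℤ)))]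
    refine Finset.sum_congr rfl fun d hd => ?_
    obtain ⟨c, rfl⟩ := Nat.dvd_of_mem_divisors hd
    have hd0 : 0 < d := Nat.pos_of_ne_zero fun h => hk.ne_zero (by simp [h])
    have hcop := Nat.coprime_of_squarefree_mul hk
    rw [Nat.mul_div_cancel_left _ hd0,
      ArithmeticFunction.isMultiplicative_moebius.map_mul_of_coprime hcop]
    have := ArithmeticFunction.moebius_sq_eq_one_of_squarefree (hk.squarefree_of_dvd (Dvd.intro_left d rfl))
    linear_combination (-(ArithmeticFunction.moebius d : ℤ) * d) * this
  exact_mod_cast h3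

theorem sum_divisors_moebius_of_dvd {m r : ℕ} (hm : Squarefree m) :
    ∑ d ∈ m.divisors with r ∣ d, (ArithmeticFunction.moebius d : ℝ) =
      if r = m then (ArithmeticFunction.moebius r : ℝ) else 0 := by
  by_cases hr : r ∣ m
  · obtain ⟨k, rfl⟩ := hr
    have hr0 : 0 < r := Nat.pos_of_ne_zero fun h => hm.ne_zero (by simp [h])
    have hk0 : k ≠ 0 := fun h => hm.ne_zero (by simp [h])
    have hcop := Nat.coprime_of_squarefree_mul hm
    have e1 : (r * k).divisors.filter (r ∣ ·) = k.divisors.image (r * ·) := by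
      ext d
      simp only [Finset.mem_filter, Nat.mem_divisors, Finset.mem_image]
      constructor
      · rintro ⟨⟨h1, h2⟩, j, rfl⟩
        exact ⟨j, ⟨Nat.dvd_of_mul_dvd_mul_left hr0 h1, hk0⟩, rfl⟩
      · rintro ⟨j, ⟨h1, -⟩, rfl⟩
        exact ⟨⟨Nat.mul_dvd_mul_left r h1, hm.ne_zero⟩, Dvd.intro _ rfl⟩
    rw [e1, Finset.sum_image fun a _ b _ h => Nat.eq_of_mul_eq_mul_left hr0 h]
    have e2 : ∀ j ∈ k.divisors, (ArithmeticFunction.moebius (r * j) : ℝ) =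
        ArithmeticFunction.moebius r * ArithmeticFunction.moebius j := by
      intro j hj
      rw [ArithmeticFunction.isMultiplicative_moebius.map_mul_of_coprime
        (hcop.coprime_dvd_right (Nat.dvd_of_mem_divisors hj))]
      push_cast; rfl
    rw [Finset.sum_congr rfl e2, ← Finset.mul_sum]
    have e3 : ∑ j ∈ k.divisors, (ArithmeticFunction.moebius j : ℝ) = if k = 1 then 1 else 0 := by
      have h := congrArg (fun f => f k) ArithmeticFunction.coe_zeta_mul_moebius
      simp only [ArithmeticFunction.coe_zeta_mul_apply, ArithmeticFunction.one_apply] at h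
      exact_mod_cast h
    rw [e3]
    have e4 : (r = r * k) ↔ k = 1 := by
      constructor
      · intro h
        exact Nat.eq_of_mul_eq_mul_left hr0 (by omega)
      · rintro rfl; simp
    simp [e4]
  · rw [if_neg (fun h => hr h.dvd)]
    refine Finset.sum_eq_zero fun d hd => ?_
    rw [Finset.mem_filter, Nat.mem_divisors] at hd
    exact absurd (hd.2.trans hd.1.1) hr

theorem sum_selbergWeight_div_eq {s : Finset ℕ} {R : ℕ} (hs : s ⊆ Finset.Icc 1 R) (r : ℕ) :
    ∑ d ∈ Finset.Icc 1 R with r ∣ d, selbergWeight s d / d =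
      if r ∈ s then ArithmeticFunction.moebius r * selbergG r else 0 := by
  have e1 : ∀ d ∈ (Finset.Icc 1 R).filter (r ∣ ·), selbergWeight s d / d =
      ∑ m ∈ s, if d ∣ m then (ArithmeticFunction.moebius d : ℝ) * selbergG m else 0 := by
    intro d hd
    have : (d : ℝ) ≠ 0 := by
      have := (Finset.mem_Icc.1 (Finset.mem_filter.1 hd).1).1
      positivity
    rw [selbergWeight, ← Finset.sum_filter, ← Finset.mul_sum]
    field_simp
  rw [Finset.sum_congr rfl e1, Finset.sum_comm]
  have e2 : ∀ m ∈ s, ∑ d ∈ Finset.Icc 1 R with r ∣ d,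
      (if d ∣ m then (ArithmeticFunction.moebius d : ℝ) * selbergG m else 0)
      = if r = m then ArithmeticFunction.moebius r * selbergG r else 0 := by
    intro m hm
    by_cases hsq : Squarefree m
    · have h := sum_divisors_moebius_of_dvd (r := r) hsq
      have hmR := Finset.mem_Icc.1 (hs hm)
      have e3 : ((Finset.Icc 1 R).filter (r ∣ ·)).filter (· ∣ m) = m.divisors.filter (r ∣ ·) := by
        ext d
        simp only [Finset.mem_filter, Finset.mem_Icc, Nat.mem_divisors]
        constructor
        · rintro ⟨⟨_, h1⟩, h2⟩
          exact ⟨⟨h2, by omega⟩, h1⟩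
        · rintro ⟨⟨h2, _⟩, h1⟩
          have := Nat.le_of_dvd (by omega) h2
          have := Nat.pos_of_dvd_of_pos h2 (by omega)
          exact ⟨⟨⟨by omega, by omega⟩, h1⟩, h2⟩
      rw [← Finset.sum_filter, e3, ← Finset.sum_mul, h]
      split_ifs with hrm
      · rw [hrm]
      · simp
    · split_ifs with hrm
      · rw [hrm, selbergG_of_not_squarefree hsq]; simp
      · rw [selbergG_of_not_squarefree hsq]; simp
  rw [Finset.sum_congr rfl e2, Finset.sum_ite_eq]

/-- The quadratic form of the Selberg weights. -/
theorem sum_selbergWeight_mul_div_lcm {s : Finset ℕ} {R : ℕ} (hs : s ⊆ Finset.Icc 1 R) :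
    ∑ d ∈ Finset.Icc 1 R, ∑ e ∈ Finset.Icc 1 R,
      selbergWeight s d * selbergWeight s e / (Nat.lcm d e : ℝ) = ∑ m ∈ s, selbergG m := by
  have e1 : ∀ d ∈ Finset.Icc 1 R, ∀ e ∈ Finset.Icc 1 R,
      selbergWeight s d * selbergWeight s e / (Nat.lcm d e : ℝ) =
      ∑ r ∈ Finset.Icc 1 R, (Nat.totient r : ℝ) * ((if r ∣ d then selbergWeight s d / d else 0) *
        (if r ∣ e then selbergWeight s e / e else 0)) := by
    intro d hd e he
    have hd' := Finset.mem_Icc.1 hd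
    have he' := Finset.mem_Icc.1 he
    have e2 : ∑ r ∈ Finset.Icc 1 R, (Nat.totient r : ℝ) *
        ((if r ∣ d then selbergWeight s d / d else 0) *
        (if r ∣ e then selbergWeight s e / e else 0)) =
        ∑ r ∈ (Nat.gcd d e).divisors, (Nat.totient r : ℝ) *
          (selbergWeight s d / d * (selbergWeight s e / e)) := by
      have hsub : (Nat.gcd d e).divisors ⊆ Finset.Icc 1 R := by
        intro r hr
        have h1 := (Nat.dvd_of_mem_divisors hr).trans (Nat.gcd_dvd_left d e)
        have := Nat.le_of_dvd (by omega) h1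
        have := Nat.pos_of_dvd_of_pos h1 (by omega)
        exact Finset.mem_Icc.2 ⟨by omega, by omega⟩
      rw [← Finset.sum_subset hsub]
      · refine Finset.sum_congr rfl fun r hr => ?_
        have h1 := (Nat.dvd_of_mem_divisors hr)
        rw [if_pos (h1.trans (Nat.gcd_dvd_left d e)), if_pos (h1.trans (Nat.gcd_dvd_right d e))]
      · intro r _ hr
        by_cases h1 : r ∣ d
        · by_cases h2 : r ∣ e
          · exact absurd (Nat.mem_divisors.2 ⟨Nat.dvd_gcd h1 h2,
              (Nat.gcd_pos_of_pos_left e (by omega : 0 < d)).ne'⟩) hr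
          · simp [h2]
        · simp [h1]
    rw [e2, ← Finset.sum_mul]
    have e3 : ∑ r ∈ (Nat.gcd d e).divisors, (Nat.totient r : ℝ) = Nat.gcd d e := by
      exact_mod_cast Nat.sum_totient (Nat.gcd d e)
    have e4 : (Nat.gcd d e : ℝ) * Nat.lcm d e = d * e := by exact_mod_cast Nat.gcd_mul_lcm d e
    have h1 : (0 : ℝ) < d := by exact_mod_cast hd'.1
    have h2 : (0 : ℝ) < e := by exact_mod_cast he'.1
    have h3 : (0 : ℝ) < Nat.lcm d e := by exact_mod_cast Nat.lcm_pos hd'.1 he'.1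
    rw [e3]
    field_simp
    linear_combination (-selbergWeight s d * selbergWeight s e) * e4
  rw [Finset.sum_congr rfl fun d hd => Finset.sum_congr rfl (e1 d hd)]
  rw [Finset.sum_congr rfl fun d _ => Finset.sum_comm, Finset.sum_comm]
  have e5 : ∀ r ∈ Finset.Icc 1 R, ∑ d ∈ Finset.Icc 1 R, ∑ e ∈ Finset.Icc 1 R,
      (Nat.totient r : ℝ) * ((if r ∣ d then selbergWeight s d / d else 0) *
        (if r ∣ e then selbergWeight s e / e else 0)) = if r ∈ s then selbergG r else 0 := by
    intro r hr
    simp_rw [← Finset.mul_sum, ← Finset.sum_mul, ← Finset.sum_filter,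
      sum_selbergWeight_div_eq hs r]
    split_ifs with hrs
    · by_cases hsq : Squarefree r
      · have h1 : (ArithmeticFunction.moebius r : ℝ) ^ 2 = 1 := by
          exact_mod_cast ArithmeticFunction.moebius_sq_eq_one_of_squarefree hsq
        have h2 : (0 : ℝ) < Nat.totient r := by
          exact_mod_cast Nat.totient_pos.2 (Finset.mem_Icc.1 hr).1
        rw [selbergG_of_squarefree hsq]
        field_simp
        exact h1
      · rw [selbergG_of_not_squarefree hsq]; simp
    · simp
  rw [Finset.sum_congr rfl e5, Finset.sum_ite_mem, Finset.inter_eq_right.2 hs]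

theorem selbergWeight_eq_zero_of_not_dvd {s : Finset ℕ} {d : ℕ} (h : ∀ m ∈ s, ¬d ∣ m) :
    selbergWeight s d = 0 := by
  rw [selbergWeight, Finset.filter_eq_empty_iff.2 fun m hm => h m hm]
  simp

theorem mul_selbergG_le {d R : ℕ} (hd : d ∈ Finset.Icc 1 R) :
    d * selbergG d ≤ ∑ m ∈ Finset.Icc 1 R, selbergG m := by
  have hd' := Finset.mem_Icc.1 hd
  by_cases hsq : Squarefree d
  · have h1 : d * selbergG d = ∑ m ∈ d.divisors, selbergG m := by
      have h2 : (d : ℝ) = ∑ m ∈ d.divisors, (Nat.totient (d / m) : ℝ) := by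
        rw [Nat.sum_div_divisors d (fun k => (Nat.totient k : ℝ))]
        exact_mod_cast (Nat.sum_totient d).symm
      nth_rewrite 1 [h2]
      rw [Finset.sum_mul]
      refine Finset.sum_congr rfl fun m hm => ?_
      obtain ⟨k, rfl⟩ := Nat.dvd_of_mem_divisors hm
      have hm0 : 0 < m := Nat.pos_of_ne_zero fun h => hsq.ne_zero (by simp [h])
      have hk0 : 0 < k := Nat.pos_of_ne_zero fun h => hsq.ne_zero (by simp [h])
      have hcop := Nat.coprime_of_squarefree_mul hsq
      rw [Nat.mul_div_cancel_left _ hm0, selbergG_mul hcop,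
        selbergG_of_squarefree (hsq.squarefree_of_dvd (Dvd.intro_left m rfl) : Squarefree k)]
      have : (Nat.totient k : ℝ) ≠ 0 := by exact_mod_cast (Nat.totient_pos.2 hk0).ne'
      field_simp
    rw [h1]
    refine Finset.sum_le_sum_of_subset_of_nonneg ?_ fun m _ _ => selbergG_nonneg m
    intro m hm
    have h3 := Nat.dvd_of_mem_divisors hm
    have := Nat.le_of_dvd (by omega) h3
    have := Nat.pos_of_dvd_of_pos h3 (by omega)
    exact Finset.mem_Icc.2 ⟨by omega, by omega⟩
  · rw [selbergG_of_not_squarefree hsq, mul_zero]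
    exact Finset.sum_nonneg fun m _ => selbergG_nonneg m

theorem abs_selbergWeight_le {s : Finset ℕ} {R d : ℕ} (hs : s ⊆ Finset.Icc 1 R)
    (hd : d ∈ Finset.Icc 1 R) :
    |selbergWeight s d| ≤ (∑ m ∈ Finset.Icc 1 R, selbergG m) ^ 2 := by
  have hd' := Finset.mem_Icc.1 hd
  have hnn : 0 ≤ ∑ m ∈ s with d ∣ m, selbergG m := Finset.sum_nonneg fun m _ => selbergG_nonneg m
  have h1 : |(ArithmeticFunction.moebius d : ℝ)| ≤ 1 := by
    exact_mod_cast ArithmeticFunction.abs_moebius_le_one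
  have h2 : ∑ m ∈ s with d ∣ m, selbergG m
      ≤ selbergG d * ∑ m ∈ Finset.Icc 1 R, selbergG m := by
    calc ∑ m ∈ s with d ∣ m, selbergG m ≤ ∑ m ∈ (Finset.Icc 1 R).image (d * ·), selbergG m := by
          refine Finset.sum_le_sum_of_subset_of_nonneg ?_ fun m _ _ => selbergG_nonneg m
          intro m hm
          obtain ⟨k, rfl⟩ := (Finset.mem_filter.1 hm).2
          have h3 := Finset.mem_Icc.1 (hs (Finset.mem_filter.1 hm).1)
          refine Finset.mem_image.2 ⟨k, Finset.mem_Icc.2 ⟨?_, ?_⟩, rfl⟩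
          · exact Nat.pos_of_ne_zero fun h => by simp [h] at h3
          · nlinarith
      _ = ∑ k ∈ Finset.Icc 1 R, selbergG (d * k) :=
          Finset.sum_image fun a _ b _ h => Nat.eq_of_mul_eq_mul_left (by omega) h
      _ ≤ ∑ k ∈ Finset.Icc 1 R, selbergG d * selbergG k := by
          refine Finset.sum_le_sum fun k _ => ?_
          by_cases hsq : Squarefree (d * k)
          · rw [selbergG_mul (Nat.coprime_of_squarefree_mul hsq)]
          · rw [selbergG_of_not_squarefree hsq]
            exact mul_nonneg (selbergG_nonneg _) (selbergG_nonneg _)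
      _ = _ := by rw [Finset.mul_sum]
  have hS : 0 ≤ ∑ m ∈ Finset.Icc 1 R, selbergG m := Finset.sum_nonneg fun m _ => selbergG_nonneg m
  rw [selbergWeight, abs_mul, abs_mul, abs_of_nonneg hnn, Nat.abs_cast]
  calc |(ArithmeticFunction.moebius d : ℝ)| * d * ∑ m ∈ s with d ∣ m, selbergG m
      ≤ 1 * d * (selbergG d * ∑ m ∈ Finset.Icc 1 R, selbergG m) := by gcongr
    _ = d * selbergG d * ∑ m ∈ Finset.Icc 1 R, selbergG m := by ring
    _ ≤ _ := by
      rw [sq]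
      exact mul_le_mul_of_nonneg_right (mul_selbergG_le hd) hS

theorem selbergSum_eq {s : Finset ℕ} {R : ℕ} (hs : s ⊆ Finset.Icc 1 R) (n : ℕ) :
    selbergSum s R n = ∑ m ∈ s, selbergG m *
      ((ArithmeticFunction.moebius (Nat.gcd m n) : ℝ) * Nat.totient (Nat.gcd m n)) := by
  simp only [selbergSum, selbergWeight, Finset.sum_filter, Finset.mul_sum]
  simp only [← Finset.sum_filter]
  rw [Finset.sum_comm]
  refine Finset.sum_congr rfl fun m hm => ?_
  have hm' := Finset.mem_Icc.1 (hs hm)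
  by_cases hsq : Squarefree m
  · rw [← sum_divisors_moebius_mul_self (hsq.squarefree_of_dvd (Nat.gcd_dvd_left m n)),
      Finset.mul_sum]
    have e1 : (Nat.gcd m n).divisors = ((Finset.Icc 1 R).filter (· ∣ n)).filter (· ∣ m) := by
      ext d
      simp only [Finset.mem_filter, Finset.mem_Icc, Nat.mem_divisors, Nat.dvd_gcd_iff]
      constructor
      · rintro ⟨⟨h1, h2⟩, -⟩
        have := Nat.le_of_dvd (by omega) h1
        have := Nat.pos_of_dvd_of_pos h1 (by omega)
        exact ⟨⟨⟨by omega, by omega⟩, h2⟩, h1⟩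
      · rintro ⟨⟨-, h2⟩, h1⟩
        exact ⟨⟨h1, h2⟩, (Nat.gcd_pos_of_pos_left n (by omega : 0 < m)).ne'⟩
    rw [e1, Finset.sum_filter (s := (Finset.Icc 1 R).filter (· ∣ n))]
    refine Finset.sum_congr rfl fun d _ => ?_
    split_ifs <;> ring
  · rw [selbergG_of_not_squarefree hsq, zero_mul]
    refine Finset.sum_eq_zero fun d _ => ?_
    simp

theorem selbergSum_Icc_eq_of_dvd {p R n : ℕ} (hp : p.Prime) (hpn : p ∣ n) :
    selbergSum (Finset.Icc 1 R) R n
      = selbergSum ((Finset.Ioc (R / p) R).filter fun m => ¬p ∣ m) R n := by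
  set t : ℕ → ℝ := fun m => selbergG m *
      ((ArithmeticFunction.moebius (Nat.gcd m n) : ℝ) * Nat.totient (Nat.gcd m n)) with ht
  have hsub : (Finset.Ioc (R / p) R).filter (fun m => ¬p ∣ m) ⊆ Finset.Icc 1 R := by
    intro m hm
    have := Finset.mem_Ioc.1 (Finset.mem_filter.1 hm).1
    exact Finset.mem_Icc.2 ⟨Nat.pos_of_ne_zero (by rintro rfl; simp at this), this.2⟩
  have hstep : ∀ m, ¬p ∣ m → t (p * m) = -t m := by
    intro m hm
    have hcop : Nat.Coprime p m := (Nat.Prime.coprime_iff_not_dvd hp).2 hm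
    have hg : Nat.gcd (p * m) n = p * Nat.gcd m n := by
      rw [Nat.gcd_comm, hcop.gcd_mul, Nat.gcd_eq_right hpn, Nat.gcd_comm]
    have hcop' : Nat.Coprime p (Nat.gcd m n) := hcop.coprime_dvd_right (Nat.gcd_dvd_left m n)
    have hp1 : ((p - 1 : ℕ) : ℝ) ≠ 0 := by
      have := hp.two_le
      exact_mod_cast (by omega : p - 1 ≠ 0)
    simp only [ht]
    rw [hg, selbergG_mul hcop, Nat.totient_mul hcop',
      ArithmeticFunction.isMultiplicative_moebius.map_mul_of_coprime hcop',
      ArithmeticFunction.moebius_apply_prime hp, selbergG_of_squarefree hp.prime.squarefree,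
      Nat.totient_prime hp]
    push_cast
    field_simp
  rw [selbergSum_eq (Finset.Subset.refl _), selbergSum_eq hsub]
  change ∑ m ∈ Finset.Icc 1 R, t m = ∑ m ∈ Finset.Ioc (R / p) R with ¬p ∣ m, t m
  have h0 : ∀ m, ¬Squarefree m → t m = 0 := fun m hm => by
    simp [ht, selbergG_of_not_squarefree hm]
  have e1 : ∑ m ∈ Finset.Icc 1 R with p ∣ m, t m
      = -∑ m ∈ Finset.Icc 1 (R / p) with ¬p ∣ m, t m := by
    rw [← Finset.sum_neg_distrib]
    have e2 : (Finset.Icc 1 R).filter (p ∣ ·) = (Finset.Icc 1 (R / p)).image (p * ·) := by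
      ext m
      simp only [Finset.mem_filter, Finset.mem_Icc, Finset.mem_image]
      constructor
      · rintro ⟨⟨h1, h2⟩, k, rfl⟩
        refine ⟨k, ⟨?_, ?_⟩, rfl⟩
        · exact Nat.pos_of_ne_zero fun h => by simp [h] at h1
        · exact (Nat.le_div_iff_mul_le hp.pos).2 (by rw [mul_comm]; exact h2)
      · rintro ⟨k, ⟨h1, h2⟩, rfl⟩
        have := (Nat.le_div_iff_mul_le hp.pos).1 h2
        exact ⟨⟨Nat.mul_pos hp.pos h1, by rw [mul_comm]; exact this⟩, Dvd.intro _ rfl⟩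
    rw [e2, Finset.sum_image fun a _ b _ h => Nat.eq_of_mul_eq_mul_left hp.pos h,
      Finset.sum_filter]
    refine Finset.sum_congr rfl fun m _ => ?_
    by_cases h : p ∣ m
    · rw [if_neg (not_not.2 h)]
      apply h0
      intro hsq
      have := Nat.coprime_of_squarefree_mul hsq
      exact (Nat.Prime.coprime_iff_not_dvd hp).1 this h
    · rw [if_pos h, hstep m h]
  have e3 : ∑ m ∈ Finset.Icc 1 R with ¬p ∣ m, t m
      = ∑ m ∈ Finset.Icc 1 (R / p) with ¬p ∣ m, t m
        + ∑ m ∈ Finset.Ioc (R / p) R with ¬p ∣ m, t m := by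
    rw [← Finset.sum_union]
    · congr 1
      ext m
      have := Nat.div_le_self R p
      simp only [Finset.mem_filter, Finset.mem_Icc, Finset.mem_union, Finset.mem_Ioc]
      constructor
      · rintro ⟨h1, h2⟩
        rcases le_or_gt m (R / p) with h | h
        · exact Or.inl ⟨⟨h1.1, h⟩, h2⟩
        · exact Or.inr ⟨⟨h, h1.2⟩, h2⟩
      · rintro (⟨h1, h2⟩ | ⟨h1, h2⟩)
        · exact ⟨⟨h1.1, h1.2.trans this⟩, h2⟩
        · exact ⟨⟨Nat.pos_of_ne_zero (by rintro rfl; simp at h1), h1.2⟩, h2⟩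
    · rw [Finset.disjoint_left]
      intro m h1 h2
      simp only [Finset.mem_filter, Finset.mem_Icc, Finset.mem_Ioc] at h1 h2
      omega
  rw [← Finset.sum_filter_add_sum_filter_not (Finset.Icc 1 R) (p ∣ ·), e1, e3]
  ring

/-- The Selberg majorant on multiples of `q`, for a sequence of level of distribution. -/
theorem abs_sum_mul_selbergSum_sq_sub_le {w : ℕ → ℝ} {M R q : ℕ} {X E : ℝ} (hq : 0 < q)
    (hw : ∀ d : ℕ, 0 < d → |∑ n ∈ Finset.Icc 1 M with d ∣ n, w n - X / d| ≤ E)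
    {s : Finset ℕ} (hs : s ⊆ Finset.Icc 1 R) (hsq : ∀ m ∈ s, Nat.Coprime m q) :
    |∑ n ∈ Finset.Icc 1 M with q ∣ n, w n * selbergSum s R n ^ 2
      - X / q * ∑ m ∈ s, selbergG m|
      ≤ E * (R * (∑ m ∈ Finset.Icc 1 R, selbergG m) ^ 2) ^ 2 := by
  set Λ := (∑ m ∈ Finset.Icc 1 R, selbergG m) ^ 2 with hΛ
  have hE : 0 ≤ E := (abs_nonneg _).trans (hw 1 one_pos)
  have hΛ0 : 0 ≤ Λ := sq_nonneg _
  have hcop : ∀ d, ¬Nat.Coprime d q → selbergWeight s d = 0 := fun d hd =>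
    selbergWeight_eq_zero_of_not_dvd fun m hm h => hd ((hsq m hm).coprime_dvd_left h)
  have e1 : ∑ n ∈ Finset.Icc 1 M with q ∣ n, w n * selbergSum s R n ^ 2 =
      ∑ d ∈ Finset.Icc 1 R, ∑ e ∈ Finset.Icc 1 R, selbergWeight s d * selbergWeight s e *
        ∑ n ∈ Finset.Icc 1 M with q * Nat.lcm d e ∣ n, w n := by
    have h1 : ∀ n ∈ (Finset.Icc 1 M).filter (q ∣ ·), w n * selbergSum s R n ^ 2 =
        ∑ d ∈ Finset.Icc 1 R, ∑ e ∈ Finset.Icc 1 R,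
          if d ∣ n ∧ e ∣ n then selbergWeight s d * selbergWeight s e * w n else 0 := by
      intro n _
      rw [selbergSum, sq, Finset.sum_filter, Finset.sum_mul_sum, Finset.mul_sum]
      refine Finset.sum_congr rfl fun d _ => ?_
      rw [Finset.mul_sum]
      refine Finset.sum_congr rfl fun e _ => ?_
      by_cases hd : d ∣ n <;> by_cases he : e ∣ n <;> simp [hd, he]
      ring
    rw [Finset.sum_congr rfl h1, Finset.sum_comm]
    refine Finset.sum_congr rfl fun d _ => ?_
    rw [Finset.sum_comm]
    refine Finset.sum_congr rfl fun e _ => ?_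
    by_cases hd : Nat.Coprime d q
    · by_cases he : Nat.Coprime e q
      · rw [Finset.mul_sum, ← Finset.sum_filter, Finset.filter_filter]
        refine Finset.sum_congr (Finset.filter_congr fun n _ => ?_) fun _ _ => rfl
        rw [← Nat.lcm_dvd_iff]
        have hc : Nat.Coprime q (Nat.lcm d e) :=
          ((hd.mul_left he).coprime_dvd_left (Nat.lcm_dvd_mul d e)).symm
        exact ⟨fun h => hc.mul_dvd_of_dvd_of_dvd h.1 h.2,
          fun h => ⟨(Dvd.intro _ rfl).trans h, (Dvd.intro_left _ rfl).trans h⟩⟩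
      · simp [hcop e he]
    · simp [hcop d hd]
  have e2 : X / q * ∑ m ∈ s, selbergG m = ∑ d ∈ Finset.Icc 1 R, ∑ e ∈ Finset.Icc 1 R,
      selbergWeight s d * selbergWeight s e * (X / (q * Nat.lcm d e : ℕ)) := by
    rw [← sum_selbergWeight_mul_div_lcm hs, Finset.mul_sum]
    refine Finset.sum_congr rfl fun d _ => ?_
    rw [Finset.mul_sum]
    refine Finset.sum_congr rfl fun e _ => ?_
    push_cast
    rw [div_mul_div_comm, mul_div_assoc', mul_comm X]
  rw [e1, e2]
  simp_rw [← Finset.sum_sub_distrib, ← mul_sub]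
  calc |∑ d ∈ Finset.Icc 1 R, ∑ e ∈ Finset.Icc 1 R, selbergWeight s d * selbergWeight s e *
          (∑ n ∈ Finset.Icc 1 M with q * Nat.lcm d e ∣ n, w n - X / (q * Nat.lcm d e : ℕ))|
      ≤ ∑ d ∈ Finset.Icc 1 R, ∑ e ∈ Finset.Icc 1 R, Λ * Λ * E := by
        refine (Finset.abs_sum_le_sum_abs _ _).trans (Finset.sum_le_sum fun d hd => ?_)
        refine (Finset.abs_sum_le_sum_abs _ _).trans (Finset.sum_le_sum fun e he => ?_)
        rw [abs_mul, abs_mul]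
        have h1 := abs_selbergWeight_le hs hd
        have h2 := abs_selbergWeight_le hs he
        have h3 := hw (q * Nat.lcm d e) (Nat.mul_pos hq
          (Nat.lcm_pos (Finset.mem_Icc.1 hd).1 (Finset.mem_Icc.1 he).1))
        gcongr
    _ = _ := by
        simp only [Finset.sum_const, Nat.card_Icc, nsmul_eq_mul]
        push_cast
        ring
theorem hasSum_inv_mul_inv_selbergG {r : ℕ} (hr : Squarefree r) :
    HasSum (fun b : ℕ => if b ≠ 0 ∧ b.primeFactors ⊆ r.primeFactors then (r : ℝ)⁻¹ * (b : ℝ)⁻¹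
      else 0) (selbergG r) := by
  have hr0 : r ≠ 0 := hr.ne_zero
  let f : ℕ →* ℝ :=
    { toFun := fun n => (n : ℝ)⁻¹
      map_one' := by simp
      map_mul' := fun a b => by push_cast; rw [mul_inv] }
  have hf : ∀ {p : ℕ}, p.Prime → ‖f p‖ < 1 := fun {p} hp => by
    change ‖(p : ℝ)⁻¹‖ < 1
    rw [norm_inv, Real.norm_natCast]
    exact inv_lt_one_of_one_lt₀ (by exact_mod_cast hp.one_lt)
  have h := (EulerProduct.summable_and_hasSum_factoredNumbers_prod_filter_prime_geometric hf
    r.primeFactors).2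
  have h2 := (hasSum_subtype_iff_indicator (f := fun n : ℕ => f n)
    (s := Nat.factoredNumbers r.primeFactors)).1 h
  have h3 := h2.mul_left (r : ℝ)⁻¹
  have hval : (r : ℝ)⁻¹ * ∏ p ∈ r.primeFactors with p.Prime, (1 - f p)⁻¹ = selbergG r := by
    rw [selbergG_of_squarefree hr, Finset.filter_true_of_mem fun p hp =>
      Nat.prime_of_mem_primeFactors hp]
    have ht : (Nat.totient r : ℝ) = r * ∏ p ∈ r.primeFactors, (1 - (p : ℝ)⁻¹) := by
      have := Nat.totient_eq_mul_prod_factors r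
      have h' := congrArg (fun q : ℚ => (q : ℝ)) this
      push_cast at h'
      exact h'
    rw [ht, mul_inv, Finset.prod_inv_distrib]
    rfl
  rw [hval] at h3
  have hfun : (fun b : ℕ => if b ≠ 0 ∧ b.primeFactors ⊆ r.primeFactors then
      (r : ℝ)⁻¹ * (b : ℝ)⁻¹ else 0) = fun b => (r : ℝ)⁻¹ *
        (Nat.factoredNumbers r.primeFactors).indicator (fun n : ℕ => f n) b := by
    funext b
    by_cases hb : b ∈ Nat.factoredNumbers r.primeFactors
    · rw [Set.indicator_of_mem hb, if_pos ⟨Nat.ne_zero_of_mem_factoredNumbers hb,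
        Nat.primeFactors_subset_of_mem_factoredNumbers hb⟩]
      rfl
    · rw [Set.indicator_of_notMem hb, mul_zero, if_neg]
      rintro ⟨h0, hs⟩
      exact hb (Nat.mem_factoredNumbers_of_primeFactors_subset h0 hs)
  rw [hfun]
  exact h3

theorem radical_mul_of_primeFactors_subset {r b : ℕ} (hr : Squarefree r) (hb : b ≠ 0)
    (h : b.primeFactors ⊆ r.primeFactors) : UniqueFactorizationMonoid.radical (r * b) = r := by
  rw [Nat.radical_eq_prod_primeFactors, Nat.primeFactors_mul hr.ne_zero hb,
    Finset.union_eq_left.2 h, Nat.prod_primeFactors_of_squarefree hr]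

theorem log_le_sum_selbergG (x : ℕ) : Real.log (x + 1) ≤ ∑ m ∈ Finset.Icc 1 x, selbergG m := by
  classical
  have h1 : Real.log (x + 1) ≤ ∑ n ∈ Finset.Icc 1 x, (n : ℝ)⁻¹ := by
    have h := log_add_one_le_harmonic x
    rw [harmonic_eq_sum_Icc] at h
    push_cast at h
    exact h
  refine h1.trans ?_
  have hmaps : ∀ n ∈ Finset.Icc 1 x, UniqueFactorizationMonoid.radical n ∈ Finset.Icc 1 x := by
    intro n hn
    rw [Finset.mem_Icc] at hn ⊢
    exact ⟨Nat.radical_pos n, (Nat.le_of_dvd hn.1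
      UniqueFactorizationMonoid.radical_dvd_self).trans hn.2⟩
  rw [← Finset.sum_fiberwise_of_maps_to hmaps]
  refine Finset.sum_le_sum fun r hr => ?_
  by_cases hs : Squarefree r
  swap
  · rw [selbergG_of_not_squarefree hs, Finset.sum_eq_zero]
    intro n hn
    exact absurd ((Finset.mem_filter.1 hn).2 ▸ UniqueFactorizationMonoid.squarefree_radical) hs
  have hdvd : ∀ n ∈ (Finset.Icc 1 x).filter (fun n => UniqueFactorizationMonoid.radical n = r),
      r * (n / r) = n := by
    intro n hn
    exact Nat.mul_div_cancel' ((Finset.mem_filter.1 hn).2 ▸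
      UniqueFactorizationMonoid.radical_dvd_self)
  have hinj : Set.InjOn (fun n => n / r)
      ((Finset.Icc 1 x).filter (fun n => UniqueFactorizationMonoid.radical n = r) : Set ℕ) := by
    intro n hn m hm hnm
    rw [← hdvd n hn, ← hdvd m hm]
    exact congrArg (r * ·) hnm
  have hle := sum_le_hasSum
    (((Finset.Icc 1 x).filter (fun n => UniqueFactorizationMonoid.radical n = r)).image
      fun n => n / r) (fun b _ => by
        split_ifs
        · positivity
        · exact le_rfl) (hasSum_inv_mul_inv_selbergG hs)
  rw [Finset.sum_image hinj] at hle
  refine le_trans (le_of_eq (Finset.sum_congr rfl fun n hn => ?_)) hle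
  have hn1 := hdvd n hn
  have hn0 : n ≠ 0 := by
    have := (Finset.mem_Icc.1 (Finset.mem_filter.1 hn).1).1
    omega
  have hb0 : n / r ≠ 0 := by
    intro h0
    rw [h0, mul_zero] at hn1
    exact hn0 hn1.symm
  rw [if_pos, ← mul_inv, ← Nat.cast_mul, hn1]
  refine ⟨hb0, ?_⟩
  have hr' : r.primeFactors = n.primeFactors := by
    rw [← (Finset.mem_filter.1 hn).2, Nat.primeFactors_radical]
  rw [hr']
  exact Nat.primeFactors_mono (Dvd.intro_left r hn1) hn0

theorem sum_Ioc_inv_le {U V : ℕ} (hVU : V ≤ U) :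
    ∑ u ∈ Finset.Ioc V U, (u : ℝ)⁻¹ ≤ 1 + Real.log U - Real.log (V + 1) := by
  have hl : Real.log (V + 1) ≤ ∑ n ∈ Finset.Ioc 0 V, (n : ℝ)⁻¹ := by
    have h := log_add_one_le_harmonic V
    rw [harmonic_eq_sum_Icc] at h
    push_cast at h
    exact h
  have hu : ∑ n ∈ Finset.Ioc 0 U, (n : ℝ)⁻¹ ≤ 1 + Real.log U := by
    have h := harmonic_le_one_add_log U
    rw [harmonic_eq_sum_Icc] at h
    push_cast at h
    exact h
  have h := Finset.sum_Ioc_consecutive (fun n : ℕ => (n : ℝ)⁻¹) (Nat.zero_le V) hVU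
  linarith

theorem sum_inv_dvd_filter_le {x b q : ℕ} (hb : 0 < b) (hq : 0 < q) :
    ∑ r ∈ Finset.Icc 1 x with q ∣ r ∧ x < r * b, (r : ℝ)⁻¹ ≤ (1 + Real.log b) / q := by
  have hb1 : (1 : ℝ) ≤ b := by exact_mod_cast hb
  have hlogb := Real.log_nonneg hb1
  have hdvd : ∀ r ∈ (Finset.Icc 1 x).filter (fun r => q ∣ r ∧ x < r * b), q * (r / q) = r :=
    fun r hr => Nat.mul_div_cancel' (Finset.mem_filter.1 hr).2.1
  have hinj : Set.InjOn (fun n => n / q)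
      ((Finset.Icc 1 x).filter (fun r => q ∣ r ∧ x < r * b) : Set ℕ) := by
    intro n hn m hm hnm
    rw [← hdvd n hn, ← hdvd m hm]
    exact congrArg (q * ·) hnm
  have hsub : ((Finset.Icc 1 x).filter (fun r => q ∣ r ∧ x < r * b)).image (fun n => n / q) ⊆
      Finset.Ioc (x / (b * q)) (x / q) := by
    intro u hu
    obtain ⟨r, hr, rfl⟩ := Finset.mem_image.1 hu
    have h1 := hdvd r hr
    obtain ⟨h2, h3, h4⟩ := Finset.mem_filter.1 hr
    rw [Finset.mem_Icc] at h2
    rw [Finset.mem_Ioc]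
    refine ⟨?_, Nat.div_le_div_right h2.2⟩
    rw [Nat.div_lt_iff_lt_mul (by positivity)]
    calc x < r * b := h4
      _ = q * (r / q) * b := by rw [h1]
      _ = r / q * (b * q) := by ring
  have hle : x / (b * q) ≤ x / q := Nat.div_le_div_left (Nat.le_mul_of_pos_left q hb) hq
  have hlog : Real.log (x / q : ℕ) - Real.log ((x / (b * q) : ℕ) + 1) ≤ Real.log b := by
    rcases Nat.eq_zero_or_pos (x / q) with h0 | h0
    · rw [h0]
      have : 0 ≤ Real.log (((x / (b * q) : ℕ) : ℝ) + 1) := by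
        apply Real.log_nonneg
        have : (0 : ℝ) ≤ ((x / (b * q) : ℕ) : ℝ) := Nat.cast_nonneg _
        linarith
      simp only [Nat.cast_zero, Real.log_zero]
      linarith
    · have hnat : x / q ≤ b * (x / (b * q) + 1) := by
        have h1 : x < (b * q) * (x / (b * q) + 1) := Nat.lt_mul_div_succ x (by positivity)
        apply Nat.le_of_lt
        rw [Nat.div_lt_iff_lt_mul hq]
        calc x < (b * q) * (x / (b * q) + 1) := h1
          _ = _ := by ring
      have h2 : ((x / q : ℕ) : ℝ) ≤ b * (((x / (b * q) : ℕ) : ℝ) + 1) := by exact_mod_cast hnat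
      have h3 : (0 : ℝ) < ((x / (b * q) : ℕ) : ℝ) + 1 := by positivity
      have h4 := Real.log_le_log (by exact_mod_cast h0) h2
      rw [Real.log_mul (by positivity) h3.ne'] at h4
      linarith
  calc ∑ r ∈ Finset.Icc 1 x with q ∣ r ∧ x < r * b, (r : ℝ)⁻¹
      = ∑ r ∈ Finset.Icc 1 x with q ∣ r ∧ x < r * b, (q : ℝ)⁻¹ * ((r / q : ℕ) : ℝ)⁻¹ := by
        refine Finset.sum_congr rfl fun r hr => ?_
        rw [← mul_inv, ← Nat.cast_mul, hdvd r hr]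
    _ = (q : ℝ)⁻¹ * ∑ u ∈ ((Finset.Icc 1 x).filter (fun r => q ∣ r ∧ x < r * b)).image
          (fun n => n / q), (u : ℝ)⁻¹ := by
        rw [Finset.sum_image hinj, Finset.mul_sum]
    _ ≤ (q : ℝ)⁻¹ * ∑ u ∈ Finset.Ioc (x / (b * q)) (x / q), (u : ℝ)⁻¹ :=
        mul_le_mul_of_nonneg_left (Finset.sum_le_sum_of_subset_of_nonneg hsub
          fun _ _ _ => by positivity) (by positivity)
    _ ≤ (q : ℝ)⁻¹ * (1 + Real.log b) :=
        mul_le_mul_of_nonneg_left ((sum_Ioc_inv_le hle).trans (by linarith)) (by positivity)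
    _ = (1 + Real.log b) / q := by ring

theorem exists_sum_one_add_log_div_radical_le : ∃ K : ℝ, 0 ≤ K ∧ ∀ t : Finset ℕ,
    ∑ b ∈ t, (1 + Real.log b) / (b * UniqueFactorizationMonoid.radical b) ≤ K := by
  have hsum : Summable fun z : ℕ × ℕ =>
      (5 * ((z.1 : ℝ) ^ (7 / 4 : ℝ))⁻¹) * ((z.2 : ℝ) ^ (3 / 2 : ℝ))⁻¹ := by
    refine Summable.mul_of_nonneg
      (f := fun n : ℕ => 5 * ((n : ℝ) ^ (7 / 4 : ℝ))⁻¹)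
      (g := fun n : ℕ => ((n : ℝ) ^ (3 / 2 : ℝ))⁻¹)
      ((Real.summable_nat_rpow_inv.2 (by norm_num)).mul_left 5)
      (Real.summable_nat_rpow_inv.2 (by norm_num)) (fun n => ?_) (fun n => ?_)
    · change (0 : ℝ) ≤ 5 * ((n : ℝ) ^ (7 / 4 : ℝ))⁻¹
      positivity
    · change (0 : ℝ) ≤ ((n : ℝ) ^ (3 / 2 : ℝ))⁻¹
      positivity
  have hex : ∀ b : ℕ, ∃ z : ℕ × ℕ, 0 < b → 0 < z.1 ∧ 0 < z.2 ∧ z.2 ^ 2 * z.1 = b ∧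
      Squarefree z.1 := by
    intro b
    by_cases hb : 0 < b
    · obtain ⟨s, t, hs, ht, h1, h2⟩ := Nat.sq_mul_squarefree_of_pos hb
      exact ⟨(s, t), fun _ => ⟨hs, ht, h1, h2⟩⟩
    · exact ⟨(0, 0), fun h => absurd h hb⟩
  choose F hF using hex
  refine ⟨∑' z : ℕ × ℕ, (5 * ((z.1 : ℝ) ^ (7 / 4 : ℝ))⁻¹) * ((z.2 : ℝ) ^ (3 / 2 : ℝ))⁻¹,
    tsum_nonneg fun z => by positivity, fun t => ?_⟩
  have hinj : Set.InjOn F (t.filter (0 < ·) : Set ℕ) := by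
    intro a ha b hb hab
    have ha' := hF a (Finset.mem_filter.1 ha).2
    have hb' := hF b (Finset.mem_filter.1 hb).2
    rw [← ha'.2.2.1, ← hb'.2.2.1, hab]
  calc ∑ b ∈ t, (1 + Real.log b) / (b * UniqueFactorizationMonoid.radical b)
      = ∑ b ∈ t with 0 < b, (1 + Real.log b) / (b * UniqueFactorizationMonoid.radical b) := by
        rw [Finset.sum_filter]
        refine Finset.sum_congr rfl fun b _ => ?_
        split_ifs with h
        · rfl
        · rw [Nat.eq_zero_of_not_pos h]
          simp
    _ ≤ ∑ b ∈ t with 0 < b, (5 * (((F b).1 : ℝ) ^ (7 / 4 : ℝ))⁻¹) *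
          (((F b).2 : ℝ) ^ (3 / 2 : ℝ))⁻¹ := by
        refine Finset.sum_le_sum fun b hb => ?_
        have hb0 := (Finset.mem_filter.1 hb).2
        obtain ⟨hs, ht, hst, hsq⟩ := hF b hb0
        set s := (F b).1
        set u := (F b).2
        have hsR : (0 : ℝ) < s := by exact_mod_cast hs
        have huR : (0 : ℝ) < u := by exact_mod_cast ht
        have hbR : (1 : ℝ) ≤ b := by exact_mod_cast hb0
        have hrad : s ≤ UniqueFactorizationMonoid.radical b := by
          refine Nat.le_of_dvd (Nat.radical_pos b) ?_
          have h1 : UniqueFactorizationMonoid.radical s ∣ UniqueFactorizationMonoid.radical b := by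
            rw [Nat.radical_dvd_iff (Nat.radical_pos b).ne', Nat.primeFactors_radical]
            exact Nat.primeFactors_mono (Dvd.intro_left _ hst) hb0.ne'
          rwa [Nat.radical_eq_prod_primeFactors, Nat.prod_primeFactors_of_squarefree hsq] at h1
        have hlog : 1 + Real.log b ≤ 5 * (b : ℝ) ^ (1 / 4 : ℝ) := by
          have h1 := Real.log_le_rpow_div (by linarith : (0 : ℝ) ≤ b) (by norm_num : (0 : ℝ) < 1 / 4)
          have h2 := Real.one_le_rpow hbR (by norm_num : (0 : ℝ) ≤ 1 / 4)
          have h3 : (b : ℝ) ^ (1 / 4 : ℝ) / (1 / 4) = 4 * (b : ℝ) ^ (1 / 4 : ℝ) := by ring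
          rw [h3] at h1
          linarith
        have hbeq : (b : ℝ) = (u : ℝ) ^ (2 : ℝ) * s := by
          rw [← hst]
          push_cast
          rw [Real.rpow_two]
        have hb34 : (b : ℝ) ^ (3 / 4 : ℝ) = (u : ℝ) ^ (3 / 2 : ℝ) * (s : ℝ) ^ (3 / 4 : ℝ) := by
          rw [hbeq, Real.mul_rpow (by positivity) hsR.le, ← Real.rpow_mul huR.le]
          norm_num
        have hs74 : (s : ℝ) ^ (7 / 4 : ℝ) = (s : ℝ) ^ (3 / 4 : ℝ) * s := by
          rw [← Real.rpow_add_one hsR.ne']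
          norm_num
        have hb14 : (b : ℝ) = (b : ℝ) ^ (1 / 4 : ℝ) * (b : ℝ) ^ (3 / 4 : ℝ) := by
          rw [← Real.rpow_add (by linarith)]
          norm_num
        have hradR : (s : ℝ) ≤ (UniqueFactorizationMonoid.radical b : ℕ) := by exact_mod_cast hrad
        have hq : (0 : ℝ) < (b : ℝ) ^ (1 / 4 : ℝ) := by positivity
        have hq3 : (0 : ℝ) < (b : ℝ) ^ (3 / 4 : ℝ) := by positivity
        calc (1 + Real.log b) / (b * (UniqueFactorizationMonoid.radical b : ℕ))
            ≤ (5 * (b : ℝ) ^ (1 / 4 : ℝ)) / (b * s) := by gcongr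
          _ = 5 / ((b : ℝ) ^ (3 / 4 : ℝ) * s) := by
              nth_rewrite 2 [hb14]
              field_simp
          _ = _ := by
              rw [hb34, hs74]
              field_simp
    _ = ∑ z ∈ (t.filter (0 < ·)).image F, (5 * ((z.1 : ℝ) ^ (7 / 4 : ℝ))⁻¹) *
          ((z.2 : ℝ) ^ (3 / 2 : ℝ))⁻¹ := by rw [Finset.sum_image hinj]
    _ ≤ _ := hsum.sum_le_tsum _ fun z _ => by positivity

theorem exists_sum_selbergG_le :
    ∃ K : ℝ, 0 ≤ K ∧ ∀ x : ℕ, ∑ m ∈ Finset.Icc 1 x, selbergG m ≤ Real.log x + K := by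
  classical
  obtain ⟨K, hK0, hK⟩ := exists_sum_one_add_log_div_radical_le
  refine ⟨1 + K, by linarith, fun x => ?_⟩
  have hS : ∑ m ∈ Finset.Icc 1 x, selbergG m = ∑ r ∈ Finset.Icc 1 x with Squarefree r,
      selbergG r := by
    rw [Finset.sum_filter]
    refine Finset.sum_congr rfl fun m _ => ?_
    split_ifs with h
    · rfl
    · exact selbergG_of_not_squarefree h
  rw [hS]
  have hsum := hasSum_sum (s := (Finset.Icc 1 x).filter Squarefree)
    (fun r hr => hasSum_inv_mul_inv_selbergG (Finset.mem_filter.1 hr).2)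
  refine hasSum_le_of_sum_le hsum fun t => ?_
  have hcond : ∀ r ∈ (Finset.Icc 1 x).filter Squarefree, ∀ b : ℕ,
      (if b ≠ 0 ∧ b.primeFactors ⊆ r.primeFactors then (r : ℝ)⁻¹ * (b : ℝ)⁻¹ else 0) ≤
      (if b ≠ 0 ∧ b.primeFactors ⊆ r.primeFactors ∧ r * b ≤ x then ((r * b : ℕ) : ℝ)⁻¹ else 0) +
      (b : ℝ)⁻¹ * (if UniqueFactorizationMonoid.radical b ∣ r ∧ x < r * b then (r : ℝ)⁻¹
        else 0) := by
    intro r hr b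
    have hr0 : r ≠ 0 := (Finset.mem_filter.1 hr).2.ne_zero
    have hiff := Nat.radical_dvd_iff (n := b) hr0
    by_cases h1 : b ≠ 0 ∧ b.primeFactors ⊆ r.primeFactors
    · rw [if_pos h1]
      rcases le_or_gt (r * b) x with h2 | h2
      · rw [if_pos ⟨h1.1, h1.2, h2⟩, if_neg (by omega)]
        push_cast
        rw [mul_inv]
        linarith
      · rw [if_neg (by omega), if_pos ⟨hiff.2 h1.2, h2⟩]
        linarith [mul_comm (r : ℝ)⁻¹ (b : ℝ)⁻¹]
    · rw [if_neg h1]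
      positivity
  have hfirst : ∑ b ∈ t, ∑ r ∈ Finset.Icc 1 x with Squarefree r,
      (if b ≠ 0 ∧ b.primeFactors ⊆ r.primeFactors ∧ r * b ≤ x then ((r * b : ℕ) : ℝ)⁻¹ else 0) ≤
      1 + Real.log x := by
    have hu : ∑ n ∈ Finset.Icc 1 x, (n : ℝ)⁻¹ ≤ 1 + Real.log x := by
      have h := harmonic_le_one_add_log x
      rw [harmonic_eq_sum_Icc] at h
      push_cast at h
      exact h
    refine le_trans ?_ hu
    rw [← Finset.sum_product', ← Finset.sum_filter]
    set T := (t ×ˢ (Finset.Icc 1 x).filter Squarefree).filter (fun z : ℕ × ℕ =>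
      z.1 ≠ 0 ∧ z.1.primeFactors ⊆ z.2.primeFactors ∧ z.2 * z.1 ≤ x) with hT
    have hmem : ∀ z ∈ T, Squarefree z.2 ∧ z.1 ≠ 0 ∧ z.1.primeFactors ⊆ z.2.primeFactors ∧
        z.2 * z.1 ≤ x := by
      intro z hz
      obtain ⟨h1, h2⟩ := Finset.mem_filter.1 hz
      exact ⟨(Finset.mem_filter.1 (Finset.mem_product.1 h1).2).2, h2⟩
    have hinj : Set.InjOn (fun z : ℕ × ℕ => z.2 * z.1) (T : Set (ℕ × ℕ)) := by
      intro z hz w hw hzw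
      obtain ⟨h1, h2, h3, -⟩ := hmem z hz
      obtain ⟨g1, g2, g3, -⟩ := hmem w hw
      have h4 := radical_mul_of_primeFactors_subset h1 h2 h3
      have g4 := radical_mul_of_primeFactors_subset g1 g2 g3
      have hzw' : z.2 * z.1 = w.2 * w.1 := hzw
      rw [hzw', g4] at h4
      rw [h4] at hzw'
      exact Prod.ext (Nat.eq_of_mul_eq_mul_left (Nat.pos_of_ne_zero h1.ne_zero) hzw').symm.symm
        h4.symm
    rw [← Finset.sum_image (f := fun n : ℕ => (n : ℝ)⁻¹) hinj]
    refine Finset.sum_le_sum_of_subset_of_nonneg ?_ fun _ _ _ => by positivity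
    intro n hn
    obtain ⟨z, hz, rfl⟩ := Finset.mem_image.1 hn
    obtain ⟨h1, h2, h3, h4⟩ := hmem z hz
    exact Finset.mem_Icc.2 ⟨Nat.mul_pos (Nat.pos_of_ne_zero h1.ne_zero) (Nat.pos_of_ne_zero h2), h4⟩
  have hsecond : ∑ b ∈ t, ∑ r ∈ Finset.Icc 1 x with Squarefree r, (b : ℝ)⁻¹ *
      (if UniqueFactorizationMonoid.radical b ∣ r ∧ x < r * b then (r : ℝ)⁻¹ else 0) ≤ K := by
    refine le_trans (Finset.sum_le_sum fun b _ => ?_) (hK t)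
    rw [← Finset.mul_sum]
    rcases Nat.eq_zero_or_pos b with rfl | hb
    · simp
    have hle := sum_inv_dvd_filter_le (x := x) hb (Nat.radical_pos b)
    rw [Finset.sum_filter] at hle
    have hsub : ∑ r ∈ Finset.Icc 1 x with Squarefree r,
        (if UniqueFactorizationMonoid.radical b ∣ r ∧ x < r * b then (r : ℝ)⁻¹ else 0) ≤
        ∑ r ∈ Finset.Icc 1 x,
        (if UniqueFactorizationMonoid.radical b ∣ r ∧ x < r * b then (r : ℝ)⁻¹ else 0) :=
      Finset.sum_le_sum_of_subset_of_nonneg (Finset.filter_subset _ _)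
        fun _ _ _ => by positivity
    calc (b : ℝ)⁻¹ * _ ≤ (b : ℝ)⁻¹ * ((1 + Real.log b) / UniqueFactorizationMonoid.radical b) :=
          mul_le_mul_of_nonneg_left (hsub.trans hle) (by positivity)
      _ = _ := by
          rw [inv_mul_eq_div, div_div, mul_comm (b : ℝ)]
  refine (Finset.sum_le_sum fun b _ => Finset.sum_le_sum fun r hr => hcond r hr b).trans ?_
  simp only [Finset.sum_add_distrib]
  linarith

theorem sum_log_div_prime_le (n : ℕ) :
    ∑ p ∈ Finset.Icc 1 n with p.Prime, Real.log p / p ≤ Real.log n + 2 := by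
  classical
  rcases Nat.eq_zero_or_pos n with rfl | hn
  · simp
  have hnR : (0 : ℝ) < n := by exact_mod_cast hn
  have hfac : ∀ m : ℕ, 0 < m → ∑ p ∈ m.primeFactors, Real.log p ≤ Real.log m := by
    intro m hm
    rw [← Real.log_prod fun p hp => by
      exact_mod_cast (Nat.prime_of_mem_primeFactors hp).ne_zero]
    have hle := Nat.le_of_dvd hm (Nat.prod_primeFactors_dvd m)
    have hpos : 0 < ∏ p ∈ m.primeFactors, p :=
      Finset.prod_pos fun p hp => (Nat.prime_of_mem_primeFactors hp).pos
    rw [← Nat.cast_prod]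
    exact Real.log_le_log (by exact_mod_cast hpos) (by exact_mod_cast hle)
  have hdouble : ∑ p ∈ Finset.Icc 1 n with p.Prime, ((n / p : ℕ) : ℝ) * Real.log p ≤
      n * Real.log n := by
    calc ∑ p ∈ Finset.Icc 1 n with p.Prime, ((n / p : ℕ) : ℝ) * Real.log p
        = ∑ p ∈ Finset.Icc 1 n with p.Prime, ∑ m ∈ Finset.Icc 1 n with p ∣ m, Real.log p := by
          refine Finset.sum_congr rfl fun p _ => ?_
          rw [Finset.sum_const, nsmul_eq_mul]
          have := Nat.Ioc_filter_dvd_card_eq_div n p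
          rw [← this]
          rfl
      _ = ∑ m ∈ Finset.Icc 1 n, ∑ p ∈ Finset.Icc 1 n with p.Prime ∧ p ∣ m, Real.log p := by
          refine Finset.sum_comm' fun p m => ?_
          simp only [Finset.mem_filter]
          tauto
      _ ≤ ∑ m ∈ Finset.Icc 1 n, Real.log n := by
          refine Finset.sum_le_sum fun m hm => ?_
          rw [Finset.mem_Icc] at hm
          refine le_trans (le_trans (le_of_eq ?_) (hfac m hm.1)) (Real.log_le_log
            (by exact_mod_cast hm.1) (by exact_mod_cast hm.2))
          refine Finset.sum_congr ?_ fun _ _ => rfl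
          ext p
          simp only [Finset.mem_filter, Finset.mem_Icc, Nat.mem_primeFactors]
          constructor
          · rintro ⟨-, h1, h2⟩
            exact ⟨h1, h2, by omega⟩
          · rintro ⟨h1, h2, -⟩
            exact ⟨⟨h1.one_lt.le, (Nat.le_of_dvd hm.1 h2).trans hm.2⟩, h1, h2⟩
      _ = n * Real.log n := by simp
  have htheta : ∑ p ∈ Finset.Icc 1 n with p.Prime, Real.log p ≤ 2 * n := by
    have h := Chebyshev.theta_le_log4_mul_x hnR.le
    rw [Chebyshev.theta, Nat.floor_natCast] at h
    have h4 : Real.log 4 ≤ 2 := by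
      have h1 : Real.log 4 = 2 * Real.log 2 := by
        rw [show (4 : ℝ) = 2 ^ 2 by norm_num, Real.log_pow]
        norm_num
      have := Real.log_two_lt_d9
      linarith
    exact h.trans (by gcongr)
  have hpt : ∑ p ∈ Finset.Icc 1 n with p.Prime, n * (Real.log p / p) ≤
      ∑ p ∈ Finset.Icc 1 n with p.Prime, (((n / p : ℕ) : ℝ) * Real.log p + Real.log p) := by
    refine Finset.sum_le_sum fun p hp => ?_
    have hp1 := (Finset.mem_filter.1 hp).2
    have hp0 : (0 : ℝ) < p := by exact_mod_cast hp1.pos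
    have hlog : 0 ≤ Real.log p := Real.log_nonneg (by exact_mod_cast hp1.one_lt.le)
    have h1 : (n : ℝ) / p ≤ ((n / p : ℕ) : ℝ) + 1 := by
      rw [div_le_iff₀ hp0]
      have := (Nat.lt_mul_div_succ n hp1.pos).le
      have h2 : (n : ℝ) ≤ p * (((n / p : ℕ) : ℝ) + 1) := by exact_mod_cast this
      linarith
    calc n * (Real.log p / p) = n / p * Real.log p := by ring
      _ ≤ (((n / p : ℕ) : ℝ) + 1) * Real.log p := by gcongr
      _ = _ := by ring
  rw [← Finset.mul_sum, Finset.sum_add_distrib] at hpt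
  have : n * ∑ p ∈ Finset.Icc 1 n with p.Prime, Real.log p / p ≤ n * (Real.log n + 2) := by
    linarith
  exact le_of_mul_le_mul_left this hnR

theorem sum_selbergG_Ioc_not_dvd_le {K : ℝ}
    (hK : ∀ x : ℕ, ∑ m ∈ Finset.Icc 1 x, selbergG m ≤ Real.log x + K) (R : ℕ) {p : ℕ}
    (hp : 0 < p) :
    ∑ m ∈ (Finset.Ioc (R / p) R).filter (fun m => ¬p ∣ m), selbergG m ≤ Real.log p + K := by
  have hp1 : (1 : ℝ) ≤ p := by exact_mod_cast hp
  have hsub : ∑ m ∈ (Finset.Ioc (R / p) R).filter (fun m => ¬p ∣ m), selbergG m ≤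
      ∑ m ∈ Finset.Ioc (R / p) R, selbergG m :=
    Finset.sum_le_sum_of_subset_of_nonneg (Finset.filter_subset _ _)
      fun m _ _ => selbergG_nonneg m
  have hsplit := Finset.sum_Ioc_consecutive selbergG (Nat.zero_le (R / p)) (Nat.div_le_self R p)
  have hlow : Real.log ((R / p : ℕ) + 1) ≤ ∑ m ∈ Finset.Ioc 0 (R / p), selbergG m :=
    log_le_sum_selbergG (R / p)
  have hup : ∑ m ∈ Finset.Ioc 0 R, selbergG m ≤ Real.log R + K := hK R
  have hlog : Real.log R ≤ Real.log p + Real.log ((R / p : ℕ) + 1) := by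
    have h3 : (0 : ℝ) < ((R / p : ℕ) : ℝ) + 1 := by positivity
    rw [← Real.log_mul (by linarith) h3.ne']
    rcases Nat.eq_zero_or_pos R with rfl | hR
    · simpa using Real.log_nonneg hp1
    · refine Real.log_le_log (by exact_mod_cast hR) ?_
      exact_mod_cast (Nat.lt_mul_div_succ R hp).le
  linarith

theorem sum_selbergG_Ioc_not_dvd_le_sum (R p : ℕ) :
    ∑ m ∈ (Finset.Ioc (R / p) R).filter (fun m => ¬p ∣ m), selbergG m ≤
      ∑ m ∈ Finset.Icc 1 R, selbergG m := by
  refine Finset.sum_le_sum_of_subset_of_nonneg (fun m hm => ?_) fun m _ _ => selbergG_nonneg m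
  have := (Finset.mem_filter.1 hm).1
  rw [Finset.mem_Ioc] at this
  exact Finset.mem_Icc.2 ⟨(Nat.zero_le _).trans_lt this.1, this.2⟩

theorem length_primeFactorsList_le_six {n y : ℕ} {l c₀ : ℝ} (hn : 0 < n) (hl : 0 < l)
    (hy : ∀ p ∈ Finset.Icc 1 y, 5 * Real.log p ≤ l)
    (hy' : ∀ p : ℕ, y < p → l ≤ 5 * Real.log p) (hc₀ : c₀ ≤ 7 - 5 * Real.log n / l)
    (h : 0 < c₀ - (∑ p ∈ Finset.Icc 1 y with p.Prime,
      if p ∣ n then 1 - 5 * Real.log p / l else 0) -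
      7 * ∑ p ∈ Finset.Icc 1 y with p.Prime, if p ^ 2 ∣ n then (1 : ℝ) else 0) :
    n.primeFactorsList.length ≤ 6 := by
  have hsmall : ∀ p ∈ Finset.Icc 1 y, 0 ≤ 1 - 5 * Real.log p / l := by
    intro p hp
    rw [sub_nonneg, div_le_one hl]
    exact hy p hp
  have hlogn : 0 ≤ 5 * Real.log n / l := by
    have : 0 ≤ Real.log n := Real.log_nonneg (by exact_mod_cast hn)
    positivity
  have hsum1 : 0 ≤ ∑ p ∈ Finset.Icc 1 y with p.Prime,
      if p ∣ n then 1 - 5 * Real.log p / l else 0 := by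
    refine Finset.sum_nonneg fun p hp => ?_
    split_ifs
    · exact hsmall p (Finset.mem_filter.1 hp).1
    · exact le_rfl
  have hsq : ∀ p ∈ Finset.Icc 1 y, p.Prime → ¬p ^ 2 ∣ n := by
    intro p hp hpp hdvd
    have hone : (1 : ℝ) ≤ ∑ p ∈ Finset.Icc 1 y with p.Prime, if p ^ 2 ∣ n then (1 : ℝ) else 0 := by
      have := Finset.single_le_sum (f := fun p : ℕ => if p ^ 2 ∣ n then (1 : ℝ) else 0)
        (fun q _ => by positivity) (Finset.mem_filter.2 ⟨hp, hpp⟩)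
      simpa only [if_pos hdvd] using this
    linarith
  have hsum2 : 0 ≤ ∑ p ∈ Finset.Icc 1 y with p.Prime, if p ^ 2 ∣ n then (1 : ℝ) else 0 :=
    Finset.sum_nonneg fun p _ => by positivity
  have hlen : (n.primeFactorsList.length : ℝ) = ∑ p ∈ n.primeFactors, (n.factorization p : ℝ) := by
    rw [← ArithmeticFunction.cardFactors_apply, ArithmeticFunction.cardFactors_eq_sum_factorization]
    rw [Finsupp.sum, Nat.support_factorization]
    push_cast
    rfl
  have hlog : Real.log n = ∑ p ∈ n.primeFactors, (n.factorization p : ℝ) * Real.log p := by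
    rw [Real.log_nat_eq_sum_factorization, Finsupp.sum, Nat.support_factorization]
  have hkey : (n.primeFactorsList.length : ℝ) - 5 * Real.log n / l ≤
      ∑ p ∈ Finset.Icc 1 y with p.Prime, if p ∣ n then 1 - 5 * Real.log p / l else 0 := by
    calc (n.primeFactorsList.length : ℝ) - 5 * Real.log n / l
        = ∑ p ∈ n.primeFactors, (n.factorization p : ℝ) * (1 - 5 * Real.log p / l) := by
          rw [hlen, hlog, Finset.mul_sum, Finset.sum_div, ← Finset.sum_sub_distrib]
          exact Finset.sum_congr rfl fun p _ => by ring
      _ ≤ ∑ p ∈ n.primeFactors, if p ≤ y then 1 - 5 * Real.log p / l else 0 := by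
          refine Finset.sum_le_sum fun p hp => ?_
          have hpp := Nat.prime_of_mem_primeFactors hp
          have hpn := Nat.dvd_of_mem_primeFactors hp
          split_ifs with hpy
          · have hmem : p ∈ Finset.Icc 1 y := Finset.mem_Icc.2 ⟨hpp.one_lt.le, hpy⟩
            have hv : n.factorization p ≤ 1 := by
              by_contra! hv
              exact hsq p hmem hpp ((hpp.pow_dvd_iff_le_factorization hn.ne').2 hv)
            have hvR : (n.factorization p : ℝ) ≤ 1 := by exact_mod_cast hv
            nlinarith [hsmall p hmem]
          · have h1 : 1 - 5 * Real.log p / l ≤ 0 := by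
              rw [sub_nonpos, one_le_div hl]
              exact hy' p (by omega)
            exact mul_nonpos_of_nonneg_of_nonpos (Nat.cast_nonneg _) h1
      _ = _ := by
          rw [← Finset.sum_filter, ← Finset.sum_filter, Finset.filter_filter]
          refine Finset.sum_congr ?_ fun _ _ => rfl
          ext p
          simp only [Finset.mem_filter, Finset.mem_Icc, Nat.mem_primeFactors]
          constructor
          · rintro ⟨⟨h1, h2, -⟩, h3⟩
            exact ⟨⟨h1.one_lt.le, h3⟩, h1, h2⟩
          · rintro ⟨⟨-, h3⟩, h1, h2⟩
            exact ⟨⟨h1, h2, hn.ne'⟩, h3⟩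
  have hlt : (n.primeFactorsList.length : ℝ) < 7 := by linarith
  have : n.primeFactorsList.length < 7 := by exact_mod_cast hlt
  omega

theorem le_sum_mul_selbergSum_sq_mul {w : ℕ → ℝ} {M R y : ℕ} {X E c₀ : ℝ} {k : ℕ → ℝ}
    (hw : ∀ d, 0 < d → |∑ n ∈ Finset.Icc 1 M with d ∣ n, w n - X / d| ≤ E)
    (hE : 0 ≤ E) (hy : 1 ≤ y) (hc₀ : 0 ≤ c₀) (hc₂ : c₀ ≤ 2)
    (hk : ∀ p ∈ Finset.Icc 1 y, 0 ≤ k p ∧ k p ≤ 1) :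
    X * (c₀ * ∑ m ∈ Finset.Icc 1 R, selbergG m - ∑ p ∈ Finset.Icc 1 y with p.Prime,
      (k p / p * ∑ m ∈ (Finset.Ioc (R / p) R).filter (fun m => ¬p ∣ m), selbergG m +
        7 / p ^ 2 * ∑ m ∈ (Finset.Ioc (R / p) R).filter (fun m => ¬p ∣ m), selbergG m)) -
      10 * y * (E * (R * (∑ m ∈ Finset.Icc 1 R, selbergG m) ^ 2) ^ 2) ≤
    ∑ n ∈ Finset.Icc 1 M, w n * selbergSum (Finset.Icc 1 R) R n ^ 2 *
      (c₀ - (∑ p ∈ Finset.Icc 1 y with p.Prime, if p ∣ n then k p else 0) -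
      7 * ∑ p ∈ Finset.Icc 1 y with p.Prime, if p ^ 2 ∣ n then (1 : ℝ) else 0) := by
  set D := E * (R * (∑ m ∈ Finset.Icc 1 R, selbergG m) ^ 2) ^ 2 with hD
  have hD0 : 0 ≤ D := by positivity
  set P := (Finset.Icc 1 y).filter Nat.Prime with hP
  set T : ℕ → ℝ := fun p =>
    ∑ m ∈ (Finset.Ioc (R / p) R).filter (fun m => ¬p ∣ m), selbergG m with hT
  set v : ℕ → ℝ := fun n => w n * selbergSum (Finset.Icc 1 R) R n ^ 2 with hv
  have h1 : |∑ n ∈ Finset.Icc 1 M, v n - X * ∑ m ∈ Finset.Icc 1 R, selbergG m| ≤ D := by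
    have := abs_sum_mul_selbergSum_sq_sub_le one_pos hw (Finset.Subset.refl (Finset.Icc 1 R))
      fun m _ => Nat.coprime_one_right m
    simpa using this
  have hq : ∀ p ∈ P, ∀ e : ℕ, 0 < e →
      |∑ n ∈ Finset.Icc 1 M with p ^ e ∣ n, v n - X / (p : ℝ) ^ e * T p| ≤ D := by
    intro p hp e he
    have hpp := (Finset.mem_filter.1 hp).2
    have := abs_sum_mul_selbergSum_sq_sub_le (R := R) (pow_pos hpp.pos e) hw
      (s := (Finset.Ioc (R / p) R).filter (fun m => ¬p ∣ m)) (fun m hm => by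
        have := (Finset.mem_filter.1 hm).1
        rw [Finset.mem_Ioc] at this
        exact Finset.mem_Icc.2 ⟨(Nat.zero_le _).trans_lt this.1, this.2⟩) (fun m hm => by
        refine Nat.Coprime.pow_right e ?_
        exact ((Nat.Prime.coprime_iff_not_dvd hpp).2 (Finset.mem_filter.1 hm).2).symm)
    push_cast at this
    have hcongr : ∑ n ∈ Finset.Icc 1 M with p ^ e ∣ n, v n =
        ∑ n ∈ Finset.Icc 1 M with p ^ e ∣ n, w n *
          selbergSum ((Finset.Ioc (R / p) R).filter (fun m => ¬p ∣ m)) R n ^ 2 := by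
      refine Finset.sum_congr rfl fun n hn => ?_
      have hpn : p ∣ n := (dvd_pow_self p he.ne').trans (Finset.mem_filter.1 hn).2
      change w n * selbergSum (Finset.Icc 1 R) R n ^ 2 = _
      rw [selbergSum_Icc_eq_of_dvd hpp hpn]
    rw [hcongr]
    exact this
  have hcard : (P.card : ℝ) ≤ y := by
    have h := Finset.card_filter_le (Finset.Icc 1 y) Nat.Prime
    rw [Nat.card_Icc] at h
    exact_mod_cast h
  have hyR : (1 : ℝ) ≤ y := by exact_mod_cast hy
  have hexp : ∑ n ∈ Finset.Icc 1 M, v n * (c₀ - (∑ p ∈ P, if p ∣ n then k p else 0) -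
      7 * ∑ p ∈ P, if p ^ 2 ∣ n then (1 : ℝ) else 0) =
      c₀ * ∑ n ∈ Finset.Icc 1 M, v n -
      ∑ p ∈ P, k p * ∑ n ∈ Finset.Icc 1 M with p ∣ n, v n -
      7 * ∑ p ∈ P, ∑ n ∈ Finset.Icc 1 M with p ^ 2 ∣ n, v n := by
    simp only [mul_sub, Finset.sum_sub_distrib, Finset.mul_sum, Finset.sum_filter]
    congr 1
    · congr 1
      · exact Finset.sum_congr rfl fun n _ => by ring
      · rw [Finset.sum_comm]
        refine Finset.sum_congr rfl fun p _ => Finset.sum_congr rfl fun n _ => ?_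
        split_ifs <;> ring
    · rw [Finset.sum_comm]
      refine Finset.sum_congr rfl fun p _ => Finset.sum_congr rfl fun n _ => ?_
      split_ifs <;> ring
  rw [hexp]
  have hb1 : c₀ * (X * ∑ m ∈ Finset.Icc 1 R, selbergG m) - 2 * D ≤
      c₀ * ∑ n ∈ Finset.Icc 1 M, v n := by
    have := (abs_le.1 h1).1
    nlinarith
  have hb2 : ∑ p ∈ P, k p * ∑ n ∈ Finset.Icc 1 M with p ∣ n, v n ≤
      ∑ p ∈ P, X * (k p / p * T p) + y * D := by
    calc ∑ p ∈ P, k p * ∑ n ∈ Finset.Icc 1 M with p ∣ n, v n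
        ≤ ∑ p ∈ P, (X * (k p / p * T p) + D) := by
          refine Finset.sum_le_sum fun p hp => ?_
          obtain ⟨hk0, hk1⟩ := hk p (Finset.mem_filter.1 hp).1
          have h := (abs_le.1 (hq p hp 1 one_pos)).2
          rw [pow_one, pow_one] at h
          have h2 : k p * ∑ n ∈ Finset.Icc 1 M with p ∣ n, v n ≤ k p * (X / p * T p + D) :=
            mul_le_mul_of_nonneg_left (by linarith) hk0
          have h3 : k p * D ≤ D := mul_le_of_le_one_left hD0 hk1
          calc _ ≤ k p * (X / p * T p + D) := h2
            _ = X * (k p / p * T p) + k p * D := by ring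
            _ ≤ _ := by linarith
      _ ≤ _ := by
          rw [Finset.sum_add_distrib, Finset.sum_const, nsmul_eq_mul]
          have := mul_le_mul_of_nonneg_right hcard hD0
          linarith
  have hb3 : ∑ p ∈ P, ∑ n ∈ Finset.Icc 1 M with p ^ 2 ∣ n, v n ≤
      ∑ p ∈ P, X / (p : ℝ) ^ 2 * T p + y * D := by
    calc ∑ p ∈ P, ∑ n ∈ Finset.Icc 1 M with p ^ 2 ∣ n, v n
        ≤ ∑ p ∈ P, (X / (p : ℝ) ^ 2 * T p + D) := by
          refine Finset.sum_le_sum fun p hp => ?_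
          have h := (abs_le.1 (hq p hp 2 two_pos)).2
          linarith
      _ ≤ _ := by
          rw [Finset.sum_add_distrib, Finset.sum_const, nsmul_eq_mul]
          have := mul_le_mul_of_nonneg_right hcard hD0
          linarith
  have hrw : X * (c₀ * ∑ m ∈ Finset.Icc 1 R, selbergG m -
      ∑ p ∈ P, (k p / p * T p + 7 / p ^ 2 * T p)) =
      c₀ * (X * ∑ m ∈ Finset.Icc 1 R, selbergG m) - ∑ p ∈ P, X * (k p / p * T p) -
        7 * ∑ p ∈ P, X / (p : ℝ) ^ 2 * T p := by
    rw [Finset.sum_add_distrib, ← Finset.mul_sum]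
    have : ∑ p ∈ P, 7 / (p : ℝ) ^ 2 * T p * X = 7 * ∑ p ∈ P, X / (p : ℝ) ^ 2 * T p := by
      rw [Finset.mul_sum]
      exact Finset.sum_congr rfl fun p _ => by ring
    rw [← this, ← Finset.sum_mul]
    ring
  have hyD : D ≤ y * D := le_mul_of_one_le_left hD0 hyR
  rw [hrw]
  linarith

theorem exists_one_le_selberg_main_term : ∃ L : ℝ, ∀ l : ℝ, L ≤ l → ∀ R y : ℕ,
    9 / 100 * l ≤ Real.log (R + 1) → Real.log R ≤ 9 / 100 * l →
    5 * Real.log y ≤ l →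
    1 ≤ (2 - 6 / l) * ∑ m ∈ Finset.Icc 1 R, selbergG m - ∑ p ∈ Finset.Icc 1 y with p.Prime,
      ((1 - 5 * Real.log p / l) / p *
        ∑ m ∈ (Finset.Ioc (R / p) R).filter (fun m => ¬p ∣ m), selbergG m +
        7 / p ^ 2 * ∑ m ∈ (Finset.Ioc (R / p) R).filter (fun m => ¬p ∣ m), selbergG m) := by
  obtain ⟨K, hK0, hK⟩ := exists_sum_selbergG_le
  have hZ : Summable fun n : ℕ => ((n : ℝ) ^ 2)⁻¹ := Real.summable_nat_pow_inv.2 (by norm_num)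
  set Z := ∑' n : ℕ, ((n : ℝ) ^ 2)⁻¹ with hZdef
  have hZ0 : 0 ≤ Z := tsum_nonneg fun n => by positivity
  set e : ℝ := 1 / 60 with he
  set B : ℝ := K * Real.exp (60 * K) + 7 * 420 + 7 * K with hB
  have hB0 : 0 ≤ B := by positivity
  refine ⟨1000 + 100 * (2 + B * Z), fun l hl R y hR1 hR2 hyl => ?_⟩
  have hBZ : 0 ≤ B * Z := mul_nonneg hB0 hZ0
  have hl0 : 0 < l := by linarith
  set S := ∑ m ∈ Finset.Icc 1 R, selbergG m with hS
  have hSl : 9 / 100 * l ≤ S := hR1.trans (log_le_sum_selbergG R)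
  have hS0 : 0 < S := by linarith
  have hpt : ∀ p ∈ (Finset.Icc 1 y).filter Nat.Prime,
      (1 - 5 * Real.log p / l) / p *
        ∑ m ∈ (Finset.Ioc (R / p) R).filter (fun m => ¬p ∣ m), selbergG m +
        7 / p ^ 2 * ∑ m ∈ (Finset.Ioc (R / p) R).filter (fun m => ¬p ∣ m), selbergG m ≤
      S * (55 / (9 * l)) * (Real.log p / p) +
        S * (5 / l) * (if p ≤ R then Real.log p / p else 0) +
        2 * e * (Real.log p / p) + B * ((p : ℝ) ^ 2)⁻¹ := by
    intro p hp
    obtain ⟨hpy, hpp⟩ := Finset.mem_filter.1 hp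
    have hp1 : (1 : ℝ) ≤ p := by exact_mod_cast hpp.one_lt.le
    have hp0 : (0 : ℝ) < p := by linarith
    have hlogp : 0 ≤ Real.log p := Real.log_nonneg hp1
    have hlogpy : Real.log p ≤ Real.log y :=
      Real.log_le_log hp0 (by exact_mod_cast (Finset.mem_Icc.1 hpy).2)
    have hx0 : 0 ≤ 1 - 5 * Real.log p / l := by
      rw [sub_nonneg, div_le_one hl0]
      linarith
    have hx1 : 1 - 5 * Real.log p / l ≤ 1 := by
      have : 0 ≤ 5 * Real.log p / l := by positivity
      linarith
    have hT1 := sum_selbergG_Ioc_not_dvd_le hK R hpp.pos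
    have hT2 := sum_selbergG_Ioc_not_dvd_le_sum R p
    have hT0 : 0 ≤ ∑ m ∈ (Finset.Ioc (R / p) R).filter (fun m => ¬p ∣ m), selbergG m :=
      Finset.sum_nonneg fun m _ => selbergG_nonneg m
    set T := ∑ m ∈ (Finset.Ioc (R / p) R).filter (fun m => ¬p ∣ m), selbergG m with hT
    have hKp : K / p ≤ e * (Real.log p / p) + K * Real.exp (60 * K) * ((p : ℝ) ^ 2)⁻¹ := by
      rcases le_or_gt (60 * K) (Real.log p) with h | h
      · have h1 : K / p ≤ e * (Real.log p / p) := by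
          rw [← mul_div_assoc]
          gcongr
          rw [he]
          linarith
        have h2 : 0 ≤ K * Real.exp (60 * K) * ((p : ℝ) ^ 2)⁻¹ := by positivity
        linarith
      · have h1 : (p : ℝ) ≤ Real.exp (60 * K) := by
          rw [← Real.exp_log hp0]
          exact Real.exp_le_exp.2 h.le
        have h2 : K / p = K * p * ((p : ℝ) ^ 2)⁻¹ := by field_simp
        have h3 : K * p * ((p : ℝ) ^ 2)⁻¹ ≤ K * Real.exp (60 * K) * ((p : ℝ) ^ 2)⁻¹ := by gcongr
        have h4 : 0 ≤ e * (Real.log p / p) := by positivity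
        linarith
    have hsq : 7 / (p : ℝ) ^ 2 * T ≤ e * (Real.log p / p) +
        (7 * 420 + 7 * K) * ((p : ℝ) ^ 2)⁻¹ := by
      have h1 : 7 / (p : ℝ) ^ 2 * T ≤ 7 / (p : ℝ) ^ 2 * (Real.log p + K) := by gcongr
      have h2 : 7 * Real.log p ≤ e * Real.log p * p + 7 * 420 := by
        rcases le_or_gt (420 : ℝ) p with h | h
        · rw [he]
          nlinarith
        · have h3 := Real.log_le_sub_one_of_pos hp0
          have h4 : 0 ≤ e * Real.log p * p := by positivity
          linarith
      calc 7 / (p : ℝ) ^ 2 * T ≤ 7 / (p : ℝ) ^ 2 * (Real.log p + K) := h1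
        _ = (7 * Real.log p + 7 * K) * ((p : ℝ) ^ 2)⁻¹ := by ring
        _ ≤ (e * Real.log p * p + 7 * 420 + 7 * K) * ((p : ℝ) ^ 2)⁻¹ := by gcongr
        _ = _ := by field_simp; ring
    have hmain : (1 - 5 * Real.log p / l) / p * T ≤ S * (55 / (9 * l)) * (Real.log p / p) +
        S * (5 / l) * (if p ≤ R then Real.log p / p else 0) + K / p := by
      split_ifs with hpR
      · have h1 : (1 - 5 * Real.log p / l) / p * T ≤ 1 / p * (Real.log p + K) := by gcongr
        have h2 : 1 ≤ S * (55 / (9 * l)) + S * (5 / l) := by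
          have h3 : S * (55 / (9 * l)) + S * (5 / l) = S * 100 / (9 * l) := by
            field_simp
            ring
          rw [h3, one_le_div (by positivity)]
          linarith
        have h4 : 1 * (Real.log p / p) ≤
            (S * (55 / (9 * l)) + S * (5 / l)) * (Real.log p / p) := by gcongr
        have h5 : 1 / (p : ℝ) * (Real.log p + K) = Real.log p / p + K / p := by ring
        linarith
      · have h1 : 9 / 100 * l ≤ Real.log p := by
          refine hR1.trans (Real.log_le_log (by positivity) ?_)
          have : R + 1 ≤ p := by omega
          exact_mod_cast this
        have h2 : 1 - 5 * Real.log p / l ≤ 55 / (9 * l) * Real.log p := by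
          have h3 : 1 ≤ 100 / (9 * l) * Real.log p := by
            rw [div_mul_eq_mul_div, one_le_div (by positivity)]
            linarith
          have h4 : 100 / (9 * l) * Real.log p = 55 / (9 * l) * Real.log p +
              5 * Real.log p / l := by
            field_simp
            ring
          linarith
        have h5 : (1 - 5 * Real.log p / l) / p * T ≤ (55 / (9 * l) * Real.log p) / p * S := by
          gcongr
        have h6 : 55 / (9 * l) * Real.log p / p * S = S * (55 / (9 * l)) * (Real.log p / p) := by
          ring
        have h7 : 0 ≤ K / p := by positivity
        linarith
    have : B * ((p : ℝ) ^ 2)⁻¹ = K * Real.exp (60 * K) * ((p : ℝ) ^ 2)⁻¹ +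
        (7 * 420 + 7 * K) * ((p : ℝ) ^ 2)⁻¹ := by
      rw [hB]
      ring
    linarith
  have hsum := Finset.sum_le_sum hpt
  simp only [Finset.sum_add_distrib, ← Finset.mul_sum] at hsum ⊢
  have hmy : ∑ p ∈ Finset.Icc 1 y with p.Prime, Real.log p / p ≤ l / 5 + 2 := by
    have := sum_log_div_prime_le y
    linarith
  have hmR : ∑ p ∈ Finset.Icc 1 y with p.Prime, (if p ≤ R then Real.log p / p else 0) ≤
      9 / 100 * l + 2 := by
    have h1 := sum_log_div_prime_le R
    have h2 : ∑ p ∈ Finset.Icc 1 y with p.Prime, (if p ≤ R then Real.log p / p else 0) ≤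
        ∑ p ∈ Finset.Icc 1 R with p.Prime, Real.log p / p := by
      rw [← Finset.sum_filter]
      refine Finset.sum_le_sum_of_subset_of_nonneg (fun p hp => ?_) fun p _ _ => ?_
      · simp only [Finset.mem_filter, Finset.mem_Icc] at hp ⊢
        exact ⟨⟨hp.1.1.1, hp.2⟩, hp.1.2⟩
      · exact div_nonneg (Real.log_natCast_nonneg p) (Nat.cast_nonneg p)
    linarith
  have hsqs : ∑ p ∈ Finset.Icc 1 y with p.Prime, ((p : ℝ) ^ 2)⁻¹ ≤ Z :=
    hZ.sum_le_tsum _ fun n _ => by positivity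
  have hA1 : S * (55 / (9 * l)) * ∑ p ∈ Finset.Icc 1 y with p.Prime, Real.log p / p ≤
      S * (55 / (9 * l)) * (l / 5 + 2) := by gcongr
  have hA2 : S * (5 / l) * ∑ p ∈ Finset.Icc 1 y with p.Prime,
      (if p ≤ R then Real.log p / p else 0) ≤ S * (5 / l) * (9 / 100 * l + 2) := by gcongr
  have hA3 : 2 * e * ∑ p ∈ Finset.Icc 1 y with p.Prime, Real.log p / p ≤ 2 * e * (l / 5 + 2) := by
    gcongr
  have hA4 : B * ∑ p ∈ Finset.Icc 1 y with p.Prime, ((p : ℝ) ^ 2)⁻¹ ≤ B * Z := by gcongr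
  have hinv : S / l ≤ S / 1000 := by
    gcongr
    linarith
  have hB1 : S * (55 / (9 * l)) * (l / 5 + 2) = 11 / 9 * S + 110 / 9 * (S / l) := by
    field_simp
    ring
  have hB2 : S * (5 / l) * (9 / 100 * l + 2) = 45 / 100 * S + 10 * (S / l) := by
    field_simp
    ring
  have hB3 : (2 - 6 / l) * S = 2 * S - 6 * (S / l) := by ring
  rw [hB3]
  rw [hB1] at hA1
  rw [hB2] at hA2
  rw [he] at hA3 hsum
  linarith

theorem eventually_sieve_error_lt {c : ℝ} (hc : 0 < c) (K : ℝ) :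
    ∀ᶠ N : ℕ in Filter.atTop, ∀ R y : ℕ, ∀ S : ℝ, (R : ℝ) ≤ (N : ℝ) ^ (9 / 100 : ℝ) →
      (y : ℝ) ≤ (N : ℝ) ^ (1 / 5 : ℝ) → 0 ≤ S → S ≤ Real.log R + K →
      10 * y * (1200 * (N * √N) * √(1 + Real.log N) * √((N : ℝ) ^ (-(1 / 14) : ℝ)) *
        (R * S ^ 2) ^ 2) < ((N : ℝ) ^ (-(1 / 14) : ℝ)) ^ 2 * (c * N) * (c * N) := by
  have hlim : Filter.Tendsto (fun N : ℕ => (N : ℝ) ^ (4 / 700 : ℝ)) Filter.atTop Filter.atTop :=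
    (tendsto_rpow_atTop (by norm_num)).comp tendsto_natCast_atTop_atTop
  have hlog : Filter.Tendsto (fun N : ℕ => Real.log N) Filter.atTop Filter.atTop :=
    Real.tendsto_log_atTop.comp tendsto_natCast_atTop_atTop
  filter_upwards [hlim.eventually_gt_atTop (12000 * 701 ^ 5 / c ^ 2),
    hlog.eventually_ge_atTop (2 * K), Filter.eventually_ge_atTop 1] with N h1 h2 hN1
  intro R y S hR hy hS0 hS
  have hN : (1 : ℝ) ≤ N := by exact_mod_cast hN1
  have hN0 : (0 : ℝ) < N := by linarith
  have hl0 := Real.log_nonneg hN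
  set G : ℝ := 701 * (N : ℝ) ^ (1 / 700 : ℝ) with hG
  have hlG : 1 + Real.log N ≤ G := by
    have h3 := Real.log_le_rpow_div hN0.le (by norm_num : (0 : ℝ) < 1 / 700)
    have h4 := Real.one_le_rpow hN (by norm_num : (0 : ℝ) ≤ 1 / 700)
    have h5 : (N : ℝ) ^ (1 / 700 : ℝ) / (1 / 700) = 700 * (N : ℝ) ^ (1 / 700 : ℝ) := by ring
    rw [hG]
    linarith
  have hlogR : Real.log R ≤ 9 / 100 * Real.log N := by
    rcases Nat.eq_zero_or_pos R with rfl | hR0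
    · simp only [Nat.cast_zero, Real.log_zero]
      positivity
    · rw [← Real.log_rpow hN0]
      exact Real.log_le_log (by exact_mod_cast hR0) hR
  have hSG : S ≤ G := by linarith
  have hsqrt : √(1 + Real.log N) ≤ G := by
    rw [Real.sqrt_le_left (by positivity)]
    nlinarith
  have hG0 : 0 ≤ G := by positivity
  have hNsq : √(N : ℝ) = (N : ℝ) ^ (1 / 2 : ℝ) := Real.sqrt_eq_rpow _
  have heta : √((N : ℝ) ^ (-(1 / 14) : ℝ)) = (N : ℝ) ^ (-(1 / 28) : ℝ) := by
    rw [Real.sqrt_eq_rpow, ← Real.rpow_mul hN0.le]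
    norm_num
  rw [heta, hNsq]
  have hcomb : (N : ℝ) ^ (1 / 5 : ℝ) * (N * (N : ℝ) ^ (1 / 2 : ℝ)) * (N : ℝ) ^ (-(1 / 28) : ℝ) *
      ((N : ℝ) ^ (9 / 100 : ℝ)) ^ 2 * ((N : ℝ) ^ (1 / 700 : ℝ)) ^ 5 * (N : ℝ) ^ (4 / 700 : ℝ) =
      ((N : ℝ) ^ (-(1 / 14) : ℝ)) ^ 2 * N * N := by
    have hpow : ∀ (a : ℝ) (n : ℕ), ((N : ℝ) ^ a) ^ n = (N : ℝ) ^ (a * n) := fun a n => by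
      rw [Real.rpow_mul hN0.le, Real.rpow_natCast]
    rw [hpow, hpow, hpow]
    have h1N : (N : ℝ) = (N : ℝ) ^ (1 : ℝ) := (Real.rpow_one _).symm
    have e1 : (N : ℝ) * (N : ℝ) ^ (1 / 2 : ℝ) = (N : ℝ) ^ (3 / 2 : ℝ) := by
      nth_rewrite 1 [h1N]
      rw [← Real.rpow_add hN0]
      norm_num
    have e2 : ∀ a : ℝ, (N : ℝ) ^ a * N = (N : ℝ) ^ (a + 1) := fun a =>
      (Real.rpow_add_one hN0.ne' a).symm
    rw [e1, e2, e2, ← Real.rpow_add hN0, ← Real.rpow_add hN0, ← Real.rpow_add hN0,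
      ← Real.rpow_add hN0, ← Real.rpow_add hN0]
    norm_num
  set Q := (N : ℝ) ^ (1 / 5 : ℝ) * (N * (N : ℝ) ^ (1 / 2 : ℝ)) * (N : ℝ) ^ (-(1 / 28) : ℝ) *
      ((N : ℝ) ^ (9 / 100 : ℝ)) ^ 2 * ((N : ℝ) ^ (1 / 700 : ℝ)) ^ 5 with hQ
  have hQ0 : 0 < Q := by positivity
  calc 10 * y * (1200 * (N * (N : ℝ) ^ (1 / 2 : ℝ)) * √(1 + Real.log N) *
        (N : ℝ) ^ (-(1 / 28) : ℝ) * (R * S ^ 2) ^ 2)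
      ≤ 10 * (N : ℝ) ^ (1 / 5 : ℝ) * (1200 * (N * (N : ℝ) ^ (1 / 2 : ℝ)) * G *
        (N : ℝ) ^ (-(1 / 28) : ℝ) * ((N : ℝ) ^ (9 / 100 : ℝ) * G ^ 2) ^ 2) := by gcongr
    _ = 12000 * 701 ^ 5 * Q := by
        rw [hQ, hG]
        ring
    _ < c ^ 2 * (N : ℝ) ^ (4 / 700 : ℝ) * Q := by
        rw [div_lt_iff₀ (by positivity)] at h1
        exact mul_lt_mul_of_pos_right (by linarith) hQ0
    _ = c ^ 2 * (Q * (N : ℝ) ^ (4 / 700 : ℝ)) := by ring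
    _ = _ := by
        rw [hcomb]
        ring

theorem exists_mem_of_nearWeight_pos {A B : Finset ℕ} {η : ℝ} {n : ℕ}
    (h : 0 < nearWeight A B η n) :
    ∃ a ∈ A, ∃ b ∈ B, |√(b : ℝ) * √(a : ℝ) - n| < η := by
  by_contra! hcon
  refine h.ne' (Finset.sum_eq_zero fun a ha => Finset.sum_eq_zero fun b hb => ?_)
  rw [max_eq_left]
  linarith [hcon a ha b hb]

theorem abs_mul_sub_sq_le {a b n N : ℕ} {δ : ℝ} (hN : 0 < N) (hn : 0 < n) (hnN : n ≤ 3 * N)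
    (hδ : δ < 1 / 14)
    (h : |√(b : ℝ) * √(a : ℝ) - n| < (N : ℝ) ^ (-(1 / 14) : ℝ)) :
    |(a * b : ℝ) - (n : ℝ) ^ 2| ≤ 9 * (n : ℝ) ^ (1 - δ) := by
  have hNR : (1 : ℝ) ≤ N := by exact_mod_cast hN
  have hnR : (1 : ℝ) ≤ n := by exact_mod_cast hn
  have hN0 : (0 : ℝ) < N := by linarith
  have hn0 : (0 : ℝ) < n := by linarith
  have hnNR : (n : ℝ) / 3 ≤ N := by
    have : (n : ℝ) ≤ 3 * N := by exact_mod_cast hnN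
    linarith
  set η := (N : ℝ) ^ (-(1 / 14) : ℝ) with hη
  have hη0 : 0 < η := by positivity
  have hη1 : η ≤ 1 := Real.rpow_le_one_of_one_le_of_nonpos hNR (by norm_num)
  have hη2 : η ≤ 3 * (n : ℝ) ^ (-δ) := by
    calc η ≤ ((n : ℝ) / 3) ^ (-(1 / 14) : ℝ) :=
          Real.rpow_le_rpow_of_nonpos (by positivity) hnNR (by norm_num)
      _ = (n : ℝ) ^ (-(1 / 14) : ℝ) * (3 : ℝ) ^ (1 / 14 : ℝ) := by
          rw [Real.div_rpow hn0.le (by norm_num), div_eq_mul_inv, ← Real.rpow_neg (by norm_num),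
            neg_neg]
      _ ≤ (n : ℝ) ^ (-δ) * 3 := by
          gcongr
          calc (3 : ℝ) ^ (1 / 14 : ℝ) ≤ (3 : ℝ) ^ (1 : ℝ) :=
                Real.rpow_le_rpow_of_exponent_le (by norm_num) (by norm_num)
            _ = 3 := Real.rpow_one 3
      _ = _ := mul_comm _ _
  have hfac : (a * b : ℝ) - (n : ℝ) ^ 2 =
      (√(b : ℝ) * √(a : ℝ) - n) * (√(b : ℝ) * √(a : ℝ) + n) := by
    have ha := Real.mul_self_sqrt (Nat.cast_nonneg (α := ℝ) a)
    have hb := Real.mul_self_sqrt (Nat.cast_nonneg (α := ℝ) b)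
    calc (a * b : ℝ) - (n : ℝ) ^ 2
        = (√(a : ℝ) * √(a : ℝ)) * (√(b : ℝ) * √(b : ℝ)) - (n : ℝ) ^ 2 := by rw [ha, hb]
      _ = _ := by ring
  have hsum : |√(b : ℝ) * √(a : ℝ) + n| ≤ 3 * n := by
    rw [abs_of_nonneg (by positivity)]
    have := (abs_lt.1 h).2
    linarith
  calc |(a * b : ℝ) - (n : ℝ) ^ 2| =
        |√(b : ℝ) * √(a : ℝ) - n| * |√(b : ℝ) * √(a : ℝ) + n| := by rw [hfac, abs_mul]
    _ ≤ (3 * (n : ℝ) ^ (-δ)) * (3 * n) :=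
        mul_le_mul (h.le.trans hη2) hsum (abs_nonneg _) (by positivity)
    _ = 9 * ((n : ℝ) ^ (-δ) * n) := by ring
    _ = 9 * (n : ℝ) ^ (1 - δ) := by
        rw [← Real.rpow_add_one hn0.ne', neg_add_eq_sub]

/-- **Corollary 1.3 (case of positive density, `k = 6`).** For any `c > 0` and
`0 < δ < 1/14`, for all large `N` and `𝔄, 𝔅 ⊆ {N+1, …, 2N}` of cardinality `≥ cN`
there are `a ∈ 𝔄`, `b ∈ 𝔅` and a `P₆` with `ab = P₆² + O(P₆^{1-δ})`. -/
theorem near_P6_square :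
    ∀ c : ℝ, 0 < c → ∀ δ : ℝ, 0 < δ → δ < 1 / 14 →
      ∃ C : ℝ, 0 < C ∧ ∃ N₀ : ℕ, ∀ N : ℕ, N₀ ≤ N →
        ∀ A B : Finset ℕ, A ⊆ Finset.Icc (N + 1) (2 * N) → B ⊆ Finset.Icc (N + 1) (2 * N) →
          c * N ≤ (A.card : ℝ) → c * N ≤ (B.card : ℝ) →
            ∃ a ∈ A, ∃ b ∈ B, ∃ P : ℕ, 0 < P ∧
              P.primeFactorsList.length ≤ 6 ∧
              |(a * b : ℝ) - (P : ℝ) ^ 2| ≤ C * (P : ℝ) ^ (1 - δ) := by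
  intro c hc δ _ hδ
  obtain ⟨K, -, hK⟩ := exists_sum_selbergG_le
  obtain ⟨L, hL⟩ := exists_one_le_selberg_main_term
  have hlog : Filter.Tendsto (fun N : ℕ => Real.log N) Filter.atTop Filter.atTop :=
    Real.tendsto_log_atTop.comp tendsto_natCast_atTop_atTop
  have hη : Filter.Tendsto (fun N : ℕ => (N : ℝ) ^ (-(1 / 14) : ℝ)) Filter.atTop (nhds 0) :=
    (tendsto_rpow_neg_atTop (by norm_num)).comp tendsto_natCast_atTop_atTop
  have hev := (eventually_sieve_error_lt hc K).and <| (hlog.eventually_ge_atTop L).and <|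
    (hlog.eventually_ge_atTop 10).and <|
    (hη.eventually_le_const (by norm_num : (0 : ℝ) < 1 / 2)).and (Filter.eventually_ge_atTop 1)
  obtain ⟨N₀, hN₀⟩ := Filter.eventually_atTop.1 hev
  refine ⟨9, by norm_num, N₀, fun N hN A B hA hB hcA hcB => ?_⟩
  obtain ⟨herr, hLN, hl10, hη2, hN1⟩ := hN₀ N hN
  have hNR : (1 : ℝ) ≤ N := by exact_mod_cast hN1
  have hNpos : (0 : ℝ) < N := by linarith
  set l := Real.log N with hl
  have hl0 : 0 < l := by linarith
  set η := (N : ℝ) ^ (-(1 / 14) : ℝ) with hηdef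
  have hη0 : 0 < η := by positivity
  set R := ⌊(N : ℝ) ^ (9 / 100 : ℝ)⌋₊ with hR
  set y := ⌊(N : ℝ) ^ (1 / 5 : ℝ)⌋₊ with hy
  have hRle : (R : ℝ) ≤ (N : ℝ) ^ (9 / 100 : ℝ) := Nat.floor_le (by positivity)
  have hyle : (y : ℝ) ≤ (N : ℝ) ^ (1 / 5 : ℝ) := Nat.floor_le (by positivity)
  have hR1 : 1 ≤ R := Nat.le_floor (by
    rw [Nat.cast_one]
    exact Real.one_le_rpow hNR (by norm_num))
  have hy1 : 1 ≤ y := Nat.le_floor (by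
    rw [Nat.cast_one]
    exact Real.one_le_rpow hNR (by norm_num))
  have hlogR : Real.log R ≤ 9 / 100 * l := by
    rw [hl, ← Real.log_rpow hNpos]
    exact Real.log_le_log (by exact_mod_cast hR1) hRle
  have hlogR1 : 9 / 100 * l ≤ Real.log (R + 1) := by
    rw [hl, ← Real.log_rpow hNpos]
    exact Real.log_le_log (by positivity) (Nat.lt_floor_add_one _).le
  have hlogy : ∀ p ∈ Finset.Icc 1 y, 5 * Real.log p ≤ l := by
    intro p hp
    rw [Finset.mem_Icc] at hp
    have hpR : (p : ℝ) ≤ (N : ℝ) ^ (1 / 5 : ℝ) := le_trans (by exact_mod_cast hp.2) hyle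
    have := Real.log_le_log (by exact_mod_cast hp.1) hpR
    rw [Real.log_rpow hNpos] at this
    linarith
  have hlogy' : ∀ p : ℕ, y < p → l ≤ 5 * Real.log p := by
    intro p hp
    have h1 := (Nat.floor_lt (by positivity)).1 hp
    have := Real.log_le_log (by positivity) h1.le
    rw [Real.log_rpow hNpos] at this
    linarith
  have hw : ∀ d : ℕ, 0 < d → |∑ n ∈ Finset.Icc 1 (2 * N + 1) with d ∣ n, nearWeight A B η n -
      η ^ 2 * A.card * B.card / d| ≤ 1200 * (N * √N) * √(1 + Real.log N) * √η :=
    fun d hd => abs_sum_nearWeight_sub_le hN1 hA hB hη0 hη2 hd le_rfl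
  have hmain := hL l hLN R y hlogR1 hlogR (hlogy y (Finset.mem_Icc.2 ⟨hy1, le_rfl⟩))
  have hsix : 6 / l ≤ 6 / 10 := by gcongr
  have hsix0 : 0 ≤ 6 / l := by positivity
  have hsieve := le_sum_mul_selbergSum_sq_mul (R := R) (c₀ := 2 - 6 / l)
    (k := fun p => 1 - 5 * Real.log p / l) hw (by positivity) hy1 (by linarith) (by linarith)
    (fun p hp => by
      have h1 := (div_le_one hl0).2 (hlogy p hp)
      have h2 : 0 ≤ 5 * Real.log p / l :=
        div_nonneg (mul_nonneg (by norm_num) (Real.log_natCast_nonneg p)) hl0.le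
      constructor <;> linarith)
  have herr' := herr R y (∑ m ∈ Finset.Icc 1 R, selbergG m) hRle hyle
    (Finset.sum_nonneg fun m _ => selbergG_nonneg m) (hK R)
  have hX : η ^ 2 * (c * N) * (c * N) ≤ η ^ 2 * A.card * B.card := by gcongr
  have hX0 : 0 ≤ η ^ 2 * (A.card : ℝ) * B.card := by positivity
  have hpos := lt_of_lt_of_le (sub_pos.2 (herr'.trans_le
    (hX.trans (le_mul_of_one_le_right hX0 hmain)))) hsieve
  obtain ⟨n, hn, hnpos⟩ := Finset.exists_lt_of_sum_lt (f := fun _ : ℕ => (0 : ℝ))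
    (Finset.sum_const_zero.trans_lt hpos)
  rw [Finset.mem_Icc] at hn
  have hwn := nearWeight_nonneg A B η n
  have hv := mul_nonneg hwn (sq_nonneg (selbergSum (Finset.Icc 1 R) R n))
  have hW := pos_of_mul_pos_right hnpos hv
  have hwpos : 0 < nearWeight A B η n := by
    refine lt_of_le_of_ne hwn fun h0 => ?_
    rw [← h0, zero_mul, zero_mul] at hnpos
    exact lt_irrefl _ hnpos
  obtain ⟨a, ha, b, hb, hab⟩ := exists_mem_of_nearWeight_pos hwpos
  refine ⟨a, ha, b, hb, n, hn.1, ?_, abs_mul_sub_sq_le hN1 hn.1 (by omega) hδ hab⟩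
  refine length_primeFactorsList_le_six hn.1 hl0 hlogy hlogy' ?_ hW
  have hn3 : (n : ℝ) ≤ 3 * N := by
    have : n ≤ 3 * N := by omega
    exact_mod_cast this
  have hlog3 : Real.log 3 ≤ 6 / 5 := by
    have h1 : Real.log (3 ^ 5) ≤ Real.log (2 ^ 8) := Real.log_le_log (by norm_num) (by norm_num)
    rw [Real.log_pow, Real.log_pow] at h1
    have h2 := Real.log_two_lt_d9
    push_cast at h1
    linarith
  have hlogn : Real.log n ≤ 6 / 5 + l := by
    have h1 := Real.log_le_log (by exact_mod_cast hn.1) hn3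
    rw [Real.log_mul (by norm_num) hNpos.ne'] at h1
    linarith
  have : 5 * Real.log n / l ≤ 5 + 6 / l := by
    rw [div_le_iff₀ hl0, add_mul, div_mul_cancel₀ _ hl0.ne']
    linarith
  linarith
end

section
/- (Double large sieve of Fouvry–Iwaniec.) Let (x_r)_{r∈R} and (y_s)_{s∈S} be finite families of real numbers with |x_r| ≤ X for all r and |y_s| ≤ Y for all s, where X, Y > 0, and let (φ_r)_{r∈R}, (ψ_s)_{s∈S} be complex numbers. Then |Σ_{r∈R} Σ_{s∈S} φ_r ψ_s e(x_r y_s)|² ≤ 20(1 + XY) · (Σ_{(r₁,r₂)∈R², |x_{r₁}−x_{r₂}| ≤ Y^{−1}} |φ_{r₁}φ_{r₂}|) · (Σ_{(s₁,s₂)∈S², |y_{s₁}−y_{s₂}| ≤ X^{−1}} |ψ_{s₁}ψ_{s₂}|). -/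
open scoped Classical Real

/-- `e(t) = e^{2πit}`. -/
noncomputable def eTwoPi (t : ℝ) : ℂ := Complex.exp (2 * Real.pi * Complex.I * t)

open MeasureTheory FourierTransform Set
open scoped ContDiff ENNReal SchwartzMap

section Plancherel

variable {V : Type*} [NormedAddCommGroup V] [InnerProductSpace ℝ V]

theorem continuous_neg_innerₗ :
    Continuous fun p : V × V ↦ (-innerₗ V : V →ₗ[ℝ] V →ₗ[ℝ] ℝ) p.1 p.2 := by
  simpa using! continuous_inner.neg

variable [FiniteDimensional ℝ V] [MeasurableSpace V] [BorelSpace V]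

/-- The Fourier integral is self-adjoint. -/
theorem integral_fourierInv_mul_eq_of_integrable {f g : V → ℂ} (hf : Integrable f)
    (hg : Integrable g) : ∫ v, 𝓕⁻ f v * g v = ∫ v, f v * 𝓕⁻ g v := by
  have hflip : (-innerₗ V : V →ₗ[ℝ] V →ₗ[ℝ] ℝ).flip = -innerₗ V := by
    ext v w
    simp [real_inner_comm]
  have := VectorFourier.integral_fourierIntegral_smul_eq_flip (L := -innerₗ V)
    Real.continuous_fourierChar continuous_neg_innerₗ hf hg
  rw [hflip] at this
  simpa using! this

/-- On `L¹ ∩ L²` the Fourier integral agrees with the Fourier transform on `L²`. -/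
theorem fourierInv_ae_eq_fourierInv_toLp {g : V → ℂ} (hg : Integrable g) (hg' : MemLp g 2) :
    𝓕⁻ g =ᵐ[volume] (𝓕⁻ (hg'.toLp g) : Lp (α := V) ℂ 2) := by
  have hc : Continuous (𝓕⁻ g) :=
    VectorFourier.fourierIntegral_continuous Real.continuous_fourierChar continuous_neg_innerₗ hg
  refine ae_eq_of_integral_contDiff_smul_eq hc.locallyIntegrable
    ((Lp.memLp _).locallyIntegrable (by norm_num)) fun θ hθ hθc ↦ ?_
  have h₁ : HasCompactSupport (Complex.ofRealCLM ∘ θ) := hθc.comp_left rfl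
  have h₂ : ContDiff ℝ ∞ (Complex.ofRealCLM ∘ θ) := by fun_prop
  set Θ : 𝓢(V, ℂ) := h₁.toSchwartzMap h₂
  have hΘ' (v : V) : Θ v = (θ v : ℂ) := rfl
  have key := congrArg (fun T ↦ T Θ) (Lp.fourierInv_toTemperedDistribution_eq (hg'.toLp g))
  simp only [TemperedDistribution.fourierInv_apply, Lp.toTemperedDistribution_apply,
    SchwartzMap.fourierInv_coe, smul_eq_mul] at key
  simp only [Complex.real_smul, ← hΘ']
  rw [← key, ← integral_fourierInv_mul_eq_of_integrable Θ.integrable hg]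
  refine integral_congr_ae ?_
  filter_upwards [hg'.coeFn_toLp] with v hv
  rw [hv]

theorem memLp_two_fourierInv {g : V → ℂ} (hg : Integrable g) (hg' : MemLp g 2) :
    MemLp (𝓕⁻ g) 2 volume :=
  (memLp_congr_ae (fourierInv_ae_eq_fourierInv_toLp hg hg')).2 (Lp.memLp _)

theorem eLpNorm_two_fourierInv {g : V → ℂ} (hg : Integrable g) (hg' : MemLp g 2) :
    eLpNorm (𝓕⁻ g) 2 volume = eLpNorm g 2 volume := by
  have h : ‖(𝓕⁻ (hg'.toLp g) : Lp (α := V) ℂ 2 volume)‖ = ‖hg'.toLp g‖ :=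
    (Lp.fourierTransformₗᵢ V ℂ).symm.norm_map _
  rw [eLpNorm_congr_ae (fourierInv_ae_eq_fourierInv_toLp hg hg'),
    ← eLpNorm_congr_ae hg'.coeFn_toLp]
  rw [Lp.norm_def, Lp.norm_def] at h
  exact (ENNReal.toReal_eq_toReal_iff' (Lp.eLpNorm_ne_top _) (Lp.eLpNorm_ne_top _)).1 h

theorem norm_integral_mul_fourierInv_sq_le {f g : V → ℂ} (hf : MemLp f 2) (hg : Integrable g)
    (hg' : MemLp g 2) :
    ‖∫ v, f v * 𝓕⁻ g v‖ ^ 2 ≤ (∫ v, ‖f v‖ ^ 2) * ∫ v, ‖g v‖ ^ 2 := by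
  have hG := memLp_two_fourierInv hg hg'
  have hsq {F : V → ℂ} (hF : MemLp F 2) :
      (eLpNorm F 2 volume).toReal ^ 2 = ∫ v, ‖F v‖ ^ 2 := by
    rw [hF.eLpNorm_eq_integral_rpow_norm (by norm_num) (by norm_num), ENNReal.toReal_ofReal
      (by positivity), ← Real.rpow_natCast, ← Real.rpow_mul (by positivity)]
    simp
  have hCS := integral_mul_norm_le_Lp_mul_Lq (μ := volume) (f := f) (g := 𝓕⁻ g)
    (p := 2) (q := 2) Real.HolderConjugate.two_two (by simpa using hf) (by simpa using hG)
  rw [← hsq hf, ← hsq hg', ← eLpNorm_two_fourierInv hg hg', hsq hf, hsq hG]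
  have h0 : ‖∫ v, f v * 𝓕⁻ g v‖ ≤ ∫ v, ‖f v‖ * ‖𝓕⁻ g v‖ := by
    simpa using norm_integral_le_integral_norm (fun v ↦ f v * 𝓕⁻ g v)
  have h1 := pow_le_pow_left₀ (norm_nonneg _) (h0.trans hCS) 2
  refine h1.trans_eq ?_
  rw [mul_pow, ← Real.rpow_natCast, ← Real.rpow_natCast, ← Real.rpow_mul (by positivity),
    ← Real.rpow_mul (by positivity)]
  simp

end Plancherel

/-- `sinc` is bounded below on `[-π/3, π/3]` by its value at the endpoints. -/
theorem three_mul_sqrt_three_div_le_sinc {z : ℝ} (hz : |z| ≤ π / 3) :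
    3 * √3 / (2 * π) ≤ Real.sinc z := by
  wlog h : 0 ≤ z generalizing z
  · rw [← Real.sinc_neg]
    exact this (by rwa [abs_neg]) (by linarith)
  rw [abs_of_nonneg h] at hz
  have hπ := Real.pi_pos
  have hsq : √3 ^ 2 = 3 := Real.sq_sqrt (by norm_num)
  rcases h.eq_or_lt with rfl | h
  · rw [Real.sinc_zero, div_le_one (by positivity)]
    nlinarith [Real.pi_gt_three, Real.sqrt_nonneg 3]
  rw [Real.sinc_of_ne_zero h.ne', le_div_iff₀ h]
  have hconc := strictConcaveOn_sin_Icc.concaveOn.2 (left_mem_Icc.2 hπ.le)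
    (show π / 3 ∈ Icc 0 π from ⟨by positivity, by linarith⟩)
    (show 0 ≤ 1 - z * 3 / π by rw [sub_nonneg, div_le_one hπ]; linarith)
    (show 0 ≤ z * 3 / π by positivity) (by ring)
  simp only [smul_eq_mul, Real.sin_zero, Real.sin_pi_div_three] at hconc
  have e1 : (1 - z * 3 / π) * 0 + z * 3 / π * (π / 3) = z := by field_simp; ring
  rw [e1] at hconc
  refine le_trans (le_of_eq ?_) hconc
  field_simp
  ring

theorem eTwoPi_add (a b : ℝ) : eTwoPi (a + b) = eTwoPi a * eTwoPi b := by
  simp only [eTwoPi, ← Complex.exp_add]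
  congr 1
  push_cast
  ring

theorem continuous_eTwoPi : Continuous eTwoPi := by
  unfold eTwoPi
  fun_prop

/-- The average of a character over an interval of half-length `h` around `a`. -/
theorem setIntegral_eTwoPi_mul (a y : ℝ) {h : ℝ} (hh : 0 ≤ h) :
    ∫ u in Icc (a - h) (a + h), eTwoPi (u * y) =
      ((2 * h * Real.sinc (2 * π * h * y) : ℝ) : ℂ) * eTwoPi (a * y) := by
  rw [integral_Icc_eq_integral_Ioc, ← intervalIntegral.integral_of_le (by linarith)]
  have e1 : ∫ u in (a - h)..(a + h), eTwoPi (u * y) =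
      ∫ u in (-h)..h, eTwoPi (a * y) * eTwoPi (u * y) := by
    have := intervalIntegral.integral_comp_add_right (a := -h) (b := h)
      (fun u ↦ eTwoPi (u * y)) a
    rw [show a - h = -h + a by ring, show a + h = h + a by ring, ← this]
    congr 1 with u
    rw [← eTwoPi_add]
    congr 1
    ring
  rw [e1, intervalIntegral.integral_const_mul, mul_comm]
  congr 1
  rcases eq_or_ne y 0 with rfl | hy
  · simp [eTwoPi]
    ring
  have := intervalIntegral.integral_comp_mul_right (a := -h) (b := h)
    (fun t : ℝ ↦ Complex.exp (t * Complex.I)) (c := 2 * π * y) (by positivity)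
  have e2 (u : ℝ) : eTwoPi (u * y) = Complex.exp ((u * (2 * π * y) : ℝ) * Complex.I) := by
    unfold eTwoPi
    congr 1
    push_cast
    ring
  simp only [e2]
  rw [this, neg_mul, integral_exp_mul_I_eq_sinc, show h * (2 * π * y) = 2 * π * h * y by ring,
    Complex.real_smul]
  have : (y : ℂ) ≠ 0 := by exact_mod_cast hy
  have : (π : ℂ) ≠ 0 := by exact_mod_cast Real.pi_ne_zero
  push_cast
  field_simp

section BoxSum

variable {ι : Type*}

/-- The sum of the point masses `c r` at `x r`, each spread out over an interval of half-length
`h`. -/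
noncomputable def boxSum (R : Finset ι) (x : ι → ℝ) (c : ι → ℂ) (h : ℝ) (u : ℝ) : ℂ :=
  ∑ r ∈ R, (Icc (x r - h) (x r + h)).indicator (fun _ ↦ c r) u

variable (R : Finset ι) (x : ι → ℝ) (c : ι → ℂ) (h : ℝ)

theorem memLp_boxSum (p : ℝ≥0∞) : MemLp (boxSum R x c h) p :=
  memLp_finsetSum _ fun r _ ↦ memLp_indicator_const p measurableSet_Icc (c r)
    (Or.inr measure_Icc_lt_top.ne)

theorem boxSum_eq_zero {U u : ℝ} (hx : ∀ r ∈ R, |x r| + h ≤ U) (hu : U < |u|) :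
    boxSum R x c h u = 0 := by
  refine Finset.sum_eq_zero fun r hr ↦ indicator_of_notMem (fun hmem ↦ ?_) _
  have h1 : |u - x r| ≤ h := abs_le.2 ⟨by linarith [hmem.1], by linarith [hmem.2]⟩
  have h2 := abs_sub_abs_le_abs_sub u (x r)
  linarith [hx r hr]

theorem integral_boxSum_mul {G : ℝ → ℂ} (hG : Continuous G) :
    ∫ u, boxSum R x c h u * G u = ∑ r ∈ R, c r * ∫ u in Icc (x r - h) (x r + h), G u := by
  have e (u : ℝ) : boxSum R x c h u * G u =
      ∑ r ∈ R, (Icc (x r - h) (x r + h)).indicator (fun u ↦ c r * G u) u := by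
    rw [boxSum, Finset.sum_mul]
    exact Finset.sum_congr rfl fun r _ ↦ (indicator_mul_left _ (fun _ ↦ c r) G).symm
  simp only [e]
  rw [integral_finsetSum]
  · refine Finset.sum_congr rfl fun r _ ↦ ?_
    rw [integral_indicator measurableSet_Icc, integral_const_mul]
  · intro r _
    exact (integrable_indicator_iff measurableSet_Icc).2
      ((continuous_const.mul hG).integrableOn_Icc)

theorem integral_norm_boxSum_sq_le (hh : 0 ≤ h) :
    ∫ u, ‖boxSum R x c h u‖ ^ 2 ≤
      2 * h * ∑ p ∈ (R ×ˢ R).filter (fun p ↦ |x p.1 - x p.2| ≤ 2 * h), ‖c p.1‖ * ‖c p.2‖ := by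
  set I : ι → Set ℝ := fun r ↦ Icc (x r - h) (x r + h)
  have hI_int (p : ι × ι) : Integrable ((I p.1 ∩ I p.2).indicator fun _ ↦ ‖c p.1‖ * ‖c p.2‖) :=
    (integrable_indicator_iff (measurableSet_Icc.inter measurableSet_Icc)).2
      (integrableOn_const ((measure_mono inter_subset_left).trans_lt measure_Icc_lt_top).ne)
  have hpt (u : ℝ) : ‖boxSum R x c h u‖ ^ 2 ≤
      ∑ p ∈ R ×ˢ R, (I p.1 ∩ I p.2).indicator (fun _ ↦ ‖c p.1‖ * ‖c p.2‖) u := by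
    have h1 : ‖boxSum R x c h u‖ ≤ ∑ r ∈ R, (I r).indicator (fun _ ↦ ‖c r‖) u :=
      (norm_sum_le _ _).trans_eq
        (Finset.sum_congr rfl fun r _ ↦ norm_indicator_eq_indicator_norm _ _)
    refine (pow_le_pow_left₀ (norm_nonneg _) h1 2).trans_eq ?_
    rw [sq, Finset.sum_mul_sum, Finset.sum_product]
    refine Finset.sum_congr rfl fun r _ ↦ Finset.sum_congr rfl fun s _ ↦ ?_
    exact (inter_indicator_mul (fun _ ↦ ‖c r‖) (fun _ ↦ ‖c s‖) u).symm
  calc ∫ u, ‖boxSum R x c h u‖ ^ 2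
      ≤ ∫ u, ∑ p ∈ R ×ˢ R, (I p.1 ∩ I p.2).indicator (fun _ ↦ ‖c p.1‖ * ‖c p.2‖) u :=
        integral_mono ((memLp_boxSum R x c h 2).integrable_norm_pow two_ne_zero)
          (integrable_finsetSum _ fun p _ ↦ hI_int p) hpt
    _ = ∑ p ∈ R ×ˢ R, volume.real (I p.1 ∩ I p.2) * (‖c p.1‖ * ‖c p.2‖) := by
        rw [integral_finsetSum _ fun p _ ↦ hI_int p]
        refine Finset.sum_congr rfl fun p _ ↦ ?_
        rw [integral_indicator_const _ (measurableSet_Icc.inter measurableSet_Icc), smul_eq_mul]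
    _ ≤ ∑ p ∈ R ×ˢ R, if |x p.1 - x p.2| ≤ 2 * h then 2 * h * (‖c p.1‖ * ‖c p.2‖) else 0 := by
        refine Finset.sum_le_sum fun p _ ↦ ?_
        split_ifs with hp
        · refine mul_le_mul_of_nonneg_right ?_ (by positivity)
          refine (measureReal_mono inter_subset_left measure_Icc_lt_top.ne).trans_eq ?_
          rw [Real.volume_real_Icc_of_le (by linarith)]
          ring
        · have : I p.1 ∩ I p.2 = ∅ := by
            refine eq_empty_of_forall_notMem fun u hu ↦ hp ?_
            obtain ⟨⟨h1, h2⟩, h3, h4⟩ := hu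
            exact abs_le.2 ⟨by linarith, by linarith⟩
          simp [this]
    _ = _ := by rw [Finset.mul_sum, Finset.sum_filter]

theorem fourierInv_boxSum (hh : 0 ≤ h) (u : ℝ) :
    𝓕⁻ (boxSum R x c h) u =
      ∑ r ∈ R, c r * (((2 * h * Real.sinc (2 * π * h * u) : ℝ) : ℂ) * eTwoPi (x r * u)) := by
  have e : 𝓕⁻ (boxSum R x c h) u = ∫ t, boxSum R x c h t * eTwoPi (t * u) := by
    rw [Real.fourierInv_eq']
    refine integral_congr_ae (ae_of_all _ fun t ↦ ?_)
    simp only [smul_eq_mul, eTwoPi]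
    rw [mul_comm]
    congr 2
    simp
    ring
  rw [e, integral_boxSum_mul R x c h (G := fun t ↦ eTwoPi (t * u))
    (continuous_eTwoPi.comp (by fun_prop))]
  exact Finset.sum_congr rfl fun r _ ↦ by rw [setIntegral_eTwoPi_mul _ _ hh]

end BoxSum

/-- **Double large sieve of Fouvry–Iwaniec.** -/
theorem double_large_sieve {ι κ : Type*} (R : Finset ι) (S : Finset κ)
    (x : ι → ℝ) (y : κ → ℝ) (φ : ι → ℂ) (ψ : κ → ℂ) (X Y : ℝ)
    (hX : 0 < X) (hY : 0 < Y)
    (hx : ∀ r ∈ R, |x r| ≤ X) (hy : ∀ s ∈ S, |y s| ≤ Y) :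
    ‖∑ r ∈ R, ∑ s ∈ S, φ r * ψ s * eTwoPi (x r * y s)‖ ^ 2 ≤
      20 * (1 + X * Y) *
        (∑ p ∈ (R ×ˢ R).filter (fun p => |x p.1 - x p.2| ≤ Y⁻¹), ‖φ p.1‖ * ‖φ p.2‖) *
        (∑ q ∈ (S ×ˢ S).filter (fun q => |y q.1 - y q.2| ≤ X⁻¹), ‖ψ q.1‖ * ‖ψ q.2‖) := by
  set h : ℝ := 1 / (6 * Y) with hh
  set U : ℝ := X + h with hU
  set k : ℝ := 1 / (6 * U) with hk
  set C : ℝ := 3 * √3 / (2 * π) with hC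
  have h0 : 0 < h := by positivity
  have U0 : 0 < U := by positivity
  have k0 : 0 < k := by positivity
  have C0 : 0 < C := by positivity
  -- the factors by which averaging over intervals of half-length `h` and `k` scales characters
  set a : ℝ → ℝ := fun t ↦ 2 * h * Real.sinc (2 * π * h * t)
  set b : ℝ → ℝ := fun u ↦ 2 * k * Real.sinc (2 * π * k * u)
  have ha' {t : ℝ} (ht : |t| ≤ Y) : 2 * h * C ≤ a t := by
    refine mul_le_mul_of_nonneg_left (three_mul_sqrt_three_div_le_sinc ?_) (by positivity)
    rw [abs_mul, abs_of_pos (by positivity)]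
    calc 2 * π * h * |t| ≤ 2 * π * h * Y := by gcongr
      _ = π / 3 := by rw [hh]; field_simp; norm_num
  have hb' {u : ℝ} (hu : |u| ≤ U) : 2 * k * C ≤ b u := by
    refine mul_le_mul_of_nonneg_left (three_mul_sqrt_three_div_le_sinc ?_) (by positivity)
    rw [abs_mul, abs_of_pos (by positivity)]
    calc 2 * π * k * |u| ≤ 2 * π * k * U := by gcongr
      _ = π / 3 := by rw [hk]; field_simp; norm_num
  have hbc : Continuous b := continuous_const.mul (Real.continuous_sinc.comp (by fun_prop))
  set F := boxSum R x φ h with hF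
  set f : ℝ → ℂ := fun u ↦ F u * ((b u)⁻¹ : ℝ) with hf
  set g := boxSum S y (fun s ↦ ψ s * ((a (y s))⁻¹ : ℝ)) k with hg
  have hxU : ∀ r ∈ R, |x r| + h ≤ U := fun r hr ↦ by linarith [hx r hr]
  have hfF (u : ℝ) : ‖f u‖ ≤ (2 * k * C)⁻¹ * ‖F u‖ := by
    rcases le_or_gt |u| U with hu | hu
    · have hpos : 0 < b u := lt_of_lt_of_le (by positivity) (hb' hu)
      rw [hf, norm_mul, Complex.norm_real, Real.norm_of_nonneg (by positivity), mul_comm]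
      gcongr
      exact hb' hu
    · simp [hf, hF, boxSum_eq_zero R x φ h hxU hu]
  have hFL : MemLp F 2 := memLp_boxSum R x φ h 2
  have hfL : MemLp f 2 := by
    refine hFL.of_le_mul (c := (2 * k * C)⁻¹) ?_ (ae_of_all _ hfF)
    exact hFL.1.mul (Complex.continuous_ofReal.measurable.comp
      hbc.measurable.inv).aestronglyMeasurable
  have hfint : ∫ u, ‖f u‖ ^ 2 ≤ ((2 * k * C)⁻¹) ^ 2 * ∫ u, ‖F u‖ ^ 2 := by
    rw [← integral_const_mul]
    refine integral_mono (hfL.integrable_norm_pow two_ne_zero)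
      ((hFL.integrable_norm_pow two_ne_zero).const_mul _) fun u ↦ ?_
    simpa only [mul_pow] using pow_le_pow_left₀ (norm_nonneg _) (hfF u) 2
  have hterm (s : κ) : Continuous fun u ↦ ψ s * ((a (y s))⁻¹ : ℝ) * eTwoPi (u * y s) :=
    continuous_const.mul (continuous_eTwoPi.comp (by fun_prop))
  have hB : ∫ u, f u * 𝓕⁻ g u = ∑ r ∈ R, ∑ s ∈ S, φ r * ψ s * eTwoPi (x r * y s) := by
    have e (u : ℝ) : f u * 𝓕⁻ g u =
        F u * ∑ s ∈ S, ψ s * ((a (y s))⁻¹ : ℝ) * eTwoPi (u * y s) := by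
      rcases le_or_gt |u| U with hu | hu
      · have hpos : 0 < b u := lt_of_lt_of_le (by positivity) (hb' hu)
        have hne : (b u : ℂ) ≠ 0 := by exact_mod_cast hpos.ne'
        rw [hg, fourierInv_boxSum S y _ k k0.le, hf, mul_assoc, Finset.mul_sum]
        congr 1
        refine Finset.sum_congr rfl fun s _ ↦ ?_
        change ((b u)⁻¹ : ℝ) * (_ * ((b u : ℂ) * _)) = _
        rw [mul_comm (y s) u]
        push_cast
        field_simp
      · simp [hf, hF, boxSum_eq_zero R x φ h hxU hu]
    simp only [e]
    rw [hF, integral_boxSum_mul R x φ h (continuous_finsetSum S fun s _ ↦ hterm s)]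
    refine Finset.sum_congr rfl fun r _ ↦ ?_
    rw [integral_finsetSum _ fun s _ ↦ (hterm s).integrableOn_Icc, Finset.mul_sum]
    refine Finset.sum_congr rfl fun s hs ↦ ?_
    rw [integral_const_mul, setIntegral_eTwoPi_mul _ _ h0.le]
    change φ r * (_ * ((a (y s) : ℂ) * _)) = _
    have hne : (a (y s) : ℂ) ≠ 0 := by
      exact_mod_cast (lt_of_lt_of_le (by positivity) (ha' (hy s hs))).ne'
    push_cast
    field_simp
  set P := ∑ p ∈ (R ×ˢ R).filter (fun p => |x p.1 - x p.2| ≤ Y⁻¹), ‖φ p.1‖ * ‖φ p.2‖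
  set Q := ∑ q ∈ (S ×ˢ S).filter (fun q => |y q.1 - y q.2| ≤ X⁻¹), ‖ψ q.1‖ * ‖ψ q.2‖ with hQ
  have hP0 : 0 ≤ P := Finset.sum_nonneg fun _ _ ↦ by positivity
  have hQ0 : 0 ≤ Q := Finset.sum_nonneg fun _ _ ↦ by positivity
  have hhY : 2 * h ≤ Y⁻¹ := by
    rw [hh, ← one_div, ← mul_div_assoc, div_le_div_iff₀ (by positivity) hY]
    linarith
  have hkX : 2 * k ≤ X⁻¹ := by
    rw [hk, ← one_div, ← mul_div_assoc, div_le_div_iff₀ (by positivity) hX]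
    linarith
  have hFP : ∫ u, ‖F u‖ ^ 2 ≤ 2 * h * P := by
    refine (integral_norm_boxSum_sq_le R x φ h h0.le).trans ?_
    refine mul_le_mul_of_nonneg_left ?_ (by positivity)
    refine Finset.sum_le_sum_of_subset_of_nonneg ?_ fun _ _ _ ↦ by positivity
    exact Finset.monotone_filter_right _ fun p _ hp ↦ hp.trans hhY
  have hgQ : ∫ t, ‖g t‖ ^ 2 ≤ 2 * k * (((2 * h * C)⁻¹) ^ 2 * Q) := by
    refine (integral_norm_boxSum_sq_le S y _ k k0.le).trans ?_
    refine mul_le_mul_of_nonneg_left ?_ (by positivity)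
    rw [hQ, Finset.mul_sum]
    refine (Finset.sum_le_sum_of_subset_of_nonneg (Finset.monotone_filter_right _
      fun p _ hp ↦ hp.trans hkX) fun _ _ _ ↦ by positivity).trans ?_
    refine Finset.sum_le_sum fun p hp ↦ ?_
    obtain ⟨h1, h2⟩ := Finset.mem_product.1 (Finset.mem_filter.1 hp).1
    have hs {s : κ} (hs : s ∈ S) : ‖ψ s * ((a (y s))⁻¹ : ℝ)‖ ≤ (2 * h * C)⁻¹ * ‖ψ s‖ := by
      have hle := ha' (hy s hs)
      have hpos : 0 < a (y s) := lt_of_lt_of_le (by positivity) hle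
      rw [norm_mul, Complex.norm_real, Real.norm_of_nonneg (by positivity), mul_comm]
      gcongr
    refine (mul_le_mul (hs h1) (hs h2) (norm_nonneg _) (by positivity)).trans_eq ?_
    ring
  have hPl := norm_integral_mul_fourierInv_sq_le (g := g) hfL
    (memLp_one_iff_integrable.1 (memLp_boxSum S y _ k 1)) (memLp_boxSum S y _ k 2)
  rw [hB] at hPl
  have hconst : ((2 * k * C)⁻¹) ^ 2 * (2 * h) * (2 * k * ((2 * h * C)⁻¹) ^ 2) ≤
      20 * (1 + X * Y) := by
    have hC4 : C ^ 4 = 729 / (16 * π ^ 4) := by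
      have hsq : √3 ^ 4 = 9 := by
        rw [show √3 ^ 4 = (√3 ^ 2) ^ 2 by ring, Real.sq_sqrt (by norm_num)]
        norm_num
      rw [hC, div_pow, mul_pow, mul_pow, hsq]
      norm_num
    have e1 : ((2 * k * C)⁻¹) ^ 2 * (2 * h) * (2 * k * ((2 * h * C)⁻¹) ^ 2) =
        (4 * h * k)⁻¹ / C ^ 4 := by
      field_simp
      norm_num
    have e2 : (4 * h * k)⁻¹ = 9 * (X * Y) + 3 / 2 := by
      rw [hk, hU, hh]
      field_simp
      ring
    have hπ4 : π ^ 4 ≤ 101 := by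
      calc π ^ 4 ≤ 3.15 ^ 4 := by gcongr; exact Real.pi_lt_d2.le
        _ ≤ 101 := by norm_num
    rw [e1, e2, hC4, div_div_eq_mul_div, div_le_iff₀ (by norm_num)]
    have hXY : 0 < X * Y := by positivity
    nlinarith
  calc _ ≤ (∫ u, ‖f u‖ ^ 2) * ∫ t, ‖g t‖ ^ 2 := hPl
    _ ≤ (((2 * k * C)⁻¹) ^ 2 * (2 * h * P)) * (2 * k * (((2 * h * C)⁻¹) ^ 2 * Q)) := by
        refine mul_le_mul (hfint.trans ?_) hgQ (integral_nonneg fun _ ↦ by positivity)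
          (by positivity)
        gcongr
    _ = ((2 * k * C)⁻¹) ^ 2 * (2 * h) * (2 * k * ((2 * h * C)⁻¹) ^ 2) * (P * Q) := by ring
    _ ≤ 20 * (1 + X * Y) * (P * Q) := by gcongr
    _ = _ := by ring
end

section
/- Let α, β be nonzero real numbers. There exists a constant C > 0, depending only on α and β, such that for all Θ > 0 and all reals M ≥ 1, N ≥ 1, the number of quadruples of integers (m, m̃, n, ñ) with M ≤ m, m̃ < 2M, N ≤ n, ñ < 2N and |(m̃/m)^α − (ñ/n)^β| < Θ is at most C(MN log(2MN) + Θ M²N²). -/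
lemma card_near_le_of_separated {ι : Type*} (S : Finset ι) (f : ι → ℝ) {δ Θ : ℝ} (hδ : 0 < δ)
    (hΘ : 0 < Θ) (hsep : ∀ p ∈ S, ∀ q ∈ S, p ≠ q → δ ≤ |f p - f q|) (y : ℝ) :
    ((S.filter fun p => |f p - y| < Θ).card : ℝ) ≤ 1 + 2 * Θ / δ := by
  have hcard : (S.filter fun p => |f p - y| < Θ).card ≤
      (Finset.range (⌊2 * Θ / δ⌋₊ + 1)).card := by
    refine Finset.card_le_card_of_injOn (fun p => ⌊(f p - (y - Θ)) / δ⌋₊) ?_ ?_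
    · intro p hp
      simp only [Finset.coe_filter, Set.mem_ofPred_eq, abs_lt] at hp
      simp only [Finset.coe_range, Set.mem_Iio, Nat.lt_succ_iff]
      gcongr
      linarith [hp.2.2]
    · intro p hp q hq hpq
      simp only [Finset.coe_filter, Set.mem_ofPred_eq, abs_lt] at hp hq
      by_contra hne
      have hs := hsep p hp.1 q hq.1 hne
      have hp0 : 0 ≤ (f p - (y - Θ)) / δ := div_nonneg (by linarith [hp.2.1]) hδ.le
      have hq0 : 0 ≤ (f q - (y - Θ)) / δ := div_nonneg (by linarith [hq.2.1]) hδ.le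
      have h1 := Nat.floor_le hp0
      have h2 := Nat.lt_floor_add_one ((f p - (y - Θ)) / δ)
      have h3 := Nat.floor_le hq0
      have h4 := Nat.lt_floor_add_one ((f q - (y - Θ)) / δ)
      simp only at hpq
      rw [hpq] at h1 h2
      have h : |(f p - (y - Θ)) / δ - (f q - (y - Θ)) / δ| < 1 := by
        rw [abs_lt]; constructor <;> linarith
      rw [← sub_div, abs_div, abs_of_pos hδ, div_lt_one hδ] at h
      rw [show f p - (y - Θ) - (f q - (y - Θ)) = f p - f q by ring] at h
      linarith
  rw [Finset.card_range] at hcard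
  have h1 : ((S.filter fun p => |f p - y| < Θ).card : ℝ) ≤ (⌊2 * Θ / δ⌋₊ : ℝ) + 1 := by
    exact_mod_cast hcard
  have h2 := Nat.floor_le (show 0 ≤ 2 * Θ / δ by positivity)
  linarith

lemma card_filter_product_le {ι κ : Type*} (P : Finset ι) (Q : Finset κ) (r : ι → κ → Prop)
    [∀ i j, Decidable (r i j)] {c : ℝ} (h : ∀ p ∈ P, ((Q.filter fun q => r p q).card : ℝ) ≤ c) :
    (((P ×ˢ Q).filter fun z => r z.1 z.2).card : ℝ) ≤ P.card * c := by
  rw [Finset.card_filter, Finset.sum_product]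
  simp only [← Finset.card_filter]
  push_cast
  exact (Finset.sum_le_sum h).trans_eq (by simp)

lemma abs_mul_log_le {z : ℝ} (γ : ℝ) (h1 : 1 / 2 ≤ z) (h2 : z ≤ 2) :
    |Real.log z * γ| ≤ Real.log 2 * |γ| := by
  rw [abs_mul]
  gcongr
  rw [abs_le]
  constructor
  · rw [← Real.log_inv]
    exact Real.log_le_log (by norm_num) (by linarith)
  · exact Real.log_le_log (by linarith) h2

lemma rpow_le_two_rpow_abs {z : ℝ} (γ : ℝ) (h1 : 1 / 2 ≤ z) (h2 : z ≤ 2) :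
    z ^ γ ≤ 2 ^ |γ| := by
  rw [Real.rpow_def_of_pos (by linarith), Real.rpow_def_of_pos two_pos]
  exact Real.exp_le_exp.2 (le_of_abs_le (abs_mul_log_le γ h1 h2))

lemma two_rpow_neg_abs_le_rpow {z : ℝ} (γ : ℝ) (h1 : 1 / 2 ≤ z) (h2 : z ≤ 2) :
    2 ^ (-|γ|) ≤ z ^ γ := by
  rw [Real.rpow_def_of_pos (show 0 < z by linarith), Real.rpow_def_of_pos two_pos]
  refine Real.exp_le_exp.2 ?_
  linarith [neg_le_of_abs_le (abs_mul_log_le γ h1 h2)]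

lemma mul_abs_sub_le_abs_rpow_sub_rpow (α : ℝ) {x y : ℝ} (hx : 1 / 2 ≤ x) (hx' : x ≤ 2)
    (hy : 1 / 2 ≤ y) (hy' : y ≤ 2) :
    |α| * 2 ^ (-|α - 1|) * |x - y| ≤ |x ^ α - y ^ α| := by
  wlog hxy : x < y generalizing x y
  · rcases eq_or_lt_of_le (not_lt.1 hxy) with rfl | h
    · simp
    · rw [abs_sub_comm x, abs_sub_comm (x ^ α)]
      exact this hy hy' hx hx' h
  obtain ⟨z, hz, hslope⟩ := exists_hasDerivAt_eq_slope (fun t : ℝ => t ^ α)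
    (fun t => α * t ^ (α - 1)) hxy
    (fun t ht => (Real.continuousAt_rpow_const t α
      (Or.inl (by linarith [ht.1]))).continuousWithinAt)
    (fun t ht => Real.hasDerivAt_rpow_const (Or.inl (by linarith [ht.1])))
  have hzpos : 0 < z := by linarith [hz.1]
  rw [eq_div_iff (sub_ne_zero.2 hxy.ne')] at hslope
  rw [abs_sub_comm x, abs_sub_comm (x ^ α), ← hslope, abs_mul, abs_mul,
    abs_of_pos (Real.rpow_pos_of_pos hzpos _)]
  gcongr
  exact two_rpow_neg_abs_le_rpow _ (by linarith [hz.1]) (by linarith [hz.2])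

/-- Pairs of integers in `[M, 2M)`. -/
noncomputable def dyadicPairs (M : ℝ) : Finset (ℤ × ℤ) :=
  Finset.Ico ⌈M⌉ ⌈2 * M⌉ ×ˢ Finset.Ico ⌈M⌉ ⌈2 * M⌉

lemma mem_dyadicPairs {M : ℝ} {p : ℤ × ℤ} :
    p ∈ dyadicPairs M ↔ (M ≤ p.1 ∧ (p.1 : ℝ) < 2 * M) ∧ (M ≤ p.2 ∧ (p.2 : ℝ) < 2 * M) := by
  simp [dyadicPairs, Int.ceil_le, Int.lt_ceil]

/-- Pairs of integers in `[M, 2M)` with greatest common divisor `d`. -/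
noncomputable def dyadicPairsGcd (M : ℝ) (d : ℕ) : Finset (ℤ × ℤ) :=
  (dyadicPairs M).filter fun p => Int.gcd p.1 p.2 = d

lemma gcd_mem_Icc {M : ℝ} (hM : 1 ≤ M) {p : ℤ × ℤ} (hp : p ∈ dyadicPairs M) :
    Int.gcd p.1 p.2 ∈ Finset.Icc 1 ⌊2 * M⌋₊ := by
  rw [mem_dyadicPairs] at hp
  have hpos : 0 < p.1 := by
    have : (0 : ℝ) < p.1 := by linarith [hp.1.1]
    exact_mod_cast this
  rw [Finset.mem_Icc]
  refine ⟨Int.gcd_pos_of_ne_zero_left _ hpos.ne', Nat.le_floor ?_⟩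
  have hle : (Int.gcd p.1 p.2 : ℤ) ≤ p.1 := Int.le_of_dvd hpos (Int.gcd_dvd_left ..)
  have hle' : (Int.gcd p.1 p.2 : ℝ) ≤ p.1 := by exact_mod_cast hle
  linarith [hp.1.2]

lemma ratio_mem_Icc {M : ℝ} (hM : 1 ≤ M) {p : ℤ × ℤ} (hp : p ∈ dyadicPairs M) :
    1 / 2 ≤ (p.2 / p.1 : ℝ) ∧ (p.2 / p.1 : ℝ) ≤ 2 := by
  rw [mem_dyadicPairs] at hp
  have hpos : (0 : ℝ) < p.1 := by linarith [hp.1.1]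
  rw [le_div_iff₀ hpos, div_le_iff₀ hpos]
  constructor <;> linarith [hp.1.1, hp.1.2, hp.2.1, hp.2.2]

lemma ratio_separated {M : ℝ} (hM : 1 ≤ M) {d : ℕ} (hd : 1 ≤ d) {p q : ℤ × ℤ}
    (hp : p ∈ dyadicPairsGcd M d) (hq : q ∈ dyadicPairsGcd M d) (hpq : p ≠ q) :
    (d : ℝ) ^ 2 / (4 * M ^ 2) ≤ |(p.2 / p.1 : ℝ) - q.2 / q.1| := by
  simp only [dyadicPairsGcd, Finset.mem_filter, mem_dyadicPairs] at hp hq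
  obtain ⟨⟨⟨hp1, hp1'⟩, hp2, hp2'⟩, hpd⟩ := hp
  obtain ⟨⟨⟨hq1, hq1'⟩, hq2, hq2'⟩, hqd⟩ := hq
  obtain ⟨a, b⟩ := p
  obtain ⟨a', b'⟩ := q
  simp only at *
  have hgp : 0 < Int.gcd a b := by omega
  have hgq : 0 < Int.gcd a' b' := by omega
  obtain ⟨u, v, huv, hau, hbv⟩ := Int.exists_gcd_one hgp
  obtain ⟨u', v', huv', hau', hbv'⟩ := Int.exists_gcd_one hgq
  rw [hpd] at hau hbv
  rw [hqd] at hau' hbv'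
  subst hau hbv hau' hbv'
  have hdR : (0 : ℝ) < d := by exact_mod_cast hd
  push_cast at *
  have hu : (0 : ℝ) < u := pos_of_mul_pos_left (lt_of_lt_of_le (by linarith) hp1) hdR.le
  have hu' : (0 : ℝ) < u' := pos_of_mul_pos_left (lt_of_lt_of_le (by linarith) hq1) hdR.le
  have hne : v * u' - u * v' ≠ 0 := by
    intro h0
    apply hpq
    have huZ : 0 < u := by exact_mod_cast hu
    have huZ' : 0 < u' := by exact_mod_cast hu'
    have h1 : u ∣ u' := by
      refine IsCoprime.dvd_of_dvd_mul_left (Int.isCoprime_iff_gcd_eq_one.2 huv) ⟨v', ?_⟩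
      linarith
    have h2 : u' ∣ u := by
      refine IsCoprime.dvd_of_dvd_mul_left (Int.isCoprime_iff_gcd_eq_one.2 huv') ⟨v, ?_⟩
      linarith
    have h3 : u = u' := Int.dvd_antisymm huZ.le huZ'.le h1 h2
    subst h3
    have h4 : u * (v - v') = 0 := by linarith
    have h5 : v = v' := by
      rcases mul_eq_zero.1 h4 with h | h <;> omega
    rw [h5]
  have hone : (1 : ℝ) ≤ |(v * u' - u * v' : ℝ)| := by
    exact_mod_cast Int.one_le_abs hne
  rw [mul_div_mul_right _ _ hdR.ne', mul_div_mul_right _ _ hdR.ne',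
    div_sub_div _ _ hu.ne' hu'.ne', abs_div, abs_of_pos (mul_pos hu hu'),
    div_le_div_iff₀ (by positivity) (mul_pos hu hu')]
  have hprod : (u * d) * (u' * d) ≤ (2 * M) * (2 * M) := by gcongr
  nlinarith [sq_nonneg M, sq_nonneg (d : ℝ)]

lemma exists_card_dyadicPairsGcd_le {α : ℝ} (hα : α ≠ 0) :
    ∃ K : ℝ, 0 < K ∧ ∀ M : ℝ, 1 ≤ M → ∀ d ∈ Finset.Icc 1 ⌊2 * M⌋₊,
      ((dyadicPairsGcd M d).card : ℝ) ≤ K * (M / d) ^ 2 ∧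
      ∀ Θ y : ℝ, 0 < Θ →
        (((dyadicPairsGcd M d).filter fun p => |((p.2 / p.1 : ℝ)) ^ α - y| < Θ).card : ℝ) ≤
          1 + K * Θ * (M / d) ^ 2 := by
  set c : ℝ := |α| * 2 ^ (-|α - 1|) with hc
  have hcpos : 0 < c := mul_pos (abs_pos.2 hα) (by positivity)
  set B : ℝ := 2 ^ |α| + 1 with hB
  have hB1 : 1 ≤ B := by
    have : (0 : ℝ) < 2 ^ |α| := by positivity
    linarith
  refine ⟨4 + 8 * B / c, by positivity, fun M hM d hd => ?_⟩
  rw [Finset.mem_Icc] at hd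
  have hd0 : (0 : ℝ) < d := by exact_mod_cast hd.1
  have hM0 : 0 < M := by linarith
  have hdM : (d : ℝ) ≤ 2 * M := (Nat.le_floor_iff (by positivity)).1 hd.2
  have near : ∀ Θ y : ℝ, 0 < Θ →
      (((dyadicPairsGcd M d).filter fun p => |((p.2 / p.1 : ℝ)) ^ α - y| < Θ).card : ℝ) ≤
        1 + 8 * Θ / c * (M / d) ^ 2 := by
    intro Θ y hΘ
    refine (card_near_le_of_separated _ (fun p : ℤ × ℤ => (p.2 / p.1 : ℝ) ^ α)
      (δ := c * ((d : ℝ) ^ 2 / (4 * M ^ 2))) (by positivity) hΘ ?_ y).trans_eq ?_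
    · intro p hp q hq hpq
      have hp' := ratio_mem_Icc hM (Finset.mem_filter.1 hp).1
      have hq' := ratio_mem_Icc hM (Finset.mem_filter.1 hq).1
      refine le_trans ?_ (mul_abs_sub_le_abs_rpow_sub_rpow α hp'.1 hp'.2 hq'.1 hq'.2)
      gcongr
      exact ratio_separated hM hd.1 hp hq hpq
    · field_simp
      ring
  constructor
  · have h := near B 0 (by positivity)
    rw [Finset.filter_true_of_mem] at h
    · refine h.trans ?_
      have : 1 ≤ 4 * (M / d) ^ 2 := by
        have : 1 ≤ 2 * (M / d) := by
          rw [← mul_div_assoc, one_le_div hd0]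
          exact hdM
        nlinarith
      linarith
    · intro p hp
      have hp' := ratio_mem_Icc hM (Finset.mem_filter.1 hp).1
      rw [sub_zero, abs_of_nonneg (Real.rpow_nonneg (by linarith [hp'.1]) _)]
      linarith [rpow_le_two_rpow_abs α hp'.1 hp'.2]
  · intro Θ y hΘ
    refine (near Θ y hΘ).trans ?_
    have : 8 * Θ / c ≤ (4 + 8 * B / c) * Θ := by
      have h1 : 8 * Θ / c * 1 ≤ 8 * Θ / c * B := by gcongr
      have h2 : (4 + 8 * B / c) * Θ = 4 * Θ + 8 * Θ / c * B := by ring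
      linarith
    gcongr

lemma sum_Ioc_inv_sq_le_two_div (k n : ℕ) : ∑ e ∈ Finset.Ioc k n, ((e : ℝ) ^ 2)⁻¹ ≤ 2 / (k + 1) := by
  rw [← Finset.Ioo_succ_right_eq_Ioc]
  exact sum_Ioo_inv_sq_le k _

lemma sum_min_sq_le {s N : ℝ} (hs : 0 < s) (hN : 0 < N) (n : ℕ) :
    ∑ e ∈ Finset.Icc 1 n, min (s ^ 2) ((N / e) ^ 2) ≤ 3 * s * N := by
  set k := ⌊N / s⌋₊ with hk
  have hkle : (k : ℝ) ≤ N / s := Nat.floor_le (by positivity)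
  have hklt : N / s < k + 1 := Nat.lt_floor_add_one _
  calc ∑ e ∈ Finset.Icc 1 n, min (s ^ 2) ((N / e) ^ 2)
      ≤ ∑ e ∈ Finset.Icc 1 k ∪ Finset.Ioc k n, min (s ^ 2) ((N / e) ^ 2) := by
        refine Finset.sum_le_sum_of_subset_of_nonneg ?_ fun _ _ _ => by positivity
        intro e he
        simp only [Finset.mem_union, Finset.mem_Icc, Finset.mem_Ioc] at *
        omega
    _ ≤ ∑ e ∈ Finset.Icc 1 k, min (s ^ 2) ((N / e) ^ 2) +
        ∑ e ∈ Finset.Ioc k n, min (s ^ 2) ((N / e) ^ 2) := by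
        rw [← Finset.sum_union_inter]
        exact le_add_of_nonneg_right (Finset.sum_nonneg fun _ _ => by positivity)
    _ ≤ ∑ e ∈ Finset.Icc 1 k, s ^ 2 + ∑ e ∈ Finset.Ioc k n, N ^ 2 * ((e : ℝ) ^ 2)⁻¹ := by
        gcongr with e _ e _
        · exact min_le_left _ _
        · refine (min_le_right _ _).trans_eq ?_
          rw [div_pow, div_eq_mul_inv]
    _ ≤ N / s * s ^ 2 + N ^ 2 * (2 / (N / s)) := by
        rw [← Finset.mul_sum, Finset.sum_const, Nat.card_Icc, nsmul_eq_mul]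
        gcongr
        · simpa using hkle
        · refine (sum_Ioc_inv_sq_le_two_div k n).trans ?_
          gcongr
    _ = 3 * s * N := by
        field_simp
        ring

lemma sum_div_sq_le {N : ℝ} (n : ℕ) : ∑ e ∈ Finset.Icc 1 n, (N / e) ^ 2 ≤ 2 * N ^ 2 := by
  have h := sum_Ioc_inv_sq_le_two_div 0 n
  simp only [div_pow, div_eq_mul_inv (N ^ 2), ← Finset.mul_sum]
  have h' : ∑ e ∈ Finset.Icc 1 n, ((e : ℝ) ^ 2)⁻¹ ≤ 2 := by
    simpa [← Finset.Icc_succ_left_eq_Ioc] using h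
  nlinarith [sq_nonneg N]

lemma sum_inv_le_log {M : ℝ} (hM : 1 ≤ M) :
    ∑ d ∈ Finset.Icc 1 ⌊2 * M⌋₊, ((d : ℝ))⁻¹ ≤ 3 * Real.log (2 * M) := by
  have h := harmonic_floor_le_one_add_log (2 * M) (by linarith)
  rw [harmonic_eq_sum_Icc] at h
  push_cast at h
  have h2 : Real.log 2 ≤ Real.log (2 * M) := Real.log_le_log two_pos (by linarith)
  linarith [Real.log_two_gt_d9]

/-- **Lemma 2.2 (Fouvry–Iwaniec).** The number of quadruples `(m, m̃, n, ñ)` with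
`M ≤ m, m̃ < 2M`, `N ≤ n, ñ < 2N` and `|(m̃/m)^α − (ñ/n)^β| < Θ` is
`≪ MN log(2MN) + Θ M²N²`. -/
theorem count_multiplicative_quadruples (α β : ℝ) (hα : α ≠ 0) (hβ : β ≠ 0) :
    ∃ C : ℝ, 0 < C ∧ ∀ Θ M N : ℝ, 0 < Θ → 1 ≤ M → 1 ≤ N →
      (Set.ncard {q : ℤ × ℤ × ℤ × ℤ |
          (M ≤ (q.1 : ℝ) ∧ (q.1 : ℝ) < 2 * M) ∧
          (M ≤ (q.2.1 : ℝ) ∧ (q.2.1 : ℝ) < 2 * M) ∧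
          (N ≤ (q.2.2.1 : ℝ) ∧ (q.2.2.1 : ℝ) < 2 * N) ∧
          (N ≤ (q.2.2.2 : ℝ) ∧ (q.2.2.2 : ℝ) < 2 * N) ∧
          |((q.2.1 : ℝ) / (q.1 : ℝ)) ^ α - ((q.2.2.2 : ℝ) / (q.2.2.1 : ℝ)) ^ β| < Θ} : ℝ) ≤
        C * (M * N * Real.log (2 * M * N) + Θ * M ^ 2 * N ^ 2) := by
  classical
  obtain ⟨K, hK, hKα⟩ := exists_card_dyadicPairsGcd_le hα
  obtain ⟨L, hL, hLβ⟩ := exists_card_dyadicPairsGcd_le hβ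
  refine ⟨9 * (K + L) + 4 * K * L, by positivity, fun Θ M N hΘ hM hN => ?_⟩
  have hM0 : 0 < M := by linarith
  have hN0 : 0 < N := by linarith
  let r : ℤ × ℤ → ℤ × ℤ → Prop := fun p q =>
    |(p.2 / p.1 : ℝ) ^ α - (q.2 / q.1 : ℝ) ^ β| < Θ
  set T := (dyadicPairs M ×ˢ dyadicPairs N).filter fun z => r z.1 z.2 with hT
  have hcard : Set.ncard {q : ℤ × ℤ × ℤ × ℤ |
          (M ≤ (q.1 : ℝ) ∧ (q.1 : ℝ) < 2 * M) ∧
          (M ≤ (q.2.1 : ℝ) ∧ (q.2.1 : ℝ) < 2 * M) ∧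
          (N ≤ (q.2.2.1 : ℝ) ∧ (q.2.2.1 : ℝ) < 2 * N) ∧
          (N ≤ (q.2.2.2 : ℝ) ∧ (q.2.2.2 : ℝ) < 2 * N) ∧
          |((q.2.1 : ℝ) / (q.1 : ℝ)) ^ α - ((q.2.2.2 : ℝ) / (q.2.2.1 : ℝ)) ^ β| < Θ} ≤
      T.card := by
    refine le_trans ?_ (Finset.card_image_le (s := T)
      (f := fun z => (z.1.1, z.1.2, z.2.1, z.2.2)))
    rw [← Set.ncard_coe_finset]
    refine Set.ncard_le_ncard ?_ (Finset.finite_toSet _)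
    rintro ⟨a, b, c, d⟩ ⟨h1, h2, h3, h4, h5⟩
    rw [Finset.mem_coe, Finset.mem_image]
    refine ⟨((a, b), (c, d)), ?_, rfl⟩
    rw [hT, Finset.mem_filter, Finset.mem_product, mem_dyadicPairs, mem_dyadicPairs]
    exact ⟨⟨⟨h1, h2⟩, h3, h4⟩, h5⟩
  have hfib : T.card = ∑ x ∈ Finset.Icc 1 ⌊2 * M⌋₊ ×ˢ Finset.Icc 1 ⌊2 * N⌋₊,
      ((dyadicPairsGcd M x.1 ×ˢ dyadicPairsGcd N x.2).filter fun z => r z.1 z.2).card := by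
    rw [Finset.card_eq_sum_card_fiberwise
      (f := fun z => (Int.gcd z.1.1 z.1.2, Int.gcd z.2.1 z.2.2))
      (t := Finset.Icc 1 ⌊2 * M⌋₊ ×ˢ Finset.Icc 1 ⌊2 * N⌋₊)]
    · refine Finset.sum_congr rfl fun x _ => congrArg Finset.card ?_
      ext z
      simp only [hT, dyadicPairsGcd, Finset.mem_filter, Finset.mem_product, Prod.ext_iff]
      tauto
    · intro z hz
      rw [hT, Finset.mem_coe, Finset.mem_filter, Finset.mem_product] at hz
      exact Finset.mem_coe.2 (Finset.mem_product.2 ⟨gcd_mem_Icc hM hz.1.1, gcd_mem_Icc hN hz.1.2⟩)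
  have hpair : ∀ d ∈ Finset.Icc 1 ⌊2 * M⌋₊, ∀ e ∈ Finset.Icc 1 ⌊2 * N⌋₊,
      (((dyadicPairsGcd M d ×ˢ dyadicPairsGcd N e).filter fun z => r z.1 z.2).card : ℝ) ≤
        (K + L) * min ((M / d) ^ 2) ((N / e) ^ 2) + K * L * Θ * ((M / d) ^ 2 * (N / e) ^ 2) := by
    intro d hd e he
    obtain ⟨hcM, hnM⟩ := hKα M hM d hd
    obtain ⟨hcN, hnN⟩ := hLβ N hN e he
    have hleft := card_filter_product_le (dyadicPairsGcd M d) (dyadicPairsGcd N e) r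
      (c := 1 + L * Θ * (N / e) ^ 2) fun p _ => by
        simpa only [r, abs_sub_comm] using hnN Θ ((p.2 / p.1 : ℝ) ^ α) hΘ
    have hright := card_filter_product_le (dyadicPairsGcd N e) (dyadicPairsGcd M d)
      (fun q p => r p q) (c := 1 + K * Θ * (M / d) ^ 2) fun q _ =>
        hnM Θ ((q.2 / q.1 : ℝ) ^ β) hΘ
    have hswap : ((dyadicPairsGcd M d ×ˢ dyadicPairsGcd N e).filter fun z => r z.1 z.2).card =
        ((dyadicPairsGcd N e ×ˢ dyadicPairsGcd M d).filter fun z => r z.2 z.1).card := by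
      refine Finset.card_equiv (Equiv.prodComm _ _) fun z => ?_
      simp only [Finset.mem_filter, Finset.mem_product, Equiv.prodComm_apply, Prod.fst_swap,
        Prod.snd_swap]
      tauto
    have hA : 0 ≤ (M / d) ^ 2 := by positivity
    have hB : 0 ≤ (N / e) ^ 2 := by positivity
    rcases min_choice ((M / d) ^ 2) ((N / e) ^ 2) with h | h <;> rw [h]
    · have h1 : ((dyadicPairsGcd M d).card : ℝ) * (1 + L * Θ * (N / e) ^ 2) ≤
          K * (M / d) ^ 2 * (1 + L * Θ * (N / e) ^ 2) := by gcongr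
      have h2 : 0 ≤ L * (M / d) ^ 2 := by positivity
      linarith
    · rw [hswap]
      have h1 : ((dyadicPairsGcd N e).card : ℝ) * (1 + K * Θ * (M / d) ^ 2) ≤
          L * (N / e) ^ 2 * (1 + K * Θ * (M / d) ^ 2) := by gcongr
      have h2 : 0 ≤ K * (N / e) ^ 2 := by positivity
      linarith
  have hmin : ∑ d ∈ Finset.Icc 1 ⌊2 * M⌋₊, ∑ e ∈ Finset.Icc 1 ⌊2 * N⌋₊,
      min ((M / (d : ℝ)) ^ 2) ((N / (e : ℝ)) ^ 2) ≤ 9 * (M * N * Real.log (2 * M * N)) := by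
    calc _ ≤ ∑ d ∈ Finset.Icc 1 ⌊2 * M⌋₊, 3 * (M * N) * (d : ℝ)⁻¹ := by
          refine Finset.sum_le_sum fun d hd => ?_
          have hd0 : (0 : ℝ) < d := by exact_mod_cast (Finset.mem_Icc.1 hd).1
          refine (sum_min_sq_le (div_pos hM0 hd0) hN0 _).trans_eq ?_
          ring
      _ ≤ 3 * (M * N) * (3 * Real.log (2 * M * N)) := by
          rw [← Finset.mul_sum]
          gcongr
          refine (sum_inv_le_log hM).trans ?_
          have : Real.log (2 * M) ≤ Real.log (2 * M * N) :=
            Real.log_le_log (by linarith) (le_mul_of_one_le_right (by linarith) hN)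
          linarith
      _ = _ := by ring
  have hprod : ∑ d ∈ Finset.Icc 1 ⌊2 * M⌋₊, ∑ e ∈ Finset.Icc 1 ⌊2 * N⌋₊,
      (M / (d : ℝ)) ^ 2 * (N / (e : ℝ)) ^ 2 ≤ 4 * (M ^ 2 * N ^ 2) := by
    rw [← Finset.sum_mul_sum]
    calc _ ≤ (2 * M ^ 2) * (2 * N ^ 2) :=
          mul_le_mul (sum_div_sq_le _) (sum_div_sq_le _)
            (Finset.sum_nonneg fun _ _ => by positivity) (by positivity)
      _ = _ := by ring
  have hlog : 0 ≤ Real.log (2 * M * N) := Real.log_nonneg (by nlinarith)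
  calc _ ≤ (T.card : ℝ) := by exact_mod_cast hcard
    _ ≤ ∑ d ∈ Finset.Icc 1 ⌊2 * M⌋₊, ∑ e ∈ Finset.Icc 1 ⌊2 * N⌋₊,
        ((K + L) * min ((M / (d : ℝ)) ^ 2) ((N / (e : ℝ)) ^ 2) +
          K * L * Θ * ((M / (d : ℝ)) ^ 2 * (N / (e : ℝ)) ^ 2)) := by
        rw [hfib, Finset.sum_product]
        push_cast
        exact Finset.sum_le_sum fun d hd => Finset.sum_le_sum fun e he => hpair d hd e he
    _ ≤ (K + L) * (9 * (M * N * Real.log (2 * M * N))) + K * L * Θ * (4 * (M ^ 2 * N ^ 2)) := by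
        simp only [Finset.sum_add_distrib, ← Finset.mul_sum]
        simp only [← Finset.mul_sum] at hprod
        gcongr
    _ ≤ _ := by
        have h1 : 0 ≤ 4 * K * L * (M * N * Real.log (2 * M * N)) := by positivity
        have h2 : 0 ≤ 9 * (K + L) * (Θ * M ^ 2 * N ^ 2) := by positivity
        linarith
end

section
/- Let N be a natural number, 𝔅 ⊆ {N+1, …, 2N}, and X ≥ 1 a real number. Then the number of ordered pairs (b, b₁) ∈ 𝔅 × 𝔅 with |√b − √b₁| < (2X)^{−1} is at most (1 + 2√(2N)·X^{−1})·|𝔅|. -/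
open scoped Classical

/-- Naturals up to `M` whose square roots differ by less than `(2X)⁻¹` differ by at most
`√M X⁻¹`. -/
theorem abs_sub_le_of_abs_sqrt_sub_lt {a b M : ℕ} {X : ℝ} (hX : 0 < X) (ha : a ≤ M) (hb : b ≤ M)
    (h : |Real.sqrt a - Real.sqrt b| < (2 * X)⁻¹) :
    |(a : ℝ) - b| ≤ Real.sqrt M * X⁻¹ := by
  have hfactor : (a : ℝ) - b = (Real.sqrt a - Real.sqrt b) * (Real.sqrt a + Real.sqrt b) := by
    have h₁ := Real.mul_self_sqrt (Nat.cast_nonneg (α := ℝ) a)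
    have h₂ := Real.mul_self_sqrt (Nat.cast_nonneg (α := ℝ) b)
    linarith
  have ha' : Real.sqrt a ≤ Real.sqrt M := Real.sqrt_le_sqrt (by exact_mod_cast ha)
  have hb' : Real.sqrt b ≤ Real.sqrt M := Real.sqrt_le_sqrt (by exact_mod_cast hb)
  have hsum : 0 ≤ Real.sqrt a + Real.sqrt b := by positivity
  calc |(a : ℝ) - b| = |Real.sqrt a - Real.sqrt b| * (Real.sqrt a + Real.sqrt b) := by
        rw [hfactor, abs_mul, abs_of_nonneg hsum]
    _ ≤ (2 * X)⁻¹ * (2 * Real.sqrt M) := by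
        gcongr
        linarith
    _ = Real.sqrt M * X⁻¹ := by field_simp

/-- **Lemma 2.3 (Iwaniec–Sárközy).** The number of pairs `(b, b₁) ∈ 𝔅 × 𝔅` with
`|√b − √b₁| < (2X)⁻¹` is at most `(1 + 2√(2N) X⁻¹)|𝔅|`. -/
theorem close_sqrt_pairs_count (N : ℕ) (B : Finset ℕ)
    (hB : B ⊆ Finset.Icc (N + 1) (2 * N)) (X : ℝ) (hX : 1 ≤ X) :
    (((B ×ˢ B).filter
        (fun p => |Real.sqrt p.1 - Real.sqrt p.2| < (2 * X)⁻¹)).card : ℝ) ≤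
      (1 + 2 * Real.sqrt (2 * N) * X⁻¹) * B.card := by
  have hX₀ : 0 < X := by linarith
  set L : ℝ := Real.sqrt (2 * N) * X⁻¹ with hL
  have hL₀ : 0 ≤ L := by positivity
  have hcard : ((B ×ˢ B).filter
      (fun p => |Real.sqrt p.1 - Real.sqrt p.2| < (2 * X)⁻¹)).card
      ≤ (2 * ⌊L⌋₊ + 1) * B.card := by
    refine Finset.card_le_mul_card_image_of_maps_to (f := Prod.fst) ?_ _ fun b _ => ?_
    · intro p hp
      exact (Finset.mem_product.1 (Finset.mem_filter.1 hp).1).1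
    · calc _ ≤ (Finset.Icc (b - ⌊L⌋₊) (b + ⌊L⌋₊)).card := by
            refine Finset.card_le_card_of_injOn Prod.snd ?_ ?_
            · rintro ⟨a, c⟩ hp
              simp only [Finset.coe_filter, Finset.mem_filter, Finset.mem_product,
                Set.mem_ofPred_eq] at hp
              obtain ⟨⟨⟨ha, hc⟩, hlt⟩, rfl⟩ := hp
              have hdist := abs_le.1 (abs_sub_le_of_abs_sqrt_sub_lt hX₀
                (Finset.mem_Icc.1 (hB ha)).2 (Finset.mem_Icc.1 (hB hc)).2 hlt)
              push_cast at hdist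
              rw [← hL] at hdist
              have h₁ : a - c ≤ ⌊L⌋₊ := by
                refine Nat.le_floor ?_
                rcases le_total c a with h | h
                · rw [Nat.cast_sub h]
                  exact hdist.2
                · simpa [Nat.sub_eq_zero_of_le h] using hL₀
              have h₂ : c - a ≤ ⌊L⌋₊ := by
                refine Nat.le_floor ?_
                rcases le_total a c with h | h
                · rw [Nat.cast_sub h]
                  linarith [hdist.1]
                · simpa [Nat.sub_eq_zero_of_le h] using hL₀
              simp only [Finset.coe_Icc, Set.mem_Icc]
              omega
            · rintro ⟨a, c⟩ hp ⟨a', c'⟩ hp' h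
              exact Prod.ext ((Finset.mem_filter.1 hp).2.trans (Finset.mem_filter.1 hp').2.symm) h
        _ ≤ 2 * ⌊L⌋₊ + 1 := by
            rw [Nat.card_Icc]
            omega
  calc _ ≤ (((2 * ⌊L⌋₊ + 1) * B.card : ℕ) : ℝ) := by exact_mod_cast hcard
    _ = (2 * (⌊L⌋₊ : ℝ) + 1) * B.card := by push_cast; ring
    _ ≤ (2 * L + 1) * B.card := by
        gcongr
        exact Nat.floor_le hL₀
    _ = _ := by rw [hL]; ring
end
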